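/- Every positive integer n with n ≡ 0 (mod 5) that can be written as a sum of three squares of integers can also be written as a sum of three nonunit squares, except for n = 5, 10, 30, 35, and 235. That is, if 5 ∣ n, n = a² + b² + c² for some integers a, b, c, and n ∉ {5, 10, 30, 35, 235}, then there exist integers x, y, z with n = x² + y² + z² and x² ≠ 1, y² ≠ 1, z² ≠ 1. -/

import Mathlib

namespace NonunitSquares

/-- The integer `n` is a sum of three nonunit squares. -/
def HasNonunitRep (n : ℤ) : Prop :=
  ∃ x y z : ℤ, n = x ^ 2 + y ^ 2 + z ^ 2 ∧ x ^ 2 ≠ 1 ∧ y ^ 2 ≠ 1 ∧ z ^ 2 ≠ 1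

/-- The shape of the representations of a number without nonunit representation. -/
def UnitShape (x y z : ℤ) : Prop :=
  x ^ 2 = 1 ∧ (5 : ℤ) ∣ y ∧ (z ^ 2 = 4 ∨ z ^ 2 = 9)

lemma sq_ne_one_of_ne {x : ℤ} (h1 : x ≠ 1) (h2 : x ≠ -1) : x ^ 2 ≠ 1 := by
  intro h
  have : (x - 1) * (x + 1) = 0 := by linear_combination h
  rcases mul_eq_zero.mp this with h | h <;> omega

lemma hasNonunitRep_of_ne {n x y z : ℤ} (h : n = x ^ 2 + y ^ 2 + z ^ 2)
    (hx : x ≠ 1 ∧ x ≠ -1) (hy : y ≠ 1 ∧ y ≠ -1) (hz : z ≠ 1 ∧ z ≠ -1) : HasNonunitRep n :=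
  ⟨x, y, z, h, sq_ne_one_of_ne hx.1 hx.2, sq_ne_one_of_ne hy.1 hy.2, sq_ne_one_of_ne hz.1 hz.2⟩

lemma rotate_unit {n k c : ℤ} (hbad : ¬ HasNonunitRep n) (h : n = 1 + (5 * k) ^ 2 + c ^ 2)
    (hc : c % 5 = 3) : c ^ 2 = 4 ∨ c ^ 2 = 9 := by
  obtain ⟨e, rfl⟩ : ∃ e, c = 5 * e + 3 := ⟨c / 5, by omega⟩
  by_cases h0 : e = 0
  · right; subst h0; norm_num
  by_cases h1 : e = -1
  · left; subst h1; norm_num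
  refine absurd (hasNonunitRep_of_ne (x := 5 * k) (y := 4 * e + 3) (z := -3 * e - 1) ?_ ?_ ?_ ?_)
    hbad
  · rw [h]; ring
  all_goals omega

lemma unitShape_of_sq_eq_one {n a b c : ℤ} (hbad : ¬ HasNonunitRep n) (h5 : (5 : ℤ) ∣ n)
    (h : n = a ^ 2 + b ^ 2 + c ^ 2) (ha : a ^ 2 = 1) : UnitShape a b c ∨ UnitShape a c b := by
  have key : ∀ b c : ℤ, n = 1 + b ^ 2 + c ^ 2 → (5 : ℤ) ∣ b → (c % 5 = 2 ∨ c % 5 = 3) →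
      UnitShape a b c := by
    rintro b c h ⟨k, rfl⟩ hc
    refine ⟨ha, dvd_mul_right _ _, ?_⟩
    rcases hc with hc | hc
    · have := rotate_unit (c := -c) (k := k) hbad (by rw [h]; ring) (by omega)
      simpa using this
    · exact rotate_unit hbad h hc
  rw [ha] at h
  have hmod : (1 + b ^ 2 + c ^ 2) % 5 = 0 := by omega
  have hb : b % 5 = 0 ∨ b % 5 = 1 ∨ b % 5 = 2 ∨ b % 5 = 3 ∨ b % 5 = 4 := by omega
  have hc : c % 5 = 0 ∨ c % 5 = 1 ∨ c % 5 = 2 ∨ c % 5 = 3 ∨ c % 5 = 4 := by omega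
  have h2 : n = 1 + c ^ 2 + b ^ 2 := by rw [h]; ring
  rcases hb with hb | hb | hb | hb | hb <;> rcases hc with hc | hc | hc | hc | hc <;>
    first
    | exact Or.inl (key b c h (Int.dvd_of_emod_eq_zero hb) (by omega))
    | exact Or.inr (key c b h2 (Int.dvd_of_emod_eq_zero hc) (by omega))
    | (exfalso; simp [pow_two, Int.add_emod, Int.mul_emod, hb, hc] at hmod)

lemma unitShape_of_rep {n a b c : ℤ} (hbad : ¬ HasNonunitRep n) (h5 : (5 : ℤ) ∣ n)
    (h : n = a ^ 2 + b ^ 2 + c ^ 2) :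
    (UnitShape a b c ∨ UnitShape a c b) ∨ (UnitShape b a c ∨ UnitShape b c a) ∨
      (UnitShape c a b ∨ UnitShape c b a) := by
  by_cases ha : a ^ 2 = 1
  · exact Or.inl (unitShape_of_sq_eq_one hbad h5 h ha)
  by_cases hb : b ^ 2 = 1
  · exact Or.inr (Or.inl (unitShape_of_sq_eq_one hbad h5 (by rw [h]; ring) hb))
  by_cases hc : c ^ 2 = 1
  · exact Or.inr (Or.inr (unitShape_of_sq_eq_one hbad h5 (by rw [h]; ring) hc))
  exact absurd ⟨a, b, c, h, ha, hb, hc⟩ hbad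

lemma eq_five_or_ten {n a b c : ℤ} (hbad : ¬ HasNonunitRep n) (h5 : (5 : ℤ) ∣ n)
    (h : n = a ^ 2 + b ^ 2 + c ^ 2) : ∃ k : ℕ, n = 25 * (k : ℤ) ^ 2 + 5 ∨ n = 25 * (k : ℤ) ^ 2 + 10 := by
  have key : ∀ a b c : ℤ, n = a ^ 2 + b ^ 2 + c ^ 2 → UnitShape a b c →
      ∃ k : ℕ, n = 25 * (k : ℤ) ^ 2 + 5 ∨ n = 25 * (k : ℤ) ^ 2 + 10 := by
    rintro a b c h ⟨ha, ⟨k, rfl⟩, hc⟩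
    refine ⟨k.natAbs, ?_⟩
    rw [Int.natCast_natAbs, sq_abs, h, ha]
    rcases hc with hc | hc <;> rw [hc]
    · left; ring
    · right; ring
  rcases unitShape_of_rep hbad h5 h with (h' | h') | (h' | h') | (h' | h')
  · exact key _ _ _ h h'
  · exact key _ _ _ (by rw [h]; ring) h'
  · exact key _ _ _ (by rw [h]; ring) h'
  · exact key _ _ _ (by rw [h]; ring) h'
  · exact key _ _ _ (by rw [h]; ring) h'
  · exact key _ _ _ (by rw [h]; ring) h'

/-- A multiple of five, sum of three squares, that has no nonunit representation is either one of
the exceptions or lies in a quadratic family. -/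
theorem exists_eq_of_not_hasNonunitRep {n a b c : ℤ} (hbad : ¬ HasNonunitRep n) (h5 : (5 : ℤ) ∣ n)
    (h : n = a ^ 2 + b ^ 2 + c ^ 2) :
    n = 5 ∨ n = 30 ∨ n = 35 ∨ ∃ j : ℕ, n = 225 * (j : ℤ) ^ 2 + 10 := by
  obtain ⟨k, hk⟩ := eq_five_or_ten hbad h5 h
  have h3 : ∃ j : ℕ, k = 3 * j ∨ k = 3 * j + 1 ∨ k = 3 * j + 2 := ⟨k / 3, by omega⟩
  obtain ⟨j, h3⟩ := h3
  by_contra! hne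
  obtain ⟨n5, n30, n35, hj⟩ := hne
  apply hbad
  rcases hk with hk | hk <;> rcases h3 with rfl | rfl | rfl <;> push_cast at hk
  · have j0 : (j : ℤ) ≠ 0 := by
      intro j0; rw [j0] at hk; exact n5 (by simpa using hk)
    apply hasNonunitRep_of_ne (x := 5 * j - 2) (y := -10 * j - 1) (z := -10 * j)
    · rw [hk]; ring
    all_goals omega
  · have j0 : (j : ℤ) ≠ 0 := by
      intro j0; rw [j0] at hk; exact n30 (by simpa using hk)
    apply hasNonunitRep_of_ne (x := 5 * j + 1) (y := 10 * j + 5) (z := -10 * j - 2)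
    · rw [hk]; ring
    all_goals omega
  · apply hasNonunitRep_of_ne (x := 5 * j + 4) (y := -10 * j - 5) (z := 10 * j + 8)
    · rw [hk]; ring
    all_goals omega
  · exact absurd (by rw [hk]; ring) (hj j)
  · have j0 : (j : ℤ) ≠ 0 := by
      intro j0; rw [j0] at hk; exact n35 (by simpa using hk)
    apply hasNonunitRep_of_ne (x := 5 * j + 3) (y := -10 * j - 1) (z := 10 * j + 5)
    · rw [hk]; ring
    all_goals omega
  · apply hasNonunitRep_of_ne (x := 5 * j + 2) (y := 10 * j + 9) (z := -10 * j - 5)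
    · rw [hk]; ring
    all_goals omega

end NonunitSquares

namespace NonunitSquares

/-- The integer `p` divides all coordinates of the quaternion product `star π * α`, where
`π = (a, b, c, d)` and `α = (t, x, y, z)`. -/
def DvdStarMul (p t x y z a b c d : ℤ) : Prop :=
  p ∣ a * t + b * x + c * y + d * z ∧ p ∣ a * x - b * t - c * z + d * y ∧
    p ∣ a * y - c * t - d * x + b * z ∧ p ∣ a * z - d * t - b * y + c * x

lemma dvdStarMul_of_two {p t x y z a b c d : ℤ} (hp : IsCoprime p (y ^ 2 + z ^ 2))
    (hα : p ∣ t ^ 2 + x ^ 2 + y ^ 2 + z ^ 2)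
    (h1 : p ∣ a * t + b * x + c * y + d * z) (h2 : p ∣ a * x - b * t - c * z + d * y) :
    DvdStarMul p t x y z a b c d := by
  refine ⟨h1, h2, ?_, ?_⟩
  · refine hp.dvd_of_dvd_mul_right ?_
    obtain ⟨u, hu⟩ := h1
    obtain ⟨v, hv⟩ := h2
    obtain ⟨w, hw⟩ := hα
    refine ⟨(a * y + b * z) * w - u * (t * y + x * z) - v * (x * y - t * z), ?_⟩
    linear_combination (-(t * y) - x * z) * hu + (-(x * y) + t * z) * hv + (a * y + b * z) * hw
  · refine hp.dvd_of_dvd_mul_right ?_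
    obtain ⟨u, hu⟩ := h1
    obtain ⟨v, hv⟩ := h2
    obtain ⟨w, hw⟩ := hα
    refine ⟨(a * z - b * y) * w - u * (t * z - x * y) - v * (t * y + x * z), ?_⟩
    linear_combination (-(t * z) + x * y) * hu - (t * y + x * z) * hv + (a * z - b * y) * hw

lemma eq_zero_of_four_sq_le {a b c d : ℤ} (h : a ^ 2 + b ^ 2 + c ^ 2 + d ^ 2 ≤ 0) :
    a = 0 ∧ b = 0 ∧ c = 0 ∧ d = 0 := by
  have ha := sq_nonneg a
  have hb := sq_nonneg b
  have hc := sq_nonneg c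
  have hd := sq_nonneg d
  refine ⟨?_, ?_, ?_, ?_⟩ <;> refine pow_eq_zero_iff two_ne_zero |>.mp ?_ <;> linarith

lemma abs_sub_le_sqrt {r : ℕ} {u v : ℕ} (hu : u < r + 1) (hv : v < r + 1) :
    ((u : ℤ) - v) ^ 2 ≤ (r : ℤ) ^ 2 := by
  apply sq_le_sq'  <;> omega

/-- A short nonzero vector in the lattice cut out by `DvdStarMul`. -/
lemma exists_short {p : ℕ} (hp : p.Prime) {t x y z : ℤ} (hc : IsCoprime (p : ℤ) (y ^ 2 + z ^ 2))
    (hα : (p : ℤ) ∣ t ^ 2 + x ^ 2 + y ^ 2 + z ^ 2) :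
    ∃ a b c d : ℤ, DvdStarMul p t x y z a b c d ∧ 0 < a ^ 2 + b ^ 2 + c ^ 2 + d ^ 2 ∧
      a ^ 2 + b ^ 2 + c ^ 2 + d ^ 2 < 4 * p := by
  have := Fact.mk hp
  set r := Nat.sqrt p with hr
  have hr1 : r * r < p := by
    rcases (Nat.sqrt_le p).lt_or_eq with h | h
    · exact h
    · exfalso
      have : IsSquare p := ⟨r, h.symm⟩
      exact hp.prime.not_isSquare this
  have hr2 : p < (r + 1) * (r + 1) := Nat.lt_succ_sqrt p
  let f : Fin (r + 1) × Fin (r + 1) × Fin (r + 1) × Fin (r + 1) → ZMod p × ZMod p := fun g =>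
    (((g.1.val * t + g.2.1.val * x + g.2.2.1.val * y + g.2.2.2.val * z : ℤ) : ZMod p),
      ((g.1.val * x - g.2.1.val * t - g.2.2.1.val * z + g.2.2.2.val * y : ℤ) : ZMod p))
  have hcard : Fintype.card (ZMod p × ZMod p) <
      Fintype.card (Fin (r + 1) × Fin (r + 1) × Fin (r + 1) × Fin (r + 1)) := by
    simp only [Fintype.card_prod, ZMod.card, Fintype.card_fin]
    calc p * p < ((r + 1) * (r + 1)) * ((r + 1) * (r + 1)) := Nat.mul_lt_mul'' hr2 hr2
      _ = _ := by ring
  obtain ⟨g, g', hne, hgg⟩ := Fintype.exists_ne_map_eq_of_card_lt f hcard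
  obtain ⟨a, b, c, d⟩ := g
  obtain ⟨a', b', c', d'⟩ := g'
  simp only [f, Prod.mk.injEq] at hgg
  obtain ⟨h1, h2⟩ := hgg
  rw [ZMod.intCast_eq_intCast_iff_dvd_sub] at h1 h2
  refine ⟨a'.val - a.val, b'.val - b.val, c'.val - c.val, d'.val - d.val,
    dvdStarMul_of_two hc hα ?_ ?_, ?_, ?_⟩
  · convert h1 using 1; ring
  · convert h2 using 1; ring
  · by_contra! h
    apply hne
    obtain ⟨e1, e2, e3, e4⟩ := eq_zero_of_four_sq_le h
    simp only [Prod.mk.injEq, Fin.ext_iff]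
    omega
  · have e1 := abs_sub_le_sqrt a'.2 a.2
    have e2 := abs_sub_le_sqrt b'.2 b.2
    have e3 := abs_sub_le_sqrt c'.2 c.2
    have e4 := abs_sub_le_sqrt d'.2 d.2
    have : (r : ℤ) * r < p := by exact_mod_cast hr1
    linarith [pow_two (r : ℤ)]

lemma dvd_norm_of_dvdStarMul {p t x y z a b c d : ℤ} (hc : IsCoprime p (y ^ 2 + z ^ 2))
    (h : DvdStarMul p t x y z a b c d) : p ∣ a ^ 2 + b ^ 2 + c ^ 2 + d ^ 2 := by
  obtain ⟨⟨u, hu⟩, ⟨v, hv⟩, ⟨w, hw⟩, ⟨k, hk⟩⟩ := h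
  have hy : p ∣ (a ^ 2 + b ^ 2 + c ^ 2 + d ^ 2) * y :=
    ⟨a * w + c * u + d * v - b * k, by
      linear_combination a * hw + c * hu + d * hv - b * hk⟩
  have hz : p ∣ (a ^ 2 + b ^ 2 + c ^ 2 + d ^ 2) * z :=
    ⟨a * k + d * u + b * w - c * v, by
      linear_combination a * hk + d * hu + b * hw - c * hv⟩
  refine hc.dvd_of_dvd_mul_right ?_
  have := (hy.mul_right y).add (hz.mul_right z)
  convert this using 1; ring

lemma norm_eq_of_two_mul {p : ℕ} (hp2 : IsCoprime (p : ℤ) 2) {t x y z a b c d : ℤ}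
    (h : DvdStarMul p t x y z a b c d) (hN : a ^ 2 + b ^ 2 + c ^ 2 + d ^ 2 = 2 * p) :
    ∃ a b c d : ℤ, DvdStarMul p t x y z a b c d ∧ a ^ 2 + b ^ 2 + c ^ 2 + d ^ 2 = p := by
  obtain ⟨⟨u, hu⟩, ⟨v, hv⟩, ⟨w, hw⟩, ⟨k, hk⟩⟩ := h
  have hpar : (a + b + c + d) % 2 = 0 := by
    have := congrArg (· % 2) hN
    rcases Int.emod_two_eq_zero_or_one a with ha | ha <;>
      rcases Int.emod_two_eq_zero_or_one b with hb | hb <;>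
      rcases Int.emod_two_eq_zero_or_one c with hc | hc <;>
      rcases Int.emod_two_eq_zero_or_one d with hd | hd <;>
      simp [pow_two, Int.add_emod, Int.mul_emod, ha, hb, hc, hd] at this ⊢
  have hcase : (a % 2 = b % 2 ∧ c % 2 = d % 2) ∨ (a % 2 = c % 2 ∧ b % 2 = d % 2) ∨
      (a % 2 = d % 2 ∧ b % 2 = c % 2) := by omega
  rcases hcase with ⟨h1, h2⟩ | ⟨h1, h2⟩ | ⟨h1, h2⟩
  · obtain ⟨e, rfl⟩ : ∃ e, a = b + 2 * e := ⟨(a - b) / 2, by omega⟩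
    obtain ⟨f, rfl⟩ : ∃ f, c = d + 2 * f := ⟨(c - d) / 2, by omega⟩
    refine ⟨b + e, -e, f, d + f, ⟨?_, ?_, ?_, ?_⟩, by linarith⟩ <;>
      refine hp2.dvd_of_dvd_mul_left ?_
    · exact ⟨u - v, by linear_combination hu - hv⟩
    · exact ⟨u + v, by linear_combination hu + hv⟩
    · exact ⟨w - k, by linear_combination hw - hk⟩
    · exact ⟨w + k, by linear_combination hw + hk⟩
  · obtain ⟨e, rfl⟩ : ∃ e, a = c + 2 * e := ⟨(a - c) / 2, by omega⟩
    obtain ⟨f, rfl⟩ : ∃ f, b = d + 2 * f := ⟨(b - d) / 2, by omega⟩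
    refine ⟨c + e, d + f, -e, -f, ⟨?_, ?_, ?_, ?_⟩, by linarith⟩ <;>
      refine hp2.dvd_of_dvd_mul_left ?_
    · exact ⟨u - w, by linear_combination hu - hw⟩
    · exact ⟨v + k, by linear_combination hv + hk⟩
    · exact ⟨u + w, by linear_combination hu + hw⟩
    · exact ⟨k - v, by linear_combination hk - hv⟩
  · obtain ⟨e, rfl⟩ : ∃ e, a = d + 2 * e := ⟨(a - d) / 2, by omega⟩
    obtain ⟨f, rfl⟩ : ∃ f, b = c + 2 * f := ⟨(b - c) / 2, by omega⟩
    refine ⟨d + e, f, c + f, -e, ⟨?_, ?_, ?_, ?_⟩, by linarith⟩ <;>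
      refine hp2.dvd_of_dvd_mul_left ?_
    · exact ⟨u - k, by linear_combination hu - hk⟩
    · exact ⟨v - w, by linear_combination hv - hw⟩
    · exact ⟨v + w, by linear_combination hv + hw⟩
    · exact ⟨u + k, by linear_combination hu + hk⟩

lemma exists_small_residue_three (a : ℤ) : ∃ g e : ℤ, a = g + 3 * e ∧ g ^ 2 ≤ 1 := by
  have : a % 3 = 0 ∨ a % 3 = 1 ∨ a % 3 = 2 := by omega
  rcases this with h | h | h
  · exact ⟨0, a / 3, by omega, by norm_num⟩
  · exact ⟨1, a / 3, by omega, by norm_num⟩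
  · exact ⟨-1, a / 3 + 1, by omega, by norm_num⟩

lemma norm_eq_of_three_mul {p : ℕ} (hp3 : IsCoprime (p : ℤ) 3) {t x y z a b c d : ℤ}
    (h : DvdStarMul p t x y z a b c d) (hN : a ^ 2 + b ^ 2 + c ^ 2 + d ^ 2 = 3 * p) :
    ∃ a b c d : ℤ, DvdStarMul p t x y z a b c d ∧ a ^ 2 + b ^ 2 + c ^ 2 + d ^ 2 = p := by
  obtain ⟨⟨u, hu⟩, ⟨v, hv⟩, ⟨w, hw⟩, ⟨k, hk⟩⟩ := h
  obtain ⟨g0, a, rfl, h0⟩ := exists_small_residue_three a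
  obtain ⟨g1, b, rfl, h1⟩ := exists_small_residue_three b
  obtain ⟨g2, c, rfl, h2⟩ := exists_small_residue_three c
  obtain ⟨g3, d, rfl, h3⟩ := exists_small_residue_three d
  have hg : (g0 ^ 2 + g1 ^ 2 + g2 ^ 2 + g3 ^ 2) =
      3 * (p - 2 * (g0 * a + g1 * b + g2 * c + g3 * d) - 3 * (a ^ 2 + b ^ 2 + c ^ 2 + d ^ 2)) := by
    linear_combination hN
  have hg3 : g0 ^ 2 + g1 ^ 2 + g2 ^ 2 + g3 ^ 2 = 3 := by
    have hnn : 0 ≤ g0 ^ 2 + g1 ^ 2 + g2 ^ 2 + g3 ^ 2 := by positivity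
    have : g0 ^ 2 + g1 ^ 2 + g2 ^ 2 + g3 ^ 2 ≠ 0 := by
      intro h
      obtain ⟨e0, e1, e2, e3⟩ := eq_zero_of_four_sq_le h.le
      subst e0 e1 e2 e3
      have hdvd : (3 : ℤ) ∣ p := ⟨a ^ 2 + b ^ 2 + c ^ 2 + d ^ 2, by linarith⟩
      have := hp3.isUnit_of_dvd' hdvd dvd_rfl
      rw [Int.isUnit_iff] at this
      omega
    omega
  refine ⟨1 + (a * g0 + b * g1 + c * g2 + d * g3), -a * g1 + b * g0 - c * g3 + d * g2,
    -a * g2 + c * g0 - d * g1 + b * g3, -a * g3 + d * g0 - b * g2 + c * g1, ⟨?_, ?_, ?_, ?_⟩, ?_⟩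
  · refine hp3.dvd_of_dvd_mul_left ⟨g0 * u - g1 * v - g2 * w - g3 * k, ?_⟩
    linear_combination g0 * hu - g1 * hv - g2 * hw - g3 * hk - t * hg3
  · refine hp3.dvd_of_dvd_mul_left ⟨g0 * v + g1 * u + g2 * k - g3 * w, ?_⟩
    linear_combination g0 * hv + g1 * hu + g2 * hk - g3 * hw - x * hg3
  · refine hp3.dvd_of_dvd_mul_left ⟨g0 * w + g2 * u + g3 * v - g1 * k, ?_⟩
    linear_combination g0 * hw + g2 * hu + g3 * hv - g1 * hk - y * hg3
  · refine hp3.dvd_of_dvd_mul_left ⟨g0 * k + g3 * u + g1 * w - g2 * v, ?_⟩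
    linear_combination g0 * hk + g3 * hu + g1 * hw - g2 * hv - z * hg3
  · have h9 : (9 : ℤ) * ((1 + (a * g0 + b * g1 + c * g2 + d * g3)) ^ 2 +
      (-a * g1 + b * g0 - c * g3 + d * g2) ^ 2 + (-a * g2 + c * g0 - d * g1 + b * g3) ^ 2 +
      (-a * g3 + d * g0 - b * g2 + c * g1) ^ 2) = 9 * p := by
      have e : (9 : ℤ) * p = 3 * p * (g0 ^ 2 + g1 ^ 2 + g2 ^ 2 + g3 ^ 2) := by rw [hg3]; ring
      have e1 : (3 : ℤ) * (1 + (a * g0 + b * g1 + c * g2 + d * g3)) =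
        (g0 + 3 * a) * g0 + (g1 + 3 * b) * g1 + (g2 + 3 * c) * g2 + (g3 + 3 * d) * g3 := by
        linear_combination -hg3
      rw [e, ← hN]
      calc _ = ((3 : ℤ) * (1 + (a * g0 + b * g1 + c * g2 + d * g3))) ^ 2 +
        9 * ((-a * g1 + b * g0 - c * g3 + d * g2) ^ 2 + (-a * g2 + c * g0 - d * g1 + b * g3) ^ 2 +
          (-a * g3 + d * g0 - b * g2 + c * g1) ^ 2) := by ring
        _ = _ := by rw [e1]; ring
    linarith

/-- A quaternion of norm divisible by `p` has a left divisor of norm `p`. -/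
lemma exists_norm_eq {p : ℕ} (hp : p.Prime) (hp2 : p ≠ 2) (hp3 : p ≠ 3) {t x y z : ℤ}
    (hc : IsCoprime (p : ℤ) (y ^ 2 + z ^ 2)) (hα : (p : ℤ) ∣ t ^ 2 + x ^ 2 + y ^ 2 + z ^ 2) :
    ∃ a b c d : ℤ, DvdStarMul p t x y z a b c d ∧ a ^ 2 + b ^ 2 + c ^ 2 + d ^ 2 = p := by
  obtain ⟨a, b, c, d, h, h0, h4⟩ := exists_short hp hc hα
  obtain ⟨k, hk⟩ := dvd_norm_of_dvdStarMul hc h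
  have hp0 : (0 : ℤ) < p := by exact_mod_cast hp.pos
  have hk0 : 0 < k := by
    by_contra! hk0
    nlinarith
  have hk4 : k < 4 := by
    by_contra! hk4
    nlinarith
  have cop : ∀ q : ℕ, q.Prime → p ≠ q → IsCoprime (p : ℤ) (q : ℤ) := fun q hq hne =>
    Nat.isCoprime_iff_coprime.mpr ((Nat.coprime_primes hp hq).mpr hne)
  have c2 := cop 2 Nat.prime_two hp2
  have c3 := cop 3 Nat.prime_three hp3
  obtain rfl | rfl | rfl : k = 1 ∨ k = 2 ∨ k = 3 := by omega
  · exact ⟨a, b, c, d, h, by linarith⟩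
  · exact norm_eq_of_two_mul c2 h (by linarith)
  · exact norm_eq_of_three_mul c3 h (by linarith)

end NonunitSquares

namespace NonunitSquares

/-- Conjugating by a quaternion of norm `p` produces a new representation. -/
lemma exists_conj {p : ℤ} (hp : p ≠ 0) {t x y z a b c d : ℤ} (h : DvdStarMul p t x y z a b c d)
    (hN : a ^ 2 + b ^ 2 + c ^ 2 + d ^ 2 = p) :
    ∃ V₁ V₂ V₃ : ℤ, V₁ ^ 2 + V₂ ^ 2 + V₃ ^ 2 = x ^ 2 + y ^ 2 + z ^ 2 ∧
      x * b + y * c + z * d = b * V₁ + c * V₂ + d * V₃ ∧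
      x * a + y * d - z * c = a * V₁ + c * V₃ - d * V₂ ∧
      y * a + z * b - x * d = a * V₂ + d * V₁ - b * V₃ ∧
      z * a + x * c - y * b = a * V₃ + b * V₂ - c * V₁ := by
  obtain ⟨⟨u, hu⟩, ⟨v, hv⟩, ⟨w, hw⟩, ⟨k, hk⟩⟩ := h
  have hp2 : p ^ 2 ≠ 0 := pow_ne_zero 2 hp
  have hr : u * a - v * b - w * c - k * d = t := by
    apply mul_left_cancel₀ hp
    linear_combination -a * hu + b * hv + c * hw + d * hk + t * hN
  refine ⟨u * b + v * a + w * d - k * c, u * c + w * a + k * b - v * d,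
    u * d + k * a + v * c - w * b, ?_, ?_, ?_, ?_, ?_⟩
  · apply mul_left_cancel₀ hp
    have e : p ^ 2 * (u ^ 2 + v ^ 2 + w ^ 2 + k ^ 2) = p * (t ^ 2 + x ^ 2 + y ^ 2 + z ^ 2) := by
      have : p ^ 2 * (u ^ 2 + v ^ 2 + w ^ 2 + k ^ 2) =
        (p * u) ^ 2 + (p * v) ^ 2 + (p * w) ^ 2 + (p * k) ^ 2 := by ring
      rw [this, ← hu, ← hv, ← hw, ← hk, ← hN]; ring
    have e2 : (u * b + v * a + w * d - k * c) ^ 2 + (u * c + w * a + k * b - v * d) ^ 2 +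
        (u * d + k * a + v * c - w * b) ^ 2 + (u * a - v * b - w * c - k * d) ^ 2 =
        p * (u ^ 2 + v ^ 2 + w ^ 2 + k ^ 2) := by rw [← hN]; ring
    rw [hr] at e2
    linear_combination p * e2 + e
  · linear_combination hu - u * hN + a * hr
  · linear_combination hv - v * hN - b * hr
  · linear_combination hw - w * hN - c * hr
  · linear_combination hk - k * hN - d * hr

/-- The vector `V` is carried to `± v` by a quaternion of norm `1`, `2` or `4`. -/
def IsAssociate (x y z V₁ V₂ V₃ : ℤ) : Prop :=
  ∃ a b c d e : ℤ, (e = 1 ∨ e = -1) ∧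
    (a ^ 2 + b ^ 2 + c ^ 2 + d ^ 2 = 1 ∨ a ^ 2 + b ^ 2 + c ^ 2 + d ^ 2 = 2 ∨
      a ^ 2 + b ^ 2 + c ^ 2 + d ^ 2 = 4) ∧
    V₁ * b + V₂ * c + V₃ * d = e * (b * x + c * y + d * z) ∧
      V₁ * a + V₂ * d - V₃ * c = e * (a * x + c * z - d * y) ∧
      V₂ * a + V₃ * b - V₁ * d = e * (a * y + d * x - b * z) ∧
      V₃ * a + V₁ * c - V₂ * b = e * (a * z + b * y - c * x)

lemma IsAssociate.neg_left {x y z u v w : ℤ} (h : IsAssociate x y z u v w) :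
    IsAssociate x y z (-u) v w := by
  obtain ⟨a, b, c, d, e, he, hN, h1, h2, h3, h4⟩ := h
  have hs : (-b) ^ 2 + (a) ^ 2 + (-d) ^ 2 + (c) ^ 2 =
      a ^ 2 + b ^ 2 + c ^ 2 + d ^ 2 := by ring
  refine ⟨-b, a, -d, c, -e, by omega, by rwa [hs], ?_, ?_, ?_, ?_⟩
  · linear_combination -h2
  · linear_combination h1
  · linear_combination h4
  · linear_combination -h3

lemma IsAssociate.neg_mid {x y z u v w : ℤ} (h : IsAssociate x y z u v w) :
    IsAssociate x y z u (-v) w := by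
  obtain ⟨a, b, c, d, e, he, hN, h1, h2, h3, h4⟩ := h
  have hs : (-c) ^ 2 + (d) ^ 2 + (a) ^ 2 + (-b) ^ 2 =
      a ^ 2 + b ^ 2 + c ^ 2 + d ^ 2 := by ring
  refine ⟨-c, d, a, -b, -e, by omega, by rwa [hs], ?_, ?_, ?_, ?_⟩
  · linear_combination -h3
  · linear_combination -h4
  · linear_combination h1
  · linear_combination h2

lemma IsAssociate.neg_right {x y z u v w : ℤ} (h : IsAssociate x y z u v w) :
    IsAssociate x y z u v (-w) := by
  obtain ⟨a, b, c, d, e, he, hN, h1, h2, h3, h4⟩ := h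
  have hs : (-d) ^ 2 + (-c) ^ 2 + (b) ^ 2 + (a) ^ 2 =
      a ^ 2 + b ^ 2 + c ^ 2 + d ^ 2 := by ring
  refine ⟨-d, -c, b, a, -e, by omega, by rwa [hs], ?_, ?_, ?_, ?_⟩
  · linear_combination -h4
  · linear_combination h3
  · linear_combination -h2
  · linear_combination h1

lemma isAssociate_perm (x y z : ℤ) : IsAssociate x y z x y z ∧ IsAssociate x y z x z y ∧
    IsAssociate x y z y x z ∧ IsAssociate x y z y z x ∧ IsAssociate x y z z x y ∧
    IsAssociate x y z z y x := by
  refine ⟨⟨1, 0, 0, 0, 1, ?_⟩, ⟨0, 0, 1, -1, -1, ?_⟩, ⟨0, 1, -1, 0, -1, ?_⟩, ⟨1, -1, -1, -1, 1, ?_⟩,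
    ⟨1, 1, 1, 1, 1, ?_⟩, ⟨0, 1, 0, -1, -1, ?_⟩⟩ <;> norm_num <;> (try ring_nf) <;> (try tauto)

lemma isAssociate_of_sq {x y z U V W X Y Z : ℤ} (h : IsAssociate x y z X Y Z)
    (hX : U ^ 2 = X ^ 2) (hY : V ^ 2 = Y ^ 2) (hZ : W ^ 2 = Z ^ 2) : IsAssociate x y z U V W := by
  rcases sq_eq_sq_iff_eq_or_eq_neg.mp hX with rfl | rfl <;>
    rcases sq_eq_sq_iff_eq_or_eq_neg.mp hY with rfl | rfl <;>
    rcases sq_eq_sq_iff_eq_or_eq_neg.mp hZ with rfl | rfl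
  · exact h
  · exact h.neg_right
  · exact h.neg_mid
  · exact h.neg_mid.neg_right
  · exact h.neg_left
  · exact h.neg_left.neg_right
  · exact h.neg_left.neg_mid
  · exact h.neg_left.neg_mid.neg_right

lemma isAssociate_of_rep {j : ℕ} (hbad : ¬ HasNonunitRep (225 * (j : ℤ) ^ 2 + 10)) {a b c : ℤ}
    (h : 225 * (j : ℤ) ^ 2 + 10 = a ^ 2 + b ^ 2 + c ^ 2) : IsAssociate (15 * j) 1 3 a b c := by
  have key : ∀ a b c : ℤ, 225 * (j : ℤ) ^ 2 + 10 = a ^ 2 + b ^ 2 + c ^ 2 → UnitShape a b c →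
      a ^ 2 = 1 ^ 2 ∧ b ^ 2 = (15 * j) ^ 2 ∧ c ^ 2 = 3 ^ 2 := by
    rintro a b c h ⟨ha, ⟨k, rfl⟩, hc⟩
    rcases hc with hc | hc
    · exfalso
      have : 5 * (45 * (j : ℤ) ^ 2 + 1 - 5 * k ^ 2) = 0 := by linear_combination h + ha + hc
      omega
    · exact ⟨by linarith, by linear_combination -h - ha - hc, by linarith⟩
  obtain ⟨p1, p2, p3, p4, p5, p6⟩ := isAssociate_perm (15 * (j : ℤ)) 1 3
  rcases unitShape_of_rep hbad ⟨45 * (j : ℤ) ^ 2 + 2, by ring⟩ h with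
    (h' | h') | (h' | h') | (h' | h')
  · obtain ⟨h1, h2, h3⟩ := key _ _ _ h h'
    exact isAssociate_of_sq p3 h1 h2 h3
  · obtain ⟨h1, h2, h3⟩ := key _ _ _ (by rw [h]; ring) h'
    exact isAssociate_of_sq p4 h1 h3 h2
  · obtain ⟨h1, h2, h3⟩ := key _ _ _ (by rw [h]; ring) h'
    exact isAssociate_of_sq p1 h2 h1 h3
  · obtain ⟨h1, h2, h3⟩ := key _ _ _ (by rw [h]; ring) h'
    exact isAssociate_of_sq p6 h3 h1 h2
  · obtain ⟨h1, h2, h3⟩ := key _ _ _ (by rw [h]; ring) h'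
    exact isAssociate_of_sq p2 h2 h3 h1
  · obtain ⟨h1, h2, h3⟩ := key _ _ _ (by rw [h]; ring) h'
    exact isAssociate_of_sq p5 h3 h2 h1

lemma not_sq_eq_prime_mul {p : ℕ} (hp : p.Prime) (hp2 : p ≠ 2) {A N : ℤ}
    (hN : N = 1 ∨ N = 2 ∨ N = 4) (h : A ^ 2 = p * N) : False := by
  have hpI : Prime (p : ℤ) := Nat.prime_iff_prime_int.mp hp
  obtain ⟨B, rfl⟩ : (p : ℤ) ∣ A := hpI.dvd_of_dvd_pow ⟨N, h⟩
  have h1 : (p : ℤ) * B ^ 2 = N := by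
    apply mul_left_cancel₀ hpI.ne_zero
    linear_combination h
  have h2 : (p : ℤ) ∣ 2 ^ 2 := by
    rcases hN with rfl | rfl | rfl
    · exact ⟨B ^ 2 * 4, by linear_combination -4 * h1⟩
    · exact ⟨B ^ 2 * 2, by linear_combination -2 * h1⟩
    · exact ⟨B ^ 2, by linear_combination -h1⟩
  have h3 := hpI.dvd_of_dvd_pow h2
  have h4 : p ∣ 2 := by exact_mod_cast h3
  exact hp2 ((Nat.prime_dvd_prime_iff_eq hp Nat.prime_two).mp h4)

lemma bound_of_commute {p : ℕ} (hp : p.Prime) (hp2 : p ≠ 2) {j A B C D N : ℤ}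
    (hN : N = 1 ∨ N = 2 ∨ N = 4) (hnorm : A ^ 2 + B ^ 2 + C ^ 2 + D ^ 2 = p * N)
    (h1 : D = 3 * C) (h2 : B = 15 * j * C) : 5 * j ^ 2 ≤ p := by
  subst h1 h2
  have hp0 : (0 : ℤ) < p := by exact_mod_cast hp.pos
  by_cases hC : C = 0
  · subst hC
    exact (not_sq_eq_prime_mul (A := A) hp hp2 hN (by linear_combination hnorm)).elim
  · have hC1 : 1 ≤ C ^ 2 := by
      have := sq_nonneg C
      have : C ^ 2 ≠ 0 := pow_ne_zero 2 hC
      omega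
    have hb : (225 * j ^ 2 + 10) * 1 ≤ (225 * j ^ 2 + 10) * C ^ 2 :=
      mul_le_mul_of_nonneg_left hC1 (by positivity)
    have hb2 : (p : ℤ) * N ≤ 4 * p := by rcases hN with rfl | rfl | rfl <;> linarith
    nlinarith [sq_nonneg A, sq_nonneg j]

lemma bound_of_anticommute {p : ℕ} (hp : p.Prime) (hp5 : p ≠ 5) {j B C D N : ℤ}
    (hN : N = 1 ∨ N = 2 ∨ N = 4) (hnorm : B ^ 2 + C ^ 2 + D ^ 2 = p * N)
    (h1 : 15 * j * B + C + 3 * D = 0) : 5 * j ^ 2 ≤ p := by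
  have hp0 : (0 : ℤ) < p := by exact_mod_cast hp.pos
  have hpI : Prime (p : ℤ) := Nat.prime_iff_prime_int.mp hp
  by_cases hB : B = 0
  · subst hB
    obtain rfl : C = -3 * D := by linarith
    exfalso
    have h5 : (5 : ℤ) ∣ p * N := ⟨2 * D ^ 2, by linear_combination -hnorm⟩
    rcases (Nat.prime_iff_prime_int.mp Nat.prime_five).dvd_or_dvd h5 with h | h
    · have h' : 5 ∣ p := by exact_mod_cast h
      exact hp5 ((Nat.prime_dvd_prime_iff_eq Nat.prime_five hp).mp h').symm
    · rcases hN with rfl | rfl | rfl <;> norm_num at h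
  · have hB1 : 1 ≤ B ^ 2 := by
      have := sq_nonneg B
      have : B ^ 2 ≠ 0 := pow_ne_zero 2 hB
      omega
    have hb : (225 * j ^ 2) * 1 ≤ (225 * j ^ 2) * B ^ 2 :=
      mul_le_mul_of_nonneg_left hB1 (by positivity)
    have hb2 : (p : ℤ) * N ≤ 4 * p := by rcases hN with rfl | rfl | rfl <;> linarith
    have e : 225 * j ^ 2 * B ^ 2 = (C + 3 * D) ^ 2 := by
      have : 15 * j * B = -(C + 3 * D) := by linarith
      calc _ = (15 * j * B) ^ 2 := by ring
        _ = _ := by rw [this]; ring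
    nlinarith [sq_nonneg (3 * C - D), sq_nonneg j]

/-- If `225 j² + 10` has no nonunit representation, then `-(225 j² + 10)` is not a square modulo
any small odd prime other than five. -/
theorem le_of_dvd_sq_add {j : ℕ} (hbad : ¬ HasNonunitRep (225 * (j : ℤ) ^ 2 + 10)) {p : ℕ}
    (hp : p.Prime) (hp2 : p ≠ 2) (hp5 : p ≠ 5) {t : ℤ}
    (ht : (p : ℤ) ∣ t ^ 2 + (225 * (j : ℤ) ^ 2 + 10)) : 5 * j ^ 2 ≤ p := by
  have hp3 : p ≠ 3 := by
    rintro rfl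
    have h3 : t % 3 = 0 ∨ t % 3 = 1 ∨ t % 3 = 2 := by omega
    have h0 : (t ^ 2 + 1) % 3 = 0 := by omega
    rcases h3 with h | h | h <;> simp [pow_two, Int.add_emod, Int.mul_emod, h] at h0
  have hc : IsCoprime (p : ℤ) (1 ^ 2 + 3 ^ 2) := by
    have h10 : (1 ^ 2 + 3 ^ 2 : ℤ) = ((2 * 5 : ℕ) : ℤ) := by norm_num
    rw [h10, Nat.isCoprime_iff_coprime]
    exact Nat.Coprime.mul_right ((Nat.coprime_primes hp Nat.prime_two).mpr hp2)
      ((Nat.coprime_primes hp Nat.prime_five).mpr hp5)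
  have hα : (p : ℤ) ∣ t ^ 2 + (15 * (j : ℤ)) ^ 2 + 1 ^ 2 + 3 ^ 2 := by
    convert ht using 1; ring
  obtain ⟨a, b, c, d, h, hN⟩ := exists_norm_eq hp hp2 hp3 hc hα
  obtain ⟨V₁, V₂, V₃, hV, h1, h2, h3, h4⟩ :=
    exists_conj (by exact_mod_cast hp.ne_zero) h hN
  obtain ⟨a', b', c', d', e, he, hN', k1, k2, k3, k4⟩ :=
    isAssociate_of_rep hbad (a := V₁) (b := V₂) (c := V₃) (by rw [hV]; ring)
  have hnorm : (a * a' - b * b' - c * c' - d * d') ^ 2 + (a * b' + b * a' + c * d' - d * c') ^ 2 +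
      (a * c' + c * a' + d * b' - b * d') ^ 2 + (a * d' + d * a' + b * c' - c * b') ^ 2 =
      p * (a' ^ 2 + b' ^ 2 + c' ^ 2 + d' ^ 2) := by
    rw [← hN]; ring
  have hgoal : (5 : ℤ) * (j : ℤ) ^ 2 ≤ p := by
    rcases he with rfl | rfl
    · refine bound_of_commute hp hp2 hN' hnorm ?_ ?_
      · have : 2 * ((a * d' + d * a' + b * c' - c * b') - 3 * (a * c' + c * a' + d * b' - b * d')) = 0 := by
          linear_combination b' * (-h1) + a' * h2 + d' * h3 - c' * h4 + a * k2 + b * (-k1) + c * k4 - d * k3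
        linarith
      · have : 2 * (15 * (j : ℤ) * (a * c' + c * a' + d * b' - b * d') - (a * b' + b * a' + c * d' - d * c')) = 0 := by
          linear_combination d' * (-h1) + a' * h4 + c' * h2 - b' * h3 + a * k4 + d * (-k1) + b * k3 - c * k2
        linarith
    · have hA : 2 * (a * a' - b * b' - c * c' - d * d') = 0 := by
        linear_combination c' * (-h1) + a' * h3 + b' * h4 - d' * h2 + a * k3 + c * (-k1) + d * k2 - b * k4
      have hA' : (a * a' - b * b' - c * c' - d * d') = 0 := by linarith
      have h0 : -2 * (15 * (j : ℤ) * (a * b' + b * a' + c * d' - d * c') + (a * c' + c * a' + d * b' - b * d') + 3 * (a * d' + d * a' + b * c' - c * b')) = 0 := by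
        linear_combination a' * (-h1) - b' * h2 - c' * h3 - d' * h4 + a * (-k1) - b * k2 - c * k3 - d * k4
      rw [hA', zero_pow two_ne_zero, zero_add] at hnorm
      exact bound_of_anticommute hp hp5 hN' hnorm (by linarith)
  exact_mod_cast hgoal

end NonunitSquares

namespace NonunitSquares

/-- The arithmetic properties of a large member `n = 225 j² + 10` of the quadratic family that has no
nonunit representation. -/
structure IsExceptional (n : ℕ) : Prop where
  large : 10 ^ 6 ≤ n
  mod_eight : n % 8 = 3 ∨ n % 4 = 2
  five_dvd : 5 ∣ n
  not_dvd : ¬ 25 ∣ n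
  le_prime : ∀ p : ℕ, p.Prime → p ≠ 2 → p ≠ 5 → ∀ t : ℤ, (p : ℤ) ∣ t ^ 2 + n → n ≤ 49 * p

lemma isExceptional_of_not_hasNonunitRep {j : ℕ} (hj : 100 ≤ j)
    (hbad : ¬ HasNonunitRep (225 * (j : ℤ) ^ 2 + 10)) : IsExceptional (225 * j ^ 2 + 10) where
  large := by nlinarith
  mod_eight := by
    have h : j % 8 < 8 := Nat.mod_lt _ (by norm_num)
    have e : j = 8 * (j / 8) + j % 8 := (Nat.div_add_mod j 8).symm
    generalize j / 8 = k at e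
    generalize j % 8 = r at e h
    subst e
    interval_cases r <;> ring_nf <;> omega
  five_dvd := ⟨45 * j ^ 2 + 2, by ring⟩
  not_dvd := by omega
  le_prime := by
    intro p hp h2 h5 t ht
    have := le_of_dvd_sq_add hbad hp h2 h5 (t := t) (by push_cast at ht; exact ht)
    have := hp.two_le
    omega

/-- Reduction of positive definite binary quadratic forms. -/
lemma exists_reduced (n : ℤ) (hn : 0 < n) : ∀ (k : ℕ) (a b c : ℤ), 0 < a → a ≤ k →
    a * c - b ^ 2 = n → ∃ p q r s : ℤ, p * s - q * r = 1 ∧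
      0 < a * p ^ 2 + 2 * b * p * r + c * r ^ 2 ∧
      2 * |a * p * q + b * (p * s + q * r) + c * r * s| ≤ a * p ^ 2 + 2 * b * p * r + c * r ^ 2 ∧
      3 * (a * p ^ 2 + 2 * b * p * r + c * r ^ 2) ^ 2 ≤ 4 * n := by
  intro k
  induction k with
  | zero => intro a b c h0 h1; push_cast at h1; omega
  | succ k ih =>
    intro a b c ha hak hdet
    push_cast at hak
    obtain ⟨e, he⟩ : ∃ e : ℤ, 2 * |b + a * e| ≤ a := by
      refine ⟨-((2 * b + a) / (2 * a)), ?_⟩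
      have h1 := Int.emod_add_mul_ediv (2 * b + a) (2 * a)
      have h2 := Int.emod_nonneg (2 * b + a) (show 2 * a ≠ 0 by omega)
      have h3 := Int.emod_lt_of_pos (2 * b + a) (show 0 < 2 * a by omega)
      have h4 : |2 * (b + a * -((2 * b + a) / (2 * a)))| ≤ a := by
        rw [abs_le]
        constructor <;> nlinarith
      rwa [abs_mul, abs_two] at h4
    obtain ⟨b', hb'⟩ : ∃ b', b' = b + a * e := ⟨_, rfl⟩
    obtain ⟨c', hc'⟩ : ∃ c', c' = a * e ^ 2 + 2 * b * e + c := ⟨_, rfl⟩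
    rw [← hb'] at he
    have hdet' : a * c' - b' ^ 2 = n := by rw [hb', hc', ← hdet]; ring
    by_cases hac : a ≤ c'
    · refine ⟨1, e, 0, 1, by ring, by linarith, ?_, ?_⟩
      · rw [show a * 1 * e + b * (1 * 1 + e * 0) + c * 0 * 1 = b' by rw [hb']; ring,
          show a * 1 ^ 2 + 2 * b * 1 * 0 + c * 0 ^ 2 = a by ring]
        exact he
      · have h4 : 4 * b' ^ 2 ≤ a ^ 2 := by
          have := abs_nonneg b'
          have h5 : (2 * |b'|) ^ 2 ≤ a ^ 2 := pow_le_pow_left₀ (by positivity) he 2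
          rw [mul_pow, sq_abs] at h5
          linarith
        have : a * a ≤ a * c' := mul_le_mul_of_nonneg_left hac ha.le
        ring_nf
        ring_nf at this h4 hdet'
        linarith
    · push Not at hac
      have hc0 : 0 < c' := by
        by_contra! h
        nlinarith [sq_nonneg b', mul_nonneg ha.le (neg_nonneg.mpr h)]
      obtain ⟨p, q, r, s, h1, h2, h3, h4⟩ := ih c' (-b') a hc0 (by omega) (by linarith)
      have e1 : a * (-r + e * p) ^ 2 + 2 * b * (-r + e * p) * p + c * p ^ 2 =
          c' * p ^ 2 + 2 * -b' * p * r + a * r ^ 2 := by rw [hb', hc']; ring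
      have e2 : a * (-r + e * p) * (-s + e * q) + b * ((-r + e * p) * q + (-s + e * q) * p) +
          c * p * q = c' * p * q + -b' * (p * s + q * r) + a * r * s := by rw [hb', hc']; ring
      refine ⟨-r + e * p, -s + e * q, p, q, by linear_combination h1, ?_, ?_, ?_⟩
      · rwa [e1]
      · rwa [e1, e2]
      · rwa [e1]

/-- First and middle coefficients of the reduced forms of determinant `n`. -/
def forms (n : ℕ) : Finset (ℤ × ℤ) :=
  if n % 2 = 1 then {(1, 0), (5, 0), (4, 1), (4, -1), (20, 5), (20, -5)}
  else {(1, 0), (5, 0), (2, 0), (10, 0)}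

lemma not_even_of_forms {n : ℕ} {A B : ℤ} (h : (A, B) ∈ forms n) :
    (n % 2 = 1 ∧ ((A = 1 ∧ B = 0) ∨ (A = 5 ∧ B = 0) ∨ (A = 4 ∧ B = 1) ∨ (A = 4 ∧ B = -1) ∨
      (A = 20 ∧ B = 5) ∨ (A = 20 ∧ B = -5))) ∨
    (n % 2 = 0 ∧ ((A = 1 ∧ B = 0) ∨ (A = 5 ∧ B = 0) ∨ (A = 2 ∧ B = 0) ∨ (A = 10 ∧ B = 0))) := by
  unfold forms at h
  split_ifs at h with h1
  · left; exact ⟨h1, by simpa using h⟩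
  · right; exact ⟨by omega, by simpa using h⟩

lemma IsExceptional.dvd_of_mem_forms {n : ℕ} (hn : IsExceptional n) {A B : ℤ}
    (h : (A, B) ∈ forms n) : A ∣ n + B ^ 2 := by
  have h8 := hn.mod_eight
  have h5 := hn.five_dvd
  have h25 := hn.not_dvd
  rcases not_even_of_forms h with ⟨h2, h | h | h | h | h | h⟩ | ⟨h2, h | h | h | h⟩ <;>
    obtain ⟨rfl, rfl⟩ := h <;> omega

lemma IsExceptional.mem_forms {n : ℕ} (hn : IsExceptional n) {A B C : ℤ} (hA : 0 < A)
    (hB : 2 * |B| ≤ A) (hA2 : 3 * A ^ 2 ≤ 4 * n) (hdet : A * C = n + B ^ 2)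
    (hodd : ¬ (Even A ∧ Even C)) : (A, B) ∈ forms n := by
  have h8 := hn.mod_eight
  have h5 := hn.five_dvd
  have h25 := hn.not_dvd
  have hlarge := hn.large
  have hB5 : (5 : ℤ) ∣ A → (5 : ℤ) ∣ B := by
    rintro ⟨a, rfl⟩
    obtain ⟨m, rfl⟩ := h5
    refine (Nat.prime_iff_prime_int.mp Nat.prime_five).dvd_of_dvd_pow
      (n := 2) ⟨a * C - m, ?_⟩
    push_cast at hdet ⊢
    linear_combination -hdet
  have hsq : B ^ 2 % 4 = 0 ∧ B % 2 = 0 ∨ B ^ 2 % 8 = 1 ∧ B % 2 = 1 := by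
    obtain ⟨k, hk⟩ | ⟨k, hk⟩ := Int.even_or_odd B
    · left; subst hk; ring_nf; omega
    · right
      obtain ⟨i, hi⟩ | ⟨i, hi⟩ := Int.even_or_odd k <;> subst hk hi <;> ring_nf <;> omega
  have hdvd : A.natAbs ∣ 20 := by
    rw [Nat.dvd_iff_prime_pow_dvd_dvd]
    intro p k hp hpk
    rcases Nat.eq_zero_or_pos k with rfl | hk
    · simp
    have hpA' : (p : ℤ) ∣ A := by
      have : p ∣ A.natAbs := (dvd_pow_self p hk.ne').trans hpk
      exact Int.natCast_dvd.mpr this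
    by_cases hp2 : p = 2
    · subst hp2
      by_contra hcon
      have hk3 : 3 ≤ k := by
        by_contra! hk3
        interval_cases k <;> norm_num at hcon
      have h8A : (8 : ℤ) ∣ A := by
        have : 2 ^ 3 ∣ A.natAbs := (pow_dvd_pow 2 hk3).trans hpk
        exact Int.natCast_dvd.mpr this
      obtain ⟨a, rfl⟩ := h8A
      rw [mul_assoc] at hdet
      generalize a * C = u at hdet
      rcases hsq with hsq | hsq
      · omega
      · rcases h8 with h8 | h8 <;> omega
    by_cases hp5 : p = 5
    · subst hp5
      by_contra hcon
      have hk2 : 2 ≤ k := by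
        by_contra! hk2
        interval_cases k
        norm_num at hcon
      have h25A : (25 : ℤ) ∣ A := by
        have : 5 ^ 2 ∣ A.natAbs := (pow_dvd_pow 5 hk2).trans hpk
        exact Int.natCast_dvd.mpr this
      obtain ⟨b, rfl⟩ := hB5 hpA'
      obtain ⟨a, rfl⟩ := h25A
      have : (n : ℤ) = 25 * (a * C - b ^ 2) := by linear_combination -hdet
      omega
    · exfalso
      have h49 := hn.le_prime p hp hp2 hp5 B (by
        rw [add_comm, ← hdet]; exact hpA'.mul_right C)
      have hpA : (p : ℤ) ≤ A := Int.le_of_dvd hA hpA'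
      zify at h49 hlarge
      nlinarith
  have hA20 : A ≤ 20 := by
    have := Nat.le_of_dvd (by norm_num) hdvd
    omega
  have hBle : -10 ≤ B ∧ B ≤ 10 := by
    have := neg_abs_le B
    have := le_abs_self B
    omega
  have hB1 : 2 * B ≤ A ∧ -A ≤ 2 * B := by
    have := neg_abs_le B
    have := le_abs_self B
    omega
  have hAv : A = 1 ∨ A = 2 ∨ A = 4 ∨ A = 5 ∨ A = 10 ∨ A = 20 := by
    obtain ⟨a, rfl⟩ := Int.eq_ofNat_of_zero_le hA.le
    have ha : a ∣ 20 := by simpa using hdvd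
    have ha' : a ≤ 20 := Nat.le_of_dvd (by norm_num) ha
    interval_cases a <;> omega
  rw [Int.even_iff, Int.even_iff] at hodd
  unfold forms
  rcases hAv with rfl | rfl | rfl | rfl | rfl | rfl
  · have : B = 0 := by omega
    subst this
    split_ifs <;> simp
  · rcases h8 with h8 | h8
    · exfalso; omega
    · have : B = 0 := by omega
      subst this
      rw [if_neg (by omega)]; simp
  · rcases h8 with h8 | h8
    · rw [if_pos (by omega)]
      have : B = 1 ∨ B = -1 := by omega
      rcases this with rfl | rfl <;> simp
    · exfalso; omega
  · have := hB5 (by norm_num)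
    have : B = 0 := by omega
    subst this
    split_ifs <;> simp
  · have := hB5 (by norm_num)
    rcases h8 with h8 | h8
    · exfalso; omega
    · have : B = 0 := by omega
      subst this
      rw [if_neg (by omega)]; simp
  · have := hB5 (by norm_num)
    rcases h8 with h8 | h8
    · rw [if_pos (by omega)]
      have : B = 5 ∨ B = -5 := by omega
      rcases this with rfl | rfl <;> simp
    · exfalso; omega

end NonunitSquares

namespace NonunitSquares

/-- The value at `(x, y)` of the quadratic form of determinant `n` with coefficients `A, 2 * B`. -/
def formValue (n : ℕ) (AB : ℤ × ℤ) (x y : ℤ) : ℤ :=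
  AB.1 * x ^ 2 + 2 * AB.2 * x * y + (n + AB.2 ^ 2) / AB.1 * y ^ 2

/-- Representations of `m` by the forms of determinant `n`. -/
def reps (n m : ℕ) : Set ((ℤ × ℤ) × ℤ × ℤ) :=
  {t | t.1 ∈ forms n ∧ formValue n t.1 t.2.1 t.2.2 = m}

/-- Primitive representations of `m` by the forms of determinant `n`. -/
def primReps (n m : ℕ) : Set ((ℤ × ℤ) × ℤ × ℤ) :=
  {t | t ∈ reps n m ∧ IsCoprime t.2.1 t.2.2}

/-- The relation between primitive representations of `m` and square roots of `-n` modulo `m`. -/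
def IsRootOf (n m : ℕ) (b : ZMod m) (t : (ℤ × ℤ) × ℤ × ℤ) : Prop :=
  b * t.2.2 = -(t.1.1 * t.2.1 + t.1.2 * t.2.2) ∧
    b * t.2.1 = t.1.2 * t.2.1 + ((n + t.1.2 ^ 2) / t.1.1 : ℤ) * t.2.2

lemma forms_pos {n : ℕ} {A B : ℤ} (h : (A, B) ∈ forms n) : 0 < A ∧ A ≤ 20 := by
  rcases not_even_of_forms h with ⟨-, h | h | h | h | h | h⟩ | ⟨-, h | h | h | h⟩ <;> omega

lemma exists_isRootOf {n m : ℕ} (hn : IsExceptional n) {t : (ℤ × ℤ) × ℤ × ℤ}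
    (ht : t ∈ primReps n m) : ∃ b : ZMod m, IsRootOf n m b t ∧ b ^ 2 = -n := by
  obtain ⟨⟨A, B⟩, x, y⟩ := t
  obtain ⟨⟨hf, hv⟩, u, v, huv⟩ := ht
  simp only [formValue] at hf hv huv
  obtain ⟨C, hC⟩ := hn.dvd_of_mem_forms hf
  have hCe : (n + B ^ 2) / A = C := by rw [hC, Int.mul_ediv_cancel_left _ (forms_pos hf).1.ne']
  rw [hCe] at hv
  have hm : ((A : ZMod m) * x ^ 2 + 2 * B * x * y + C * y ^ 2) = 0 := by
    have := congrArg (Int.cast : ℤ → ZMod m) hv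
    push_cast at this
    simpa using this
  have huv' : (u : ZMod m) * x + v * y = 1 := by
    have := congrArg (Int.cast : ℤ → ZMod m) huv
    push_cast at this
    exact this
  have hC' : (n : ZMod m) + B ^ 2 = A * C := by
    have := congrArg (Int.cast : ℤ → ZMod m) hC
    push_cast at this
    exact this
  have h1 : (u * (B * x + C * y) - v * (A * x + B * y) : ZMod m) * y = -(A * x + B * y) := by
    linear_combination u * hm - (A * x + B * y) * huv'
  have h2 : (u * (B * x + C * y) - v * (A * x + B * y) : ZMod m) * x = B * x + C * y := by
    linear_combination -v * hm + (B * x + C * y) * huv'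
  refine ⟨u * (B * x + C * y) - v * (A * x + B * y), ⟨h1, by simpa [hCe] using h2⟩, ?_⟩
  generalize (u * (B * x + C * y) - v * (A * x + B * y) : ZMod m) = b at h1 h2
  linear_combination (-b ^ 2 - n) * huv' + (u * b + u * B - v * A) * h2 + (v * b - v * B + u * C) * h1
    + (u * x + v * y) * hC'

lemma isRootOf_unique {n m : ℕ} {t : (ℤ × ℤ) × ℤ × ℤ} (ht : t ∈ primReps n m) {b b' : ZMod m}
    (h : IsRootOf n m b t) (h' : IsRootOf n m b' t) : b = b' := by
  obtain ⟨-, u, v, huv⟩ := ht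
  have huv' : (u : ZMod m) * t.2.1 + v * t.2.2 = 1 := by
    have := congrArg (Int.cast : ℤ → ZMod m) huv
    push_cast at this
    exact this
  linear_combination (-b + b') * huv' + u * (h.2 - h'.2) + v * (h.1 - h'.1)

lemma exists_primReps {n m : ℕ} (hn : IsExceptional n) (hm : Odd m) {b : ZMod m}
    (hb : b ^ 2 = -n) : ∃ t ∈ primReps n m, IsRootOf n m b t := by
  have hn0 : 0 < n := by have := hn.large; omega
  obtain ⟨β, rfl⟩ := ZMod.intCast_surjective b
  have hdvd : (m : ℤ) ∣ β ^ 2 + n := by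
    rw [← ZMod.intCast_zmod_eq_zero_iff_dvd]
    push_cast
    rw [hb]; ring
  obtain ⟨c, hc⟩ := hdvd
  have hm0 : 0 < m := hm.pos
  obtain ⟨p, q, r, s, h1, h2, h3, h4⟩ := exists_reduced n (by exact_mod_cast hn0) m m β c
    (by exact_mod_cast hm0) le_rfl (by linear_combination -hc)
  obtain ⟨A, hA⟩ : ∃ A, A = m * p ^ 2 + 2 * β * p * r + c * r ^ 2 := ⟨_, rfl⟩
  obtain ⟨B, hB⟩ : ∃ B, B = m * p * q + β * (p * s + q * r) + c * r * s := ⟨_, rfl⟩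
  obtain ⟨C, hC⟩ : ∃ C, C = m * q ^ 2 + 2 * β * q * s + c * s ^ 2 := ⟨_, rfl⟩
  rw [← hA] at h2 h3 h4
  rw [← hB] at h3
  have hdet : A * C = n + B ^ 2 := by
    rw [hA, hB, hC]
    linear_combination (-hc + (m * c - β ^ 2) * (p * s - q * r + 1) * h1)
  have hval : A * s ^ 2 + 2 * B * s * (-r) + C * (-r) ^ 2 = m := by
    rw [hA, hB, hC]
    linear_combination m * (p * s - q * r + 1) * h1
  have hmem : (A, B) ∈ forms n := by
    refine hn.mem_forms h2 h3 h4 hdet ?_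
    rintro ⟨⟨a, ha⟩, ⟨d, hd⟩⟩
    obtain ⟨k, rfl⟩ := hm
    rw [ha, hd] at hval
    push_cast at hval
    have : 2 * (a * s ^ 2 - B * s * r + d * r ^ 2 - k) = 1 := by linear_combination hval
    omega
  have hCe : (n + B ^ 2) / A = C := by rw [← hdet, Int.mul_ediv_cancel_left _ h2.ne']
  refine ⟨((A, B), s, -r), ⟨⟨hmem, ?_⟩, ⟨p, q, ?_⟩⟩, ?_, ?_⟩
  · simpa [formValue, hCe] using hval
  · simp only; linear_combination h1
  · have e1 : β * (-r) = -(A * s + B * -r) + m * p := by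
      rw [hA, hB]; linear_combination m * p * h1 + β * r * h1
    have := congrArg (Int.cast : ℤ → ZMod m) e1
    push_cast at this ⊢
    simpa using this
  · have e1 : β * s = B * s + C * -r - m * q := by
      rw [hB, hC]; linear_combination -m * q * h1 - β * s * h1
    have := congrArg (Int.cast : ℤ → ZMod m) e1
    simp only [hCe]
    push_cast at this ⊢
    simpa using this

set_option maxHeartbeats 1000000 in
lemma eq_or_eq_neg_of_isRootOf {n m : ℕ} (hn : IsExceptional n) (hm : Odd m) {b : ZMod m}
    (hb : b ^ 2 = -n) {t t' : (ℤ × ℤ) × ℤ × ℤ} (ht : t ∈ primReps n m) (ht' : t' ∈ primReps n m)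
    (h : IsRootOf n m b t) (h' : IsRootOf n m b t') : t' = t ∨ t' = (t.1, -t.2) := by
  have hlarge := hn.large
  have hm0 : (m : ℤ) ≠ 0 := by exact_mod_cast hm.pos.ne'
  obtain ⟨⟨A, B⟩, x, y⟩ := t
  obtain ⟨⟨A', B'⟩, x', y'⟩ := t'
  obtain ⟨⟨hf, hv⟩, -⟩ := ht
  obtain ⟨⟨hf', hv'⟩, -⟩ := ht'
  simp only [formValue] at hf hv hf' hv'
  obtain ⟨C, hC⟩ := hn.dvd_of_mem_forms hf
  obtain ⟨C', hC'⟩ := hn.dvd_of_mem_forms hf'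
  obtain ⟨hA0, hA20⟩ := forms_pos hf
  obtain ⟨hA0', hA20'⟩ := forms_pos hf'
  rw [hC, Int.mul_ediv_cancel_left _ hA0.ne'] at hv
  rw [hC', Int.mul_ediv_cancel_left _ hA0'.ne'] at hv'
  obtain ⟨z, hz⟩ : ∃ z, z = A * x + B * y := ⟨_, rfl⟩
  obtain ⟨z', hz'⟩ : ∃ z', z' = A' * x' + B' * y' := ⟨_, rfl⟩
  have h1 : b * y = -z := by have := h.1; simp only at this; rw [this, hz]; push_cast; rfl
  have h1' : b * y' = -z' := by have := h'.1; simp only at this; rw [this, hz']; push_cast; rfl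
  have hN : z ^ 2 + n * y ^ 2 = A * m := by
    rw [hz]; linear_combination A * hv + y ^ 2 * hC
  have hN' : z' ^ 2 + n * y' ^ 2 = A' * m := by
    rw [hz']; linear_combination A' * hv' + y' ^ 2 * hC'
  obtain ⟨P, hP⟩ : (m : ℤ) ∣ z * z' + n * y * y' := by
    rw [← ZMod.intCast_zmod_eq_zero_iff_dvd]
    push_cast
    linear_combination (y * y' : ZMod m) * hb + (z' : ZMod m) * h1 - (b * y) * h1'
  obtain ⟨R, hR⟩ : (m : ℤ) ∣ y * z' - z * y' := by
    rw [← ZMod.intCast_zmod_eq_zero_iff_dvd]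
    push_cast
    linear_combination (y : ZMod m) * h1' - (y' : ZMod m) * h1
  have hPR : P ^ 2 + n * R ^ 2 = A * A' := by
    have : (m : ℤ) ^ 2 * (P ^ 2 + n * R ^ 2) = m ^ 2 * (A * A') := by
      linear_combination -(z * z' + n * y * y' + m * P) * hP - n * (y * z' - z * y' + m * R) * hR
        + (z' ^ 2 + n * y' ^ 2) * hN + A * m * hN'
    exact mul_left_cancel₀ (pow_ne_zero 2 hm0) this
  have hR0 : R = 0 := by
    by_contra hne
    have : 1 ≤ R ^ 2 := by have := sq_nonneg R; have := pow_ne_zero 2 hne; omega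
    zify at hlarge
    nlinarith [sq_nonneg P]
  subst hR0
  have hP2 : P ^ 2 = A * A' := by linear_combination hPR
  have hzz : A * z' = P * z := by
    apply mul_left_cancel₀ hm0
    linear_combination -z' * hN + z * hP + n * y * hR
  have hyy : A * y' = P * y := by
    apply mul_left_cancel₀ hm0
    linear_combination -y' * hN + y * hP - z * hR
  obtain ⟨k, hk⟩ := hm
  have hkey : A' = A ∧ B' = B := by
    by_contra hne
    have hpar : Even A → ¬ Even y := by
      rintro ⟨a, rfl⟩ ⟨w, rfl⟩
      have : 2 * (a * x ^ 2 + 2 * B * x * w + 2 * C * w ^ 2 - k) = 1 := by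
        rw [hk] at hv; push_cast at hv; linear_combination hv
      omega
    have hpar' : Even A' → ¬ Even y' := by
      rintro ⟨a, rfl⟩ ⟨w, rfl⟩
      have : 2 * (a * x' ^ 2 + 2 * B' * x' * w + 2 * C' * w ^ 2 - k) = 1 := by
        rw [hk] at hv'; push_cast at hv'; linear_combination hv'
      omega
    rw [Int.even_iff, Int.even_iff] at hpar hpar'
    have hPb : -20 ≤ P ∧ P ≤ 20 := by constructor <;> nlinarith
    clear hPR hP hR hN hN' h1 h1' h h' hv hv' hC hC' hlarge hb hm0 hk hn
    obtain ⟨hP1, hP3⟩ := hPb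
    rcases not_even_of_forms hf with ⟨hodd, hf⟩ | ⟨hodd, hf⟩ <;>
      rcases not_even_of_forms hf' with ⟨hodd', hf'⟩ | ⟨hodd', hf'⟩ <;>
      [skip; omega; omega; skip]
    · rcases hf with h | h | h | h | h | h <;> obtain ⟨rfl, rfl⟩ := h <;>
        rcases hf' with h | h | h | h | h | h <;> obtain ⟨rfl, rfl⟩ := h <;>
        first
        | exact hne ⟨rfl, rfl⟩
        | (exfalso; interval_cases P <;> omega)
    · rcases hf with h | h | h | h <;> obtain ⟨rfl, rfl⟩ := h <;>
        rcases hf' with h | h | h | h <;> obtain ⟨rfl, rfl⟩ := h <;>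
        first
        | exact hne ⟨rfl, rfl⟩
        | (exfalso; interval_cases P <;> omega)
  obtain ⟨rfl, rfl⟩ := hkey
  have : P = A' ∨ P = -A' := sq_eq_sq_iff_eq_or_eq_neg.mp (by rw [hP2]; ring)
  rcases this with rfl | rfl
  · left
    have hy : y' = y := mul_left_cancel₀ hA0.ne' hyy
    have hz2 : z' = z := mul_left_cancel₀ hA0.ne' hzz
    subst hy
    have hx : x' = x := mul_left_cancel₀ hA0.ne' (by linear_combination hz2 - hz' + hz)
    rw [hx]
  · right
    have hy : y' = -y := mul_left_cancel₀ hA0.ne' (by linear_combination hyy)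
    have hz2 : z' = -z := mul_left_cancel₀ hA0.ne' (by linear_combination hzz)
    subst hy
    have hx : x' = -x := mul_left_cancel₀ hA0.ne' (by linear_combination hz2 - hz' - hz)
    rw [hx]; rfl

end NonunitSquares

namespace NonunitSquares

/-- The number of square roots of `-n` modulo `m`. -/
noncomputable def rootCount (n m : ℕ) : ℕ := Nat.card {b : ZMod m // b ^ 2 = -n}

lemma neg_mem_primReps {n m : ℕ} {t : (ℤ × ℤ) × ℤ × ℤ} (ht : t ∈ primReps n m) :
    (t.1, -t.2) ∈ primReps n m := by
  obtain ⟨⟨hf, hv⟩, hc⟩ := ht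
  refine ⟨⟨hf, ?_⟩, hc.neg_neg⟩
  rw [← hv]
  simp only [formValue, Prod.fst_neg, Prod.snd_neg]
  ring

lemma card_primReps_isRootOf {n m : ℕ} (hn : IsExceptional n) (hm : Odd m) {b : ZMod m}
    (hb : b ^ 2 = -n) : Nat.card {t : primReps n m // IsRootOf n m b t} = 2 := by
  obtain ⟨t, ht, hr⟩ := exists_primReps hn hm hb
  have hr' : IsRootOf n m b (t.1, -t.2) := by
    obtain ⟨h1, h2⟩ := hr
    constructor
    · simp only [Prod.fst_neg, Prod.snd_neg]; push_cast; linear_combination -h1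
    · simp only [Prod.fst_neg, Prod.snd_neg]; push_cast; linear_combination -h2
  have hne : t ≠ (t.1, -t.2) := by
    intro h
    have h2 : t.2 = -t.2 := congrArg Prod.snd h
    obtain ⟨-, u, v, huv⟩ := ht
    have h3 : t.2.1 = -t.2.1 := congrArg Prod.fst h2
    have h4 : t.2.2 = -t.2.2 := congrArg Prod.snd h2
    have h5 : t.2.1 = 0 := by omega
    have h6 : t.2.2 = 0 := by omega
    rw [h5, h6] at huv
    simp at huv
  have hset : {s : primReps n m | IsRootOf n m b s} =
      {⟨t, ht⟩, ⟨(t.1, -t.2), neg_mem_primReps ht⟩} := by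
    ext ⟨s, hs⟩
    simp only [Set.mem_ofPred_eq, Set.mem_insert_iff, Set.mem_singleton_iff, Subtype.mk.injEq]
    refine ⟨fun h => eq_or_eq_neg_of_isRootOf hn hm hb ht hs hr h, ?_⟩
    rintro (rfl | rfl)
    exacts [hr, hr']
  rw [← Set.ncard_pair (a := (⟨t, ht⟩ : primReps n m))
    (b := ⟨(t.1, -t.2), neg_mem_primReps ht⟩) (by simpa using hne), ← hset]
  rfl

lemma finite_card_primReps {n m : ℕ} (hn : IsExceptional n) (hm : Odd m) :
    Finite (primReps n m) ∧ Nat.card (primReps n m) = 2 * rootCount n m := by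
  have : NeZero m := ⟨hm.pos.ne'⟩
  choose f hf hf' using fun t : primReps n m => exists_isRootOf hn t.2
  let F : primReps n m → {b : ZMod m // b ^ 2 = -(n : ZMod m)} := fun t => ⟨f t, hf' t⟩
  have hF : ∀ b, Nat.card {t // F t = b} = 2 := by
    rintro ⟨b, hb⟩
    refine Eq.trans ?_ (card_primReps_isRootOf hn hm hb)
    refine Nat.card_congr (Equiv.subtypeEquivRight fun t => ?_)
    rw [Subtype.mk.injEq]
    exact ⟨fun h => h ▸ hf t, fun h => isRootOf_unique t.2 (hf t) h⟩
  have hfin : ∀ b, Finite {t // F t = b} := fun b =>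
    Nat.finite_of_card_ne_zero (by rw [hF b]; norm_num)
  refine ⟨Finite.of_equiv _ (Equiv.sigmaFiberEquiv F), ?_⟩
  have : Fintype {b : ZMod m // b ^ 2 = -(n : ZMod m)} := Fintype.ofFinite _
  rw [← Nat.card_congr (Equiv.sigmaFiberEquiv F), Nat.card_sigma]
  simp only [hF, Finset.sum_const, smul_eq_mul, rootCount, Nat.card_eq_fintype_card,
    Finset.card_univ]
  ring

lemma finite_card_reps {n m : ℕ} (hn : IsExceptional n) (hm : Odd m) :
    Finite (reps n m) ∧ Nat.card (reps n m) =
      2 * ∑ g ∈ m.divisors with g ^ 2 ∣ m, rootCount n (m / g ^ 2) := by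
  have hm0 : 0 < m := hm.pos
  let S := {g ∈ m.divisors | g ^ 2 ∣ m}
  have hS : ∀ g : S, (g : ℕ) ^ 2 * (m / g ^ 2) = m := fun g =>
    Nat.mul_div_cancel' (Finset.mem_filter.mp g.2).2
  have hodd : ∀ g : S, Odd (m / (g : ℕ) ^ 2) := fun g =>
    (Nat.odd_mul.mp (by rw [hS g]; exact hm : Odd ((g : ℕ) ^ 2 * (m / (g : ℕ) ^ 2)))).2
  have hSpos : ∀ g : S, 0 < (g : ℕ) := fun g =>
    Nat.pos_of_mem_divisors (Finset.mem_filter.mp g.2).1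
  let F : (Σ g : S, primReps n (m / (g : ℕ) ^ 2)) → reps n m := fun p =>
    ⟨(p.2.1.1, (p.1 : ℤ) * p.2.1.2.1, (p.1 : ℤ) * p.2.1.2.2), by
      refine ⟨p.2.2.1.1, ?_⟩
      have h1 := p.2.2.1.2
      have h2 := hS p.1
      zify at h2
      rw [← h2]
      have h3 : ((m / (p.1 : ℕ) ^ 2 : ℕ) : ℤ) = (m : ℤ) / (p.1 : ℤ) ^ 2 := by push_cast; rfl
      rw [← h3, ← h1]
      simp only [formValue]
      ring⟩
  have hinj : Function.Injective F := by
    rintro ⟨g, t, ht⟩ ⟨g', t', ht'⟩ h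
    have h1 := congrArg Subtype.val h
    simp only [F, Prod.mk.injEq] at h1
    obtain ⟨h1, h2, h3⟩ := h1
    have hg : g = g' := by
      apply Subtype.ext
      have e := congrArg₂ Int.gcd h2 h3
      rwa [Int.gcd_mul_left, Int.gcd_mul_left, Int.isCoprime_iff_gcd_eq_one.mp ht.2,
        Int.isCoprime_iff_gcd_eq_one.mp ht'.2, mul_one, mul_one, Int.natAbs_natCast,
        Int.natAbs_natCast] at e
    subst hg
    have hg0 : (g : ℤ) ≠ 0 := by exact_mod_cast (hSpos g).ne'
    have e2 := mul_left_cancel₀ hg0 h2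
    have e3 := mul_left_cancel₀ hg0 h3
    have : t = t' := Prod.ext h1 (Prod.ext e2 e3)
    subst this
    rfl
  have hsurj : Function.Surjective F := by
    rintro ⟨⟨AB, x, y⟩, hf, hv⟩
    simp only at hf hv
    obtain ⟨x', y', g, hg0, hco, hx, hy⟩ : ∃ x' y' : ℤ, ∃ g : ℕ, 0 < g ∧ IsCoprime x' y' ∧
        x = g * x' ∧ y = g * y' := by
      have hpos : 0 < Int.gcd x y := by
        rw [Int.gcd_pos_iff]
        by_contra! hcon
        rw [hcon.1, hcon.2] at hv
        simp [formValue] at hv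
        omega
      obtain ⟨x', y', h1, h2, h3⟩ := Int.exists_gcd_one hpos
      exact ⟨x', y', Int.gcd x y, hpos, Int.isCoprime_iff_gcd_eq_one.mpr h1, by
        rw [mul_comm]; exact h2, by rw [mul_comm]; exact h3⟩
    have hval : (g : ℤ) ^ 2 * formValue n AB x' y' = m := by
      rw [← hv, hx, hy]; simp only [formValue]; ring
    have hgm : g ^ 2 ∣ m := by
      have : ((g ^ 2 : ℕ) : ℤ) ∣ m := ⟨_, by push_cast; exact hval.symm⟩
      exact_mod_cast this
    have hgS : g ∈ S := Finset.mem_filter.mpr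
      ⟨Nat.mem_divisors.mpr ⟨(dvd_pow_self g two_ne_zero).trans hgm, hm0.ne'⟩, hgm⟩
    refine ⟨⟨⟨g, hgS⟩, ⟨(AB, x', y'), ⟨hf, ?_⟩, hco⟩⟩, ?_⟩
    · have h2 := hS ⟨g, hgS⟩
      zify at h2
      have h3 : ((m / g ^ 2 : ℕ) : ℤ) = (m : ℤ) / (g : ℤ) ^ 2 := by push_cast; rfl
      simp only
      rw [h3]
      refine mul_left_cancel₀ (pow_ne_zero 2 (by exact_mod_cast hg0.ne' : (g : ℤ) ≠ 0)) ?_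
      rw [hval, h2]
    · simp only [F, hx, hy]
  have hfin : ∀ g : S, Finite (primReps n (m / (g : ℕ) ^ 2)) := fun g =>
    (finite_card_primReps hn (hodd g)).1
  refine ⟨Finite.of_surjective F hsurj, ?_⟩
  rw [← Nat.card_congr (Equiv.ofBijective F ⟨hinj, hsurj⟩), Nat.card_sigma, Finset.mul_sum,
    ← Finset.sum_coe_sort {g ∈ m.divisors | g ^ 2 ∣ m}]
  exact Finset.sum_congr rfl fun g _ => (finite_card_primReps hn (hodd g)).2

end NonunitSquares

namespace NonunitSquares

lemma rootCount_one (n : ℕ) : rootCount n 1 = 1 := by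
  have : Unique {b : ZMod 1 // b ^ 2 = -(n : ZMod 1)} :=
    ⟨⟨⟨0, Subsingleton.elim _ _⟩⟩, fun b => Subtype.ext (Subsingleton.elim _ _)⟩
  exact Nat.card_unique

lemma rootCount_mul (n : ℕ) {a b : ℕ} (h : a.Coprime b) :
    rootCount n (a * b) = rootCount n a * rootCount n b := by
  unfold rootCount
  rw [← Nat.card_prod]
  let e := ZMod.chineseRemainder h
  refine Nat.card_congr ((e.toEquiv.subtypeEquiv (q := fun c => c.1 ^ 2 = -(n : ZMod a) ∧
    c.2 ^ 2 = -(n : ZMod b)) fun x => ?_).trans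
    (Equiv.subtypeProdEquivProd (p := fun c : ZMod a => c ^ 2 = -(n : ZMod a))
      (q := fun c : ZMod b => c ^ 2 = -(n : ZMod b))))
  rw [← e.injective.eq_iff, map_pow, map_neg, map_natCast, Prod.ext_iff]
  rfl

lemma rootCount_prime {n p : ℕ} (hp : p.Prime) (hp2 : p ≠ 2) :
    (rootCount n p : ℤ) = jacobiSym (-n) p + 1 := by
  have : Fact p.Prime := ⟨hp⟩
  rw [← jacobiSym.legendreSym.to_jacobiSym, ← legendreSym.card_sqrts p hp2, rootCount,
    Nat.card_eq_fintype_card, Set.toFinset_card]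
  norm_cast

lemma exists_sq_of_legendreSym {p : ℕ} (hp : p.Prime) (hp2 : p ≠ 2) (a : ℤ) (ha : ¬ (p : ℤ) ∣ a)
    {t : ℤ} (ht : (p : ℤ) ∣ t ^ 2 - a) (k : ℕ) :
    ∃ s : ℤ, ((p ^ (k + 1) : ℕ) : ℤ) ∣ s ^ 2 - a := by
  have hpi := Nat.prime_iff_prime_int.mp hp
  induction k with
  | zero => exact ⟨t, by simpa using ht⟩
  | succ k ih =>
    obtain ⟨s, c, hc⟩ := ih
    have hps : ¬ (p : ℤ) ∣ 2 * s := by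
      intro h
      rcases hpi.dvd_or_dvd h with h | h
      · have : p ∣ 2 := by exact_mod_cast h
        exact hp2 ((Nat.prime_dvd_prime_iff_eq hp Nat.prime_two).mp this)
      · apply ha
        have h1 : (p : ℤ) ∣ s ^ 2 - a := by
          rw [hc]; push_cast; rw [pow_succ]; exact ⟨p ^ k * c, by ring⟩
        have h2 : (p : ℤ) ∣ s ^ 2 := h.trans (dvd_pow_self s two_ne_zero)
        have := dvd_sub h2 h1
        simpa using this
    have hco : IsCoprime (2 * s) (p : ℤ) := (hpi.coprime_iff_not_dvd.mpr hps).symm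
    obtain ⟨u, v, huv⟩ := hco
    refine ⟨s - p ^ (k + 1) * (u * c), c * v + p ^ k * (u * c) ^ 2, ?_⟩
    push_cast at hc ⊢
    linear_combination hc - p ^ (k + 1) * c * huv

lemma rootCount_prime_pow {n p : ℕ} (hn : IsExceptional n) (hp : p.Prime) (hp2 : p ≠ 2) (k : ℕ) :
    (rootCount n (p ^ (k + 2)) : ℤ) = jacobiSym (-n) p ^ 2 + jacobiSym (-n) p := by
  have : Fact p.Prime := ⟨hp⟩
  have hpi := Nat.prime_iff_prime_int.mp hp
  have hlarge := hn.large
  have hroot : ∀ b : ZMod (p ^ (k + 2)), b ^ 2 = -(n : ZMod (p ^ (k + 2))) →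
      ∃ t : ℤ, (t : ZMod (p ^ (k + 2))) = b ∧ ((p ^ (k + 2) : ℕ) : ℤ) ∣ t ^ 2 - (-n) := by
    intro b hb
    obtain ⟨t, rfl⟩ := ZMod.intCast_surjective b
    refine ⟨t, rfl, ?_⟩
    rw [← ZMod.intCast_zmod_eq_zero_iff_dvd]
    push_cast at hb ⊢
    rw [hb]; ring
  rw [← jacobiSym.legendreSym.to_jacobiSym]
  by_cases hpn : (p : ℤ) ∣ -n
  · rw [(legendreSym.eq_zero_iff p _).mpr ((ZMod.intCast_zmod_eq_zero_iff_dvd _ p).mpr hpn)]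
    have : IsEmpty {b : ZMod (p ^ (k + 2)) // b ^ 2 = -(n : ZMod (p ^ (k + 2)))} := by
      refine ⟨fun ⟨b, hb⟩ => ?_⟩
      obtain ⟨t, -, c, hc⟩ := hroot b hb
      push_cast at hc
      have h1 : (p : ℤ) ∣ t := by
        apply hpi.dvd_of_dvd_pow (n := 2)
        have h2 : (p : ℤ) ∣ t ^ 2 - -n := by
          rw [hc, pow_add]; exact ⟨p ^ k * p * c, by ring⟩
        have := dvd_add h2 hpn
        simpa using this
      obtain ⟨u, rfl⟩ := h1
      have h3 : ((p ^ 2 : ℕ) : ℤ) ∣ n :=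
        ⟨p ^ k * c - u ^ 2, by push_cast; linear_combination hc⟩
      have h4 : p ^ 2 ∣ n := by exact_mod_cast h3
      by_cases hp5 : p = 5
      · subst hp5; exact hn.not_dvd h4
      · have h5 := hn.le_prime p hp hp2 hp5 0 (by
          rw [dvd_neg] at hpn; simpa using hpn)
        have h6 := Nat.le_of_dvd (by omega) h4
        have : p ≤ 49 := by
          by_contra! h7
          nlinarith
        nlinarith
    rw [rootCount, Nat.card_of_isEmpty]
    norm_num
  have h0 : (((-n : ℤ)) : ZMod p) ≠ 0 := by
    rwa [Ne, ZMod.intCast_zmod_eq_zero_iff_dvd]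
  rcases legendreSym.eq_one_or_neg_one p h0 with h1 | h1
  · rw [h1]
    obtain ⟨x, hx⟩ := (legendreSym.eq_one_iff p h0).mp h1
    obtain ⟨t, rfl⟩ := ZMod.intCast_surjective x
    obtain ⟨s, hs⟩ := exists_sq_of_legendreSym hp hp2 (-n) hpn (t := t) (by
      rw [← ZMod.intCast_zmod_eq_zero_iff_dvd]
      push_cast at hx ⊢
      rw [hx]; ring) (k + 1)
    have hps : ¬ (p : ℤ) ∣ 2 * s := by
      intro h
      rcases hpi.dvd_or_dvd h with h | h
      · have : p ∣ 2 := by exact_mod_cast h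
        exact hp2 ((Nat.prime_dvd_prime_iff_eq hp Nat.prime_two).mp this)
      · apply hpn
        have h3 : (p : ℤ) ∣ s ^ 2 - -n := by
          refine Dvd.dvd.trans ?_ hs
          exact_mod_cast dvd_pow_self p (by omega)
        have := dvd_sub (h.trans (dvd_pow_self s two_ne_zero)) h3
        simpa using this
    have hset : {b : ZMod (p ^ (k + 2)) | b ^ 2 = -(n : ZMod (p ^ (k + 2)))} =
        {(s : ZMod (p ^ (k + 2))), -(s : ZMod (p ^ (k + 2)))} := by
      have hs' : (s : ZMod (p ^ (k + 2))) ^ 2 = -n := by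
        have := (ZMod.intCast_zmod_eq_zero_iff_dvd _ _).mpr hs
        push_cast at this
        linear_combination this
      ext b
      simp only [Set.mem_ofPred_eq, Set.mem_insert_iff, Set.mem_singleton_iff]
      constructor
      · intro hb
        obtain ⟨b, rfl⟩ := ZMod.intCast_surjective b
        have hdvd : (p : ℤ) ^ (k + 2) ∣ (b - s) * (b + s) := by
          have : ((p ^ (k + 2) : ℕ) : ℤ) ∣ (b - s) * (b + s) := by
            rw [← ZMod.intCast_zmod_eq_zero_iff_dvd]
            push_cast
            linear_combination hb - hs'
          exact_mod_cast this
        by_cases h : (p : ℤ) ∣ b - s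
        · left
          have hns : ¬ (p : ℤ) ∣ b + s := fun h' => hps (by
            have := dvd_sub h' h; ring_nf at this; rwa [mul_comm] at this)
          have := (hpi.coprime_iff_not_dvd.mpr hns).pow_left (m := k + 2) |>.dvd_of_dvd_mul_right hdvd
          rw [← sub_eq_zero, ← Int.cast_sub, ZMod.intCast_zmod_eq_zero_iff_dvd]
          exact_mod_cast this
        · right
          have := (hpi.coprime_iff_not_dvd.mpr h).pow_left (m := k + 2) |>.dvd_of_dvd_mul_left hdvd
          rw [← sub_eq_zero, sub_neg_eq_add, ← Int.cast_add, ZMod.intCast_zmod_eq_zero_iff_dvd]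
          exact_mod_cast this
      · rintro (rfl | rfl)
        · exact hs'
        · rw [neg_sq]; exact hs'
    have hne : (s : ZMod (p ^ (k + 2))) ≠ -(s : ZMod (p ^ (k + 2))) := by
      intro h
      apply hps
      have h2 : ((2 * s : ℤ) : ZMod (p ^ (k + 2))) = 0 := by push_cast; linear_combination h
      rw [ZMod.intCast_zmod_eq_zero_iff_dvd] at h2
      refine Dvd.dvd.trans ?_ h2
      exact_mod_cast dvd_pow_self p (by omega)
    have := Set.ncard_pair hne
    rw [← hset] at this
    have h2 : rootCount n (p ^ (k + 2)) = 2 := this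
    rw [h2]
    norm_num
  · rw [h1]
    have : IsEmpty {b : ZMod (p ^ (k + 2)) // b ^ 2 = -(n : ZMod (p ^ (k + 2)))} := by
      refine ⟨fun ⟨b, hb⟩ => ?_⟩
      obtain ⟨t, -, ht⟩ := hroot b hb
      rw [legendreSym.eq_neg_one_iff] at h1
      refine h1 ⟨t, ?_⟩
      have h3 : (p : ℤ) ∣ t ^ 2 - -n := by
        refine Dvd.dvd.trans ?_ ht
        exact_mod_cast dvd_pow_self p (by omega)
      rw [← ZMod.intCast_zmod_eq_zero_iff_dvd] at h3
      push_cast at h3 ⊢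
      linear_combination -h3
    rw [rootCount, Nat.card_of_isEmpty]
    norm_num

end NonunitSquares

namespace NonunitSquares

open ArithmeticFunction

/-- The restriction of `f` to odd arguments, as an arithmetic function. -/
def oddPart (f : ℕ → ℤ) : ArithmeticFunction ℤ :=
  ⟨fun k => if Odd k then f k else 0, by simp⟩

lemma oddPart_apply (f : ℕ → ℤ) (k : ℕ) : oddPart f k = if Odd k then f k else 0 := rfl

lemma oddPart_of_odd (f : ℕ → ℤ) {k : ℕ} (hk : Odd k) : oddPart f k = f k := by
  rw [oddPart_apply, if_pos hk]

lemma isMultiplicative_oddPart {f : ℕ → ℤ} (h1 : f 1 = 1)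
    (hmul : ∀ a b : ℕ, a.Coprime b → f (a * b) = f a * f b) : (oddPart f).IsMultiplicative := by
  refine ⟨by rw [oddPart_of_odd _ odd_one, h1], fun {a b} hab => ?_⟩
  simp only [oddPart_apply, Nat.odd_mul]
  by_cases ha : Odd a <;> by_cases hb : Odd b <;> simp [ha, hb, hmul a b hab]

/-- The indicator function of the squares. -/
noncomputable def squareIndicator (k : ℕ) : ℤ := by
  classical exact if IsSquare k then 1 else 0

lemma squareIndicator_sq (k : ℕ) : squareIndicator (k ^ 2) = 1 := by
  rw [squareIndicator, if_pos (IsSquare.sq k)]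

lemma squareIndicator_mul (a b : ℕ) (h : a.Coprime b) :
    squareIndicator (a * b) = squareIndicator a * squareIndicator b := by
  have : IsSquare (a * b) ↔ IsSquare a ∧ IsSquare b := by
    refine ⟨?_, fun ⟨h1, h2⟩ => h1.mul h2⟩
    rintro ⟨c, hc⟩
    rw [← sq] at hc
    obtain ⟨d, hd⟩ := exists_eq_pow_of_mul_eq_pow
      (by rw [Nat.isUnit_iff]; exact h : IsUnit (gcd a b)) hc
    obtain ⟨e, he⟩ := exists_eq_pow_of_mul_eq_pow
      (by rw [Nat.isUnit_iff]; exact h.symm : IsUnit (gcd b a)) ((mul_comm b a).trans hc)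
    exact ⟨⟨d, by rw [hd, sq]⟩, ⟨e, by rw [he, sq]⟩⟩
  unfold squareIndicator
  simp only [this]
  by_cases h1 : IsSquare a <;> by_cases h2 : IsSquare b <;> simp [h1, h2]

lemma squareIndicator_prime {p : ℕ} (hp : p.Prime) : squareIndicator p = 0 := by
  rw [squareIndicator, if_neg]
  exact fun h => (Nat.prime_iff.mp hp).not_isSquare h

lemma mul_prime_pow (f g : ArithmeticFunction ℤ) {p : ℕ} (hp : p.Prime) (e : ℕ) :
    (f * g) (p ^ e) = ∑ k ∈ Finset.range (e + 1), f (p ^ k) * g (p ^ (e - k)) := by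
  rw [mul_apply, Nat.sum_divisorsAntidiagonal (fun i j => f i * g j),
    Nat.sum_divisors_prime_pow hp]
  refine Finset.sum_congr rfl fun k hk => ?_
  rw [Nat.pow_div (by simpa [Nat.lt_succ_iff] using hk) hp.pos]

lemma mul_prime_pow_add_two (f g : ArithmeticFunction ℤ) {p : ℕ} (hp : p.Prime) (e : ℕ) :
    (f * g) (p ^ (e + 2)) = (∑ k ∈ Finset.range (e + 1), f (p ^ (k + 2)) * g (p ^ (e - k))) +
      f p * g (p ^ (e + 1)) + f 1 * g (p ^ (e + 2)) := by
  rw [mul_prime_pow _ _ hp, Finset.sum_range_succ', Finset.sum_range_succ']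
  simp only [pow_zero, zero_add, pow_one, Nat.sub_zero]
  congr 2
  refine Finset.sum_congr rfl fun k _ => ?_
  rw [show e + 2 - (k + 1 + 1) = e - k by omega]

lemma squareIndicator_mul_rootCount {n : ℕ} (hn : IsExceptional n) :
    oddPart squareIndicator * oddPart (fun m => rootCount n m) =
      oddPart 1 * oddPart (fun m => jacobiSym (-n) m) := by
  have hS : (oddPart squareIndicator).IsMultiplicative :=
    isMultiplicative_oddPart (by simpa using squareIndicator_sq 1) squareIndicator_mul
  have hR : (oddPart fun m => (rootCount n m : ℤ)).IsMultiplicative :=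
    isMultiplicative_oddPart (by simp [rootCount_one])
      fun a b hab => by rw [rootCount_mul n hab]; push_cast; rfl
  have hZ : (oddPart 1).IsMultiplicative := isMultiplicative_oddPart rfl (by simp)
  have hJ : (oddPart fun m => jacobiSym (-n) m).IsMultiplicative :=
    isMultiplicative_oddPart (by simp) fun a b hab => by
      by_cases ha : a = 0
      · subst ha; simp at hab; subst hab; simp
      by_cases hb : b = 0
      · subst hb; simp at hab; subst hab; simp
      have : NeZero a := ⟨ha⟩
      have : NeZero b := ⟨hb⟩
      exact jacobiSym.mul_right _ _ _
  rw [(hS.mul hR).eq_iff_eq_on_prime_powers _ _ (hZ.mul hJ)]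
  intro p e hp
  by_cases hp2 : p = 2
  · subst hp2
    have hz : ∀ (f : ℕ → ℤ) k, k ≠ 0 → oddPart f (2 ^ k) = 0 := by
      intro f k hk
      rw [oddPart_apply, if_neg]
      rw [Nat.not_odd_iff_even, Nat.even_pow]
      exact ⟨even_two, hk⟩
    rcases Nat.eq_zero_or_pos e with rfl | he
    · simp [hS.1, hR.1, hZ.1, hJ.1]
    · rw [mul_prime_pow _ _ hp, mul_prime_pow _ _ hp]
      rw [Finset.sum_eq_zero, Finset.sum_eq_zero]
      all_goals
        intro k hk
        rcases Nat.eq_zero_or_pos k with rfl | hk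
        · rw [Nat.sub_zero, hz _ e he.ne', mul_zero]
        · rw [hz _ k hk.ne', zero_mul]
  have hodd : ∀ k, Odd (p ^ k) := fun k => (hp.odd_of_ne_two hp2).pow
  have hpow : ∀ k, jacobiSym (-n) (p ^ k) = jacobiSym (-n) p ^ k := fun k =>
    jacobiSym.pow_right _ _ _
  induction e using Nat.twoStepInduction with
  | zero => simp [hS.1, hR.1, hZ.1, hJ.1]
  | one =>
    rw [mul_prime_pow _ _ hp, mul_prime_pow _ _ hp]
    simp only [oddPart_of_odd _ (hodd _), Finset.sum_range_succ, Finset.sum_range_zero]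
    have h1 : squareIndicator 1 = 1 := by simpa using squareIndicator_sq 1
    simp [rootCount_one, squareIndicator_prime hp, rootCount_prime hp hp2, h1]
  | more e ih _ =>
    rw [mul_prime_pow _ _ hp, mul_prime_pow _ _ hp] at ih
    rw [mul_prime_pow_add_two _ _ hp, mul_prime_pow_add_two _ _ hp]
    have hodd1 : Odd p := hp.odd_of_ne_two hp2
    simp only [oddPart_of_odd _ (hodd _), oddPart_of_odd _ hodd1, oddPart_of_odd _ odd_one]
      at ih ⊢
    have hsq : ∀ k, squareIndicator (p ^ (k + 2)) = squareIndicator (p ^ k) := by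
      intro k
      unfold squareIndicator
      congr 1
      rw [eq_iff_iff, pow_add]
      refine ⟨?_, fun h => h.mul (IsSquare.sq p)⟩
      rintro ⟨c, hc⟩
      have : p ^ 2 ∣ c ^ 2 := ⟨p ^ k, by rw [sq c, ← hc]; ring⟩
      obtain ⟨d, rfl⟩ := (Nat.pow_dvd_pow_iff two_ne_zero).mp this
      refine ⟨d, Nat.eq_of_mul_eq_mul_right (pow_pos hp.pos 2) ?_⟩
      rw [hc]; ring
    simp only [hsq]
    rw [ih, squareIndicator_prime hp, rootCount_prime_pow hn hp hp2, hpow, hpow]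
    have h1 : squareIndicator 1 = 1 := by simpa using squareIndicator_sq 1
    have hJ3 : jacobiSym (-n) p = 0 ∨ jacobiSym (-n) p = 1 ∨ jacobiSym (-n) p = -1 :=
      jacobiSym.trichotomy _ _
    rw [h1]
    simp only [Pi.one_apply, one_mul, zero_mul, add_zero]
    rw [add_assoc]
    congr 1
    rcases hJ3 with h | h | h <;> rw [h]
    · simp
    · simp
    · rw [pow_succ _ (e + 1)]; ring

/-- The number of representations of an odd number by the forms of determinant `n`. -/
lemma card_reps {n m : ℕ} (hn : IsExceptional n) (hm : Odd m) :
    (Nat.card (reps n m) : ℤ) = 2 * ∑ d ∈ m.divisors, jacobiSym (-n) d := by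
  have hm0 : m ≠ 0 := hm.pos.ne'
  rw [(finite_card_reps hn hm).2]
  push_cast
  congr 1
  have h := congrArg (fun f : ArithmeticFunction ℤ => f m) (squareIndicator_mul_rootCount hn)
  have hdiv : ∀ d ∈ m.divisors, Odd d := fun d hd => hm.of_dvd_nat (Nat.dvd_of_mem_divisors hd)
  have hdiv' : ∀ d ∈ m.divisors, Odd (m / d) := fun d hd =>
    hm.of_dvd_nat (Nat.div_dvd_of_dvd (Nat.dvd_of_mem_divisors hd))
  simp only [mul_apply] at h
  rw [Nat.sum_divisorsAntidiagonal (fun i j => oddPart squareIndicator i *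
    oddPart (fun m => (rootCount n m : ℤ)) j), Nat.sum_divisorsAntidiagonal' (fun i j =>
    oddPart 1 i * oddPart (fun m => jacobiSym (-n) m) j)] at h
  have h2 : ∑ d ∈ m.divisors, oddPart 1 (m / d) * oddPart (fun m => jacobiSym (-n) m) d =
      ∑ d ∈ m.divisors, jacobiSym (-n) d := Finset.sum_congr rfl fun d hd => by
    rw [oddPart_of_odd _ (hdiv d hd), oddPart_of_odd _ (hdiv' d hd)]; simp
  rw [← h2, ← h]
  have h3 : ∑ d ∈ m.divisors, oddPart squareIndicator d *
      oddPart (fun m => (rootCount n m : ℤ)) (m / d) =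
      ∑ d ∈ m.divisors with IsSquare d, (rootCount n (m / d) : ℤ) := by
    rw [Finset.sum_filter]
    refine Finset.sum_congr rfl fun d hd => ?_
    rw [oddPart_of_odd _ (hdiv d hd), oddPart_of_odd _ (hdiv' d hd), squareIndicator]
    split_ifs <;> simp
  rw [h3]
  refine Finset.sum_bij (fun g _ => g ^ 2) ?_ ?_ ?_ ?_
  · intro g hg
    rw [Finset.mem_filter] at hg ⊢
    exact ⟨Nat.mem_divisors.mpr ⟨hg.2, hm0⟩, IsSquare.sq g⟩
  · intro a _ b _ h
    exact Nat.pow_left_injective two_ne_zero h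
  · intro d hd
    rw [Finset.mem_filter] at hd
    obtain ⟨hd, c, rfl⟩ := hd
    have := Nat.dvd_of_mem_divisors hd
    refine ⟨c, ?_, by ring⟩
    rw [Finset.mem_filter, sq]
    exact ⟨Nat.mem_divisors.mpr ⟨(Dvd.intro _ rfl).trans this, hm0⟩, this⟩
  · intro g _; rfl

end NonunitSquares

namespace NonunitSquares

lemma IsExceptional.mul_formValue {n : ℕ} (hn : IsExceptional n) {AB : ℤ × ℤ} (h : AB ∈ forms n)
    (x y : ℤ) : AB.1 * formValue n AB x y = (AB.1 * x + AB.2 * y) ^ 2 + n * y ^ 2 := by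
  obtain ⟨A, B⟩ := AB
  obtain ⟨C, hC⟩ := hn.dvd_of_mem_forms h
  simp only [formValue]
  rw [hC, Int.mul_ediv_cancel_left _ (forms_pos h).1.ne']
  linear_combination (-y ^ 2) * hC

lemma abs_snd_le_of_mem_forms {n : ℕ} {AB : ℤ × ℤ} (h : AB ∈ forms n) : |AB.2| ≤ 5 := by
  obtain ⟨A, B⟩ := AB
  rcases not_even_of_forms h with ⟨-, h | h | h | h | h | h⟩ | ⟨-, h | h | h | h⟩ <;>
    obtain ⟨rfl, rfl⟩ := h <;> norm_num

lemma IsExceptional.formValue_nonneg {n : ℕ} (hn : IsExceptional n) {AB : ℤ × ℤ}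
    (h : AB ∈ forms n) (x y : ℤ) : 0 ≤ formValue n AB x y := by
  have h1 := hn.mul_formValue h x y
  have h2 := (forms_pos h).1
  by_contra! h3
  have : AB.1 * formValue n AB x y < 0 := mul_neg_of_pos_of_neg h2 h3
  nlinarith [sq_nonneg (AB.1 * x + AB.2 * y), mul_nonneg (Nat.cast_nonneg (α := ℤ) n) (sq_nonneg y)]

lemma IsExceptional.le_formValue {n : ℕ} (hn : IsExceptional n) {AB : ℤ × ℤ} (h : AB ∈ forms n)
    (x y : ℤ) : x ^ 2 ≤ 40 * formValue n AB x y ∧ y ^ 2 ≤ 40 * formValue n AB x y := by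
  have h1 := hn.mul_formValue h x y
  obtain ⟨h2, h3⟩ := forms_pos h
  have h4 := hn.formValue_nonneg h x y
  have h5 := abs_le.mp (abs_snd_le_of_mem_forms h)
  have h6 := hn.large
  zify at h6
  have h7 : AB.2 ^ 2 ≤ 25 := by nlinarith
  have h8 : AB.1 * formValue n AB x y ≤ 20 * formValue n AB x y :=
    mul_le_mul_of_nonneg_right h3 h4
  have h9 : (100 : ℤ) * y ^ 2 ≤ n * y ^ 2 := mul_le_mul_of_nonneg_right (by linarith) (sq_nonneg y)
  have h10 : AB.2 ^ 2 * y ^ 2 ≤ 25 * y ^ 2 := mul_le_mul_of_nonneg_right h7 (sq_nonneg y)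
  have h11 : x ^ 2 ≤ AB.1 ^ 2 * x ^ 2 := by
    have : 1 ≤ AB.1 ^ 2 := by nlinarith
    nlinarith [sq_nonneg x]
  constructor
  · nlinarith [sq_nonneg (AB.1 * x + 2 * (AB.2 * y)), sq_nonneg y]
  · nlinarith [sq_nonneg (AB.1 * x + AB.2 * y), sq_nonneg y]

lemma IsExceptional.norm_sq_le {n : ℕ} (hn : IsExceptional n) {AB : ℤ × ℤ} (h : AB ∈ forms n)
    (z : ℤ × ℤ) : ‖z‖ ^ 2 ≤ 40 * (formValue n AB z.1 z.2 : ℝ) := by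
  obtain ⟨hx, hy⟩ := hn.le_formValue h z.1 z.2
  have hx' : |(z.1 : ℝ)| ^ 2 ≤ 40 * (formValue n AB z.1 z.2 : ℝ) := by
    rw [sq_abs]; exact_mod_cast hx
  have hy' : |(z.2 : ℝ)| ^ 2 ≤ 40 * (formValue n AB z.1 z.2 : ℝ) := by
    rw [sq_abs]; exact_mod_cast hy
  rw [Prod.norm_def, Int.norm_eq_abs, Int.norm_eq_abs]
  rcases max_choice |(z.1 : ℝ)| |(z.2 : ℝ)| with h | h <;> rw [h] <;> assumption

lemma summable_max_one_norm {k : ℝ} (hk : 2 < k) :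
    Summable fun z : ℤ × ℤ => (max 1 ‖z‖) ^ (-k) := by
  have h1 := EisensteinSeries.summable_one_div_norm_rpow hk
  rw [← (finTwoArrowEquiv ℤ).symm.summable_iff] at h1
  refine h1.congr_cofinite ?_
  have hfin : ({0} : Set (ℤ × ℤ)).Finite := Set.finite_singleton 0
  filter_upwards [hfin.compl_mem_cofinite] with z hz
  have h2 : ‖(finTwoArrowEquiv ℤ).symm z‖ = ‖z‖ := by
    rw [Prod.norm_def, Pi.norm_def]
    simp [finTwoArrowEquiv, Finset.univ_fin2 ]
  have h3 : 1 ≤ ‖z‖ := by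
    rw [Prod.norm_def, Int.norm_eq_abs, Int.norm_eq_abs, le_max_iff]
    by_contra! h
    apply hz
    have ha : |z.1| < 1 := by exact_mod_cast h.1
    have hb : |z.2| < 1 := by exact_mod_cast h.2
    exact Prod.ext (Int.abs_lt_one_iff.mp ha) (Int.abs_lt_one_iff.mp hb)
  simp only [Function.comp_apply, h2, max_eq_right h3]

lemma IsExceptional.formValue_rpow_le {n : ℕ} (hn : IsExceptional n) {AB : ℤ × ℤ}
    (h : AB ∈ forms n) {s : ℝ} (hs : 0 < s) (z : ℤ × ℤ) :
    (formValue n AB z.1 z.2 : ℝ) ^ (-s) ≤ 40 ^ s * (max 1 ‖z‖) ^ (-(2 * s)) := by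
  have h1 := hn.norm_sq_le h z
  rcases (hn.formValue_nonneg h z.1 z.2).eq_or_lt with h2 | h2
  · rw [← h2, Int.cast_zero, Real.zero_rpow (by linarith)]
    positivity
  · have h3 : (1 : ℝ) ≤ formValue n AB z.1 z.2 := by exact_mod_cast h2
    have h4 : (max 1 ‖z‖) ^ 2 ≤ 40 * (formValue n AB z.1 z.2 : ℝ) := by
      rcases max_choice 1 ‖z‖ with h | h <;> rw [h]
      · linarith
      · exact h1
    have h5 : (40 : ℝ) ^ s * (max 1 ‖z‖) ^ (-(2 * s)) = ((max 1 ‖z‖) ^ 2 / 40) ^ (-s) := by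
      rw [Real.div_rpow (by positivity) (by norm_num), ← Real.rpow_natCast, ← Real.rpow_mul
        (by positivity), Real.rpow_neg (by norm_num : (0 : ℝ) ≤ 40)]
      push_cast
      field_simp
    rw [h5]
    exact Real.rpow_le_rpow_of_nonpos (by positivity) (by linarith) (by linarith)

lemma IsExceptional.summable_formValue {n : ℕ} (hn : IsExceptional n) {AB : ℤ × ℤ}
    (h : AB ∈ forms n) {s : ℝ} (hs : 1 < s) :
    Summable fun t : ℤ × ℤ => (formValue n AB t.1 t.2 : ℝ) ^ (-s) :=
  Summable.of_nonneg_of_le (fun t => Real.rpow_nonneg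
    (by exact_mod_cast hn.formValue_nonneg h _ _) _) (hn.formValue_rpow_le h (by linarith))
    ((summable_max_one_norm (by linarith)).mul_left _)

end NonunitSquares

namespace NonunitSquares

structure IsTwist (n N : ℕ) (χ : MulChar (ZMod N) ℤ) : Prop where
  quadratic : χ.IsQuadratic
  two_dvd : 2 ∣ N
  five : χ 5 = -1
  norm_neg : ∃ u v : ZMod N, χ (u ^ 2 + n * v ^ 2) = -1

section

variable {n N : ℕ} {χ : MulChar (ZMod N) ℤ}

lemma IsTwist.eq_zero_of_even (hχ : IsTwist n N χ) {m : ℕ} (hm : ¬Odd m) :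
    χ (m : ZMod N) = 0 := by
  apply χ.map_nonunit
  rw [ZMod.isUnit_iff_coprime]
  intro h
  have h2 : 2 ∣ Nat.gcd m N := Nat.dvd_gcd (Nat.not_odd_iff_even.mp hm).two_dvd hχ.two_dvd
  rw [h] at h2
  omega

lemma IsTwist.abs_le (hχ : IsTwist n N χ) (a : ZMod N) : |χ a| ≤ 1 := by
  rcases hχ.quadratic a with h | h | h <;> simp [h]

lemma abs_jacobiSym_le (a : ℤ) (m : ℕ) : |jacobiSym a m| ≤ 1 := by
  rcases jacobiSym.trichotomy a m with h | h | h <;> simp [h]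

lemma IsExceptional.card_fibers (hn : IsExceptional n) {m : ℕ} (hm : Odd m) :
    ∑ AB ∈ forms n, (Nat.card {z : ℤ × ℤ | formValue n AB z.1 z.2 = m} : ℤ) =
      2 * ∑ d ∈ m.divisors, jacobiSym (-n) d := by
  rw [← card_reps hn hm]
  have hfin := (finite_card_reps hn hm).1
  let e : reps n m ≃ Σ AB : forms n, {z : ℤ × ℤ | formValue n AB z.1 z.2 = m} :=
    { toFun := fun t => ⟨⟨t.1.1, t.2.1⟩, t.1.2, t.2.2⟩
      invFun := fun t => ⟨(t.1.1, t.2.1), t.1.2, t.2.2⟩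
      left_inv := fun _ => rfl
      right_inv := fun _ => rfl }
  have hfin' (AB : forms n) : Finite {z : ℤ × ℤ | formValue n AB z.1 z.2 = m} := by
    refine Finite.of_injective (fun z => e.symm ⟨AB, z⟩) fun z w h => ?_
    simpa using h
  rw [Nat.card_congr e, Nat.card_sigma, ← Finset.sum_coe_sort (forms n)]
  push_cast
  rfl

lemma IsTwist.hasSum_fiber (hn : IsExceptional n) (hχ : IsTwist n N χ) {s : ℝ} (hs : 1 < s)
    {AB : ℤ × ℤ} (h : AB ∈ forms n) :
    HasSum (fun m : ℕ => (Nat.card {z : ℤ × ℤ | formValue n AB z.1 z.2 = m} : ℝ) *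
        ((χ (m : ZMod N) : ℝ) * (m : ℝ) ^ (-s)))
      (∑' z : ℤ × ℤ, (χ (formValue n AB z.1 z.2 : ZMod N) : ℝ) *
        (formValue n AB z.1 z.2 : ℝ) ^ (-s)) := by
  have hsum : Summable fun z : ℤ × ℤ => (χ (formValue n AB z.1 z.2 : ZMod N) : ℝ) *
        (formValue n AB z.1 z.2 : ℝ) ^ (-s) := by
    refine Summable.of_norm_bounded (hn.summable_formValue h hs) fun z => ?_
    have h1 : (0 : ℝ) ≤ formValue n AB z.1 z.2 := by
      exact_mod_cast hn.formValue_nonneg h z.1 z.2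
    rw [norm_mul, Real.norm_of_nonneg (Real.rpow_nonneg h1 _)]
    refine mul_le_of_le_one_left (Real.rpow_nonneg h1 _) ?_
    rw [Real.norm_eq_abs]
    exact_mod_cast hχ.abs_le _
  refine HasSum.congr_fun
    (hsum.hasSum.tsum_fiberwise (fun z => (formValue n AB z.1 z.2).natAbs)) fun m => ?_
  have key (z : ℤ × ℤ) : (formValue n AB z.1 z.2).natAbs = m ↔ formValue n AB z.1 z.2 = m := by
    have := hn.formValue_nonneg h z.1 z.2
    omega
  have hset : ((fun z : ℤ × ℤ => (formValue n AB z.1 z.2).natAbs) ⁻¹' {m}) =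
      {z : ℤ × ℤ | formValue n AB z.1 z.2 = m} := by
    ext z
    simp [key]
  rw [hset, ← nsmul_eq_mul, ← tsum_const]
  refine tsum_congr fun z => ?_
  rw [show formValue n AB z.1.1 z.1.2 = m from z.2]
  simp

/-- The product of the two twisted `L`-series counts the values of the forms. -/
lemma IsTwist.LSeries_mul_LSeries (hn : IsExceptional n) (hχ : IsTwist n N χ) {s : ℝ}
    (hs : 1 < s) :
    LSeries (fun m : ℕ => ((χ (m : ZMod N) : ℤ) : ℂ)) s *
        LSeries (fun m : ℕ => ((χ (m : ZMod N) * jacobiSym (-n) m : ℤ) : ℂ)) s =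
      ((∑ AB ∈ forms n, ∑' z : ℤ × ℤ, (χ (formValue n AB z.1 z.2 : ZMod N) : ℝ) *
        (formValue n AB z.1 z.2 : ℝ) ^ (-s)) / 2 : ℝ) := by
  have h1 : LSeriesSummable (fun m : ℕ => ((χ (m : ZMod N) : ℤ) : ℂ)) s := by
    refine LSeriesSummable_of_bounded_of_one_lt_real (m := 1) (fun m _ => ?_) hs
    rw [Complex.norm_intCast]
    exact_mod_cast hχ.abs_le _
  have h2 : LSeriesSummable (fun m : ℕ => ((χ (m : ZMod N) * jacobiSym (-n) m : ℤ) : ℂ)) s := by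
    refine LSeriesSummable_of_bounded_of_one_lt_real (m := 1) (fun m _ => ?_) hs
    rw [Complex.norm_intCast]
    have : |χ (m : ZMod N) * jacobiSym (-n) m| ≤ 1 := by
      rw [abs_mul]
      exact mul_le_one₀ (hχ.abs_le _) (abs_nonneg _) (abs_jacobiSym_le _ _)
    exact_mod_cast this
  rw [← LSeries_convolution' h1 h2]
  have h3 : HasSum (fun m : ℕ => ∑ AB ∈ forms n,
      (Nat.card {z : ℤ × ℤ | formValue n AB z.1 z.2 = m} : ℝ) *
        ((χ (m : ZMod N) : ℝ) * (m : ℝ) ^ (-s))) _ :=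
    hasSum_sum fun AB h => hχ.hasSum_fiber hn hs h
  have h4 := (Complex.hasSum_ofReal.mpr (h3.div_const 2))
  rw [← h4.tsum_eq, LSeries]
  refine tsum_congr fun m => ?_
  rw [LSeries.term_def]
  split_ifs with hm
  · subst hm
    simp [Real.zero_rpow (by linarith : -s ≠ 0)]
  rw [LSeries.convolution_def]
  have h5 : ∑ p ∈ m.divisorsAntidiagonal, ((χ (p.1 : ZMod N) : ℤ) : ℂ) *
      ((χ (p.2 : ZMod N) * jacobiSym (-n) p.2 : ℤ) : ℂ) =
      ((χ (m : ZMod N) * ∑ d ∈ m.divisors, jacobiSym (-n) d : ℤ) : ℂ) := by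
    rw [← Nat.sum_divisorsAntidiagonal' fun _ d => jacobiSym (-n) d, Finset.mul_sum]
    push_cast
    refine Finset.sum_congr rfl fun p hp => ?_
    rw [← (Nat.mem_divisorsAntidiagonal.mp hp).1]
    push_cast
    rw [map_mul]
    push_cast
    ring
  beta_reduce
  rw [h5, ← Finset.sum_mul]
  by_cases hodd : Odd m
  · have h6 := hn.card_fibers hodd
    have h7 : ∑ AB ∈ forms n, (Nat.card {z : ℤ × ℤ | formValue n AB z.1 z.2 = m} : ℝ) =
        ((2 * ∑ d ∈ m.divisors, jacobiSym (-n) d : ℤ) : ℝ) := by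
      rw [← h6]; push_cast; rfl
    rw [h7, Real.rpow_neg (Nat.cast_nonneg m)]
    push_cast
    rw [Complex.ofReal_cpow (Nat.cast_nonneg m)]
    push_cast
    ring
  · rw [hχ.eq_zero_of_even hodd]
    simp

end

end NonunitSquares

namespace NonunitSquares

lemma abs_rpow_neg_sub_le {a b m s : ℝ} (hm : 1 ≤ m) (ha : m ≤ a) (hb : m ≤ b)
    (hs : s ∈ Set.Icc (1 : ℝ) 2) : |a ^ (-s) - b ^ (-s)| ≤ 2 / m ^ 2 * |a - b| := by
  refine Convex.norm_image_sub_le_of_norm_hasDerivWithin_le (s := Set.Ici m)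
    (f := fun x : ℝ => x ^ (-s)) (f' := fun x => -s * x ^ (-s - 1)) (fun x hx => ?_)
    (fun x hx => ?_) (convex_Ici m) hb ha
  · have hx' : m ≤ x := hx
    exact (Real.hasDerivAt_rpow_const (Or.inl (by linarith))).hasDerivWithinAt
  · have hx' : m ≤ x := hx
    rw [norm_mul, norm_neg, Real.norm_of_nonneg (by linarith [hs.1] : (0 : ℝ) ≤ s),
      Real.norm_of_nonneg (Real.rpow_nonneg (by linarith) _), div_eq_mul_inv]
    have h1 : x ^ (-s - 1) ≤ (m ^ 2)⁻¹ := by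
      calc x ^ (-s - 1) ≤ x ^ (-2 : ℝ) :=
            Real.rpow_le_rpow_of_exponent_le (by linarith) (by linarith [hs.1])
        _ ≤ m ^ (-2 : ℝ) := Real.rpow_le_rpow_of_nonpos (by linarith) hx' (by norm_num)
        _ = (m ^ 2)⁻¹ := by
          rw [Real.rpow_neg (by linarith)]; norm_cast
    exact mul_le_mul hs.2 h1 (Real.rpow_nonneg (by linarith) _) (by norm_num)

lemma intCast_rpow_neg_le_one {q : ℤ} (hq : 0 ≤ q) {s : ℝ} (hs : 0 < s) : (q : ℝ) ^ (-s) ≤ 1 := by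
  rcases hq.eq_or_lt with h | h
  · rw [← h, Int.cast_zero, Real.zero_rpow (by linarith)]
    norm_num
  · exact Real.rpow_le_one_of_one_le_of_nonpos (by exact_mod_cast h) (by linarith)

lemma abs_fst_le_norm (z : ℤ × ℤ) : |(z.1 : ℝ)| ≤ ‖z‖ := by
  rw [← Int.norm_eq_abs]; exact norm_fst_le z

lemma abs_snd_le_norm (z : ℤ × ℤ) : |(z.2 : ℝ)| ≤ ‖z‖ := by
  rw [← Int.norm_eq_abs]; exact norm_snd_le z

lemma IsExceptional.abs_formValue_sub_le {n : ℕ} (hn : IsExceptional n) {AB : ℤ × ℤ}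
    (h : AB ∈ forms n) {z v : ℤ × ℤ} (hzv : ‖v‖ ≤ ‖z‖) :
    |(formValue n AB (z + v).1 (z + v).2 : ℝ) - formValue n AB z.1 z.2| ≤
      (1875 + 3 * n) * ‖v‖ * ‖z‖ := by
  have h1 := congrArg (Int.cast : ℤ → ℝ) (hn.mul_formValue h (z + v).1 (z + v).2)
  have h2 := congrArg (Int.cast : ℤ → ℝ) (hn.mul_formValue h z.1 z.2)
  have hA : (0 : ℝ) < AB.1 ∧ (AB.1 : ℝ) ≤ 20 := by
    obtain ⟨h3, h4⟩ := forms_pos (A := AB.1) (B := AB.2) h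
    exact ⟨by exact_mod_cast h3, by exact_mod_cast h4⟩
  have hA1 : (1 : ℝ) ≤ AB.1 := by
    have := (forms_pos (A := AB.1) (B := AB.2) h).1
    exact_mod_cast this
  have hB : |(AB.2 : ℝ)| ≤ 5 := by exact_mod_cast abs_snd_le_of_mem_forms h
  push_cast [Prod.fst_add, Prod.snd_add] at h1 h2 ⊢
  set A : ℝ := (AB.1 : ℝ)
  set B : ℝ := (AB.2 : ℝ)
  set q' : ℝ := (formValue n AB (z.1 + v.1) (z.2 + v.2) : ℝ)
  set q : ℝ := (formValue n AB z.1 z.2 : ℝ)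
  have hx := abs_fst_le_norm z
  have hy := abs_snd_le_norm z
  have hx' := abs_fst_le_norm v
  have hy' := abs_snd_le_norm v
  set x : ℝ := (z.1 : ℝ)
  set y : ℝ := (z.2 : ℝ)
  set x' : ℝ := (v.1 : ℝ)
  set y' : ℝ := (v.2 : ℝ)
  have hZ := norm_nonneg z
  have hV := norm_nonneg v
  set Z := ‖z‖
  set V := ‖v‖
  have lin (X Y T : ℝ) (hX : |X| ≤ T) (hY : |Y| ≤ T) : |A * X + B * Y| ≤ 25 * T := by
    have hT : 0 ≤ T := (abs_nonneg _).trans hX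
    calc |A * X + B * Y| ≤ |A * X| + |B * Y| := abs_add_le _ _
      _ = A * |X| + |B| * |Y| := by rw [abs_mul, abs_mul, abs_of_pos hA.1]
      _ ≤ 20 * T + 5 * T := by gcongr; exact hA.2
      _ = 25 * T := by ring
  have e : A * (q' - q) = (2 * (A * x + B * y) + (A * x' + B * y')) * (A * x' + B * y') +
      n * ((2 * y + y') * y') := by linear_combination h1 - h2
  have l1 := lin x y Z hx hy
  have l2 := lin x' y' V hx' hy'
  have b1 : |(2 * (A * x + B * y) + (A * x' + B * y')) * (A * x' + B * y')| ≤
      (75 * Z) * (25 * V) := by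
    rw [abs_mul]
    gcongr
    calc _ ≤ |2 * (A * x + B * y)| + |A * x' + B * y'| := abs_add_le _ _
      _ ≤ 2 * (25 * Z) + 25 * V := by rw [abs_mul, abs_two]; gcongr
      _ ≤ _ := by linarith
  have b2 : |(n : ℝ) * ((2 * y + y') * y')| ≤ n * ((3 * Z) * V) := by
    rw [abs_mul, abs_mul, Nat.abs_cast]
    gcongr
    calc _ ≤ |2 * y| + |y'| := abs_add_le _ _
      _ ≤ 2 * Z + V := by rw [abs_mul, abs_two]; gcongr
      _ ≤ _ := by linarith
  calc |q' - q| ≤ A * |q' - q| := le_mul_of_one_le_left (abs_nonneg _) hA1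
    _ = |A * (q' - q)| := by rw [abs_mul, abs_of_pos hA.1]
    _ ≤ (75 * Z) * (25 * V) + n * ((3 * Z) * V) := by
      rw [e]; exact (abs_add_le _ _).trans (add_le_add b1 b2)
    _ = _ := by ring

lemma IsExceptional.exists_abs_rpow_sub_le {n : ℕ} (hn : IsExceptional n) {AB : ℤ × ℤ}
    (h : AB ∈ forms n) (V : ℕ) : ∃ C : ℝ, 0 ≤ C ∧ ∀ s ∈ Set.Icc (1 : ℝ) 2, ∀ z v : ℤ × ℤ,
      ‖v‖ ≤ V → |(formValue n AB (z + v).1 (z + v).2 : ℝ) ^ (-s) -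
        (formValue n AB z.1 z.2 : ℝ) ^ (-s)| ≤ C * (max 1 ‖z‖) ^ (-3 : ℝ) := by
  refine ⟨(2 * V + 20) ^ 3 + 51200 * ((1875 + 3 * n) * V), by positivity,
    fun s hs z v hv => ?_⟩
  have hs0 : 0 < s := by linarith [hs.1]
  have hq := hn.formValue_nonneg h z.1 z.2
  have hq' := hn.formValue_nonneg h (z + v).1 (z + v).2
  have hM : 0 < max 1 ‖z‖ := by positivity
  have hcube : (max 1 ‖z‖) ^ (-3 : ℝ) = ((max 1 ‖z‖) ^ 3)⁻¹ := by
    rw [Real.rpow_neg hM.le]; norm_cast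
  rw [hcube, ← div_eq_mul_inv, le_div_iff₀ (by positivity)]
  by_cases hz : ‖z‖ ≤ 2 * V + 20
  · have h1 : |(formValue n AB (z + v).1 (z + v).2 : ℝ) ^ (-s) -
        (formValue n AB z.1 z.2 : ℝ) ^ (-s)| ≤ 1 := by
      have a1 := intCast_rpow_neg_le_one hq hs0
      have a2 := intCast_rpow_neg_le_one hq' hs0
      have a3 : (0 : ℝ) ≤ (formValue n AB z.1 z.2 : ℝ) ^ (-s) :=
        Real.rpow_nonneg (by exact_mod_cast hq) _
      have a4 : (0 : ℝ) ≤ (formValue n AB (z + v).1 (z + v).2 : ℝ) ^ (-s) :=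
        Real.rpow_nonneg (by exact_mod_cast hq') _
      rw [abs_le]; constructor <;> linarith
    have h2 : max 1 ‖z‖ ≤ 2 * V + 20 := max_le (by linarith [Nat.cast_nonneg (α := ℝ) V]) hz
    calc _ ≤ 1 * (2 * V + 20 : ℝ) ^ 3 := by gcongr
      _ ≤ _ := by
        have : (0 : ℝ) ≤ 51200 * ((1875 + 3 * n) * V) := by positivity
        linarith
  · push Not at hz
    have hV : (0 : ℝ) ≤ V := Nat.cast_nonneg V
    have h1 : max 1 ‖z‖ = ‖z‖ := max_eq_right (by linarith)
    rw [h1] at hM ⊢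
    have h2 : ‖z‖ / 2 ≤ ‖z + v‖ := by
      have := norm_sub_le (z + v) v
      rw [add_sub_cancel_right] at this
      linarith
    have m1 : ‖z‖ ^ 2 / 160 ≤ formValue n AB z.1 z.2 := by
      have := hn.norm_sq_le h z
      linarith [sq_nonneg ‖z‖]
    have m2 : ‖z‖ ^ 2 / 160 ≤ formValue n AB (z + v).1 (z + v).2 := by
      have := hn.norm_sq_le h (z + v)
      have : (‖z‖ / 2) ^ 2 ≤ ‖z + v‖ ^ 2 := by gcongr
      linarith
    have h3 := abs_rpow_neg_sub_le (m := ‖z‖ ^ 2 / 160) (by nlinarith) m2 m1 hs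
    have h4 := hn.abs_formValue_sub_le h (z := z) (v := v) (by linarith)
    calc _ ≤ 2 / (‖z‖ ^ 2 / 160) ^ 2 * ((1875 + 3 * n) * V * ‖z‖) * ‖z‖ ^ 3 := by
          refine mul_le_mul_of_nonneg_right (h3.trans ?_) (by positivity)
          refine mul_le_mul_of_nonneg_left (h4.trans ?_) (by positivity)
          gcongr
      _ = 51200 * ((1875 + 3 * n) * V) := by
          field_simp
          ring
      _ ≤ _ := by
          have : (0 : ℝ) ≤ (2 * V + 20) ^ 3 := by positivity
          linarith

end NonunitSquares

namespace NonunitSquares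

open Filter Topology

/-- The sum of `W z * q(z) ^ (-s)` over one block of lattice points. -/
noncomputable def blockSum {ι : Type} [Fintype ι] (n : ℕ) (AB : ℤ × ℤ) (e : (ℤ × ℤ) × ι ≃ ℤ × ℤ)
    (W : ℤ × ℤ → ℝ) (s : ℝ) (w : ℤ × ℤ) : ℝ :=
  ∑ i, W (e (w, i)) * (formValue n AB (e (w, i)).1 (e (w, i)).2 : ℝ) ^ (-s)

section

variable {n : ℕ} {AB : ℤ × ℤ} {ι : Type} [Fintype ι] {e : (ℤ × ℤ) × ι ≃ ℤ × ℤ} {W : ℤ × ℤ → ℝ}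
  {M : ℝ}

lemma IsExceptional.summable_mul_formValue (hn : IsExceptional n) (h : AB ∈ forms n)
    (hM : ∀ z, |W z| ≤ M) {s : ℝ} (hs : 1 < s) :
    Summable fun z : ℤ × ℤ => W z * (formValue n AB z.1 z.2 : ℝ) ^ (-s) := by
  refine Summable.of_norm_bounded ((hn.summable_formValue h hs).mul_left M) fun z => ?_
  have h1 : (0 : ℝ) ≤ formValue n AB z.1 z.2 := by
    exact_mod_cast hn.formValue_nonneg h z.1 z.2
  rw [norm_mul, Real.norm_of_nonneg (Real.rpow_nonneg h1 _)]
  exact mul_le_mul_of_nonneg_right (hM z) (Real.rpow_nonneg h1 _)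

lemma IsExceptional.tsum_eq_tsum_blockSum (hn : IsExceptional n) (h : AB ∈ forms n)
    (hM : ∀ z, |W z| ≤ M) {s : ℝ} (hs : 1 < s) :
    ∑' z : ℤ × ℤ, W z * (formValue n AB z.1 z.2 : ℝ) ^ (-s) = ∑' w, blockSum n AB e W s w := by
  have h1 := hn.summable_mul_formValue h hM hs
  rw [← e.tsum_eq]
  exact (Summable.tsum_prod (e.summable_iff.mpr h1)).trans
    (tsum_congr fun w => tsum_fintype _)

lemma IsExceptional.exists_abs_blockSum_le (hn : IsExceptional n) (h : AB ∈ forms n)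
    (hM : ∀ z, |W z| ≤ M) {V : ℕ} {b : ℤ × ℤ → ℤ × ℤ} (hb : ∀ w, ‖w‖ ≤ ‖b w‖)
    (he : ∀ w i, ‖e (w, i) - b w‖ ≤ V) (hW : ∀ w, ∑ i, W (e (w, i)) = 0) :
    ∃ C : ℝ, ∀ s ∈ Set.Icc (1 : ℝ) 2, ∀ w,
      |blockSum n AB e W s w| ≤ C * (max 1 ‖w‖) ^ (-3 : ℝ) := by
  obtain ⟨C, hC0, hC⟩ := hn.exists_abs_rpow_sub_le h V
  refine ⟨Fintype.card ι * (M * C), fun s hs w => ?_⟩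
  have h1 : blockSum n AB e W s w = ∑ i, W (e (w, i)) *
      ((formValue n AB (e (w, i)).1 (e (w, i)).2 : ℝ) ^ (-s) -
        (formValue n AB (b w).1 (b w).2 : ℝ) ^ (-s)) := by
    simp only [mul_sub, Finset.sum_sub_distrib]
    rw [← Finset.sum_mul, hW, zero_mul, sub_zero, blockSum]
  have hM0 : 0 ≤ M := (abs_nonneg _).trans (hM 0)
  have h2 : (max 1 ‖b w‖) ^ (-3 : ℝ) ≤ (max 1 ‖w‖) ^ (-3 : ℝ) :=
    Real.rpow_le_rpow_of_nonpos (by positivity) (max_le_max le_rfl (hb w)) (by norm_num)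
  rw [h1]
  calc _ ≤ ∑ i : ι, M * (C * (max 1 ‖w‖) ^ (-3 : ℝ)) := by
        refine (Finset.abs_sum_le_sum_abs _ _).trans (Finset.sum_le_sum fun i _ => ?_)
        rw [abs_mul]
        refine mul_le_mul (hM _) ?_ (abs_nonneg _) hM0
        have := hC s hs (b w) (e (w, i) - b w) (he w i)
        rw [add_sub_cancel] at this
        exact this.trans (mul_le_mul_of_nonneg_left h2 hC0)
    _ = _ := by
        rw [Finset.sum_const, Finset.card_univ, nsmul_eq_mul]
        ring

lemma eventually_mem_Icc : ∀ᶠ s : ℝ in 𝓝[>] 1, s ∈ Set.Icc (1 : ℝ) 2 := by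
  filter_upwards [Ioo_mem_nhdsGT (show (1 : ℝ) < 2 by norm_num)] with s hs
  exact ⟨hs.1.le, hs.2.le⟩

lemma IsExceptional.tendsto_tsum (hn : IsExceptional n) (h : AB ∈ forms n)
    (hM : ∀ z, |W z| ≤ M) {V : ℕ} {b : ℤ × ℤ → ℤ × ℤ} (hb : ∀ w, ‖w‖ ≤ ‖b w‖)
    (he : ∀ w i, ‖e (w, i) - b w‖ ≤ V) (hW : ∀ w, ∑ i, W (e (w, i)) = 0) :
    Summable (blockSum n AB e W 1) ∧
    Tendsto (fun s : ℝ => ∑' z : ℤ × ℤ, W z * (formValue n AB z.1 z.2 : ℝ) ^ (-s)) (𝓝[>] 1)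
      (𝓝 (∑' w, blockSum n AB e W 1 w)) := by
  obtain ⟨C, hC⟩ := hn.exists_abs_blockSum_le h hM hb he hW
  have hsum := (summable_max_one_norm (k := 3) (by norm_num)).mul_left C
  refine ⟨Summable.of_norm_bounded hsum fun w => hC 1 (by norm_num) w, ?_⟩
  have h1 : Tendsto (fun s => ∑' w, blockSum n AB e W s w) (𝓝[>] 1)
      (𝓝 (∑' w, blockSum n AB e W 1 w)) := by
    refine tendsto_tsum_of_dominated_convergence hsum (fun w => ?_) ?_
    · have : ContinuousAt (fun s => blockSum n AB e W s w) 1 := by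
        unfold blockSum
        refine tendsto_finsetSum _ fun i _ => ?_
        refine Tendsto.const_mul _ ?_
        exact ((Real.continuousAt_const_rpow' (by norm_num)).comp continuous_neg.continuousAt)
      exact this.tendsto.mono_left nhdsWithin_le_nhds
    · filter_upwards [eventually_mem_Icc] with s hs w
      exact hC s hs w
  refine h1.congr' ?_
  filter_upwards [self_mem_nhdsWithin] with s hs
  exact (hn.tsum_eq_tsum_blockSum h hM hs).symm

/-- Splits the first coordinate into residue classes. -/
def rowEquiv (P : ℕ) [NeZero P] : (ℤ × ℤ) × Fin P ≃ ℤ × ℤ where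
  toFun p := (p.1.1 * P + (p.2 : ℕ), p.1.2)
  invFun z := ((((Int.divModEquiv P) z.1).1, z.2), ((Int.divModEquiv P) z.1).2)
  left_inv p := by
    have := (Int.divModEquiv P).apply_symm_apply (p.1.1, p.2)
    simp only [Int.divModEquiv_symm_apply] at this
    simp only [this]
  right_inv z := by
    have := (Int.divModEquiv P).symm_apply_apply z.1
    simp only [Int.divModEquiv_symm_apply] at this
    simp only [this]

/-- Splits both coordinates into residue classes. -/
def boxEquiv (P : ℕ) [NeZero P] : (ℤ × ℤ) × (Fin P × Fin P) ≃ ℤ × ℤ where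
  toFun p := (p.1.1 * P + (p.2.1 : ℕ), p.1.2 * P + (p.2.2 : ℕ))
  invFun z := ((((Int.divModEquiv P) z.1).1, ((Int.divModEquiv P) z.2).1),
    (((Int.divModEquiv P) z.1).2, ((Int.divModEquiv P) z.2).2))
  left_inv p := by
    have h1 := (Int.divModEquiv P).apply_symm_apply (p.1.1, p.2.1)
    have h2 := (Int.divModEquiv P).apply_symm_apply (p.1.2, p.2.2)
    simp only [Int.divModEquiv_symm_apply] at h1 h2
    simp only [h1, h2]
  right_inv z := by
    have h1 := (Int.divModEquiv P).symm_apply_apply z.1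
    have h2 := (Int.divModEquiv P).symm_apply_apply z.2
    simp only [Int.divModEquiv_symm_apply] at h1 h2
    simp only [h1, h2]

lemma norm_le_norm_mul {P : ℕ} [NeZero P] (t : ℤ) : ‖t‖ ≤ ‖t * (P : ℤ)‖ := by
  have hP : 1 ≤ P := NeZero.one_le
  rw [Int.norm_eq_abs, Int.norm_eq_abs, Int.cast_mul, abs_mul]
  refine le_mul_of_one_le_right (abs_nonneg _) ?_
  simpa using hP

lemma norm_fin_le {P : ℕ} (r : Fin P) : ‖((r : ℕ) : ℤ)‖ ≤ (P : ℝ) := by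
  rw [Int.norm_natCast]
  exact_mod_cast r.2.le

lemma IsExceptional.tendsto_tsum_row (hn : IsExceptional n) (h : AB ∈ forms n)
    (hM : ∀ z, |W z| ≤ M) {P : ℕ} [NeZero P]
    (hW : ∀ w, ∑ i, W (rowEquiv P (w, i)) = 0) :
    Summable (blockSum n AB (rowEquiv P) W 1) ∧
    Tendsto (fun s : ℝ => ∑' z : ℤ × ℤ, W z * (formValue n AB z.1 z.2 : ℝ) ^ (-s)) (𝓝[>] 1)
      (𝓝 (∑' w, blockSum n AB (rowEquiv P) W 1 w)) := by
  refine hn.tendsto_tsum h hM (V := P) (b := fun w => (w.1 * P, w.2)) (fun w => ?_)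
    (fun w i => ?_) hW
  · rw [Prod.norm_def, Prod.norm_def]
    exact max_le_max (norm_le_norm_mul _) le_rfl
  · simp only [rowEquiv, Equiv.coe_fn_mk, Prod.mk_sub_mk, add_sub_cancel_left, sub_self,
      Prod.norm_def, norm_zero]
    exact max_le (norm_fin_le i) (Nat.cast_nonneg P)

lemma IsExceptional.tendsto_tsum_box (hn : IsExceptional n) (h : AB ∈ forms n)
    (hM : ∀ z, |W z| ≤ M) {P : ℕ} [NeZero P]
    (hW : ∀ w, ∑ i, W (boxEquiv P (w, i)) = 0) :
    Tendsto (fun s : ℝ => ∑' z : ℤ × ℤ, W z * (formValue n AB z.1 z.2 : ℝ) ^ (-s)) (𝓝[>] 1)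
      (𝓝 (∑' w, blockSum n AB (boxEquiv P) W 1 w)) := by
  refine (hn.tendsto_tsum h hM (V := P) (b := fun w => (w.1 * P, w.2 * P)) (fun w => ?_)
    (fun w i => ?_) hW).2
  · rw [Prod.norm_def, Prod.norm_def]
    exact max_le_max (norm_le_norm_mul _) (norm_le_norm_mul _)
  · simp only [boxEquiv, Equiv.coe_fn_mk, Prod.mk_sub_mk, add_sub_cancel_left, Prod.norm_def]
    exact max_le (norm_fin_le _) (norm_fin_le _)

end

end NonunitSquares

namespace NonunitSquares

open Filter Topology

def baseForms (n : ℕ) : Finset (ℤ × ℤ) :=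
  if n % 2 = 1 then {(1, 0), (4, 1), (4, -1)} else {(1, 0), (2, 0)}

lemma sum_forms (n : ℕ) (f : ℤ × ℤ → ℝ) :
    ∑ AB ∈ forms n, f AB = ∑ AB ∈ baseForms n, (f AB + f (5 * AB.1, 5 * AB.2)) := by
  unfold forms baseForms
  split_ifs <;> simp <;> ring

lemma mem_forms_of_mem_baseForms {n : ℕ} {AB : ℤ × ℤ} (h : AB ∈ baseForms n) :
    AB ∈ forms n ∧ (5 * AB.1, 5 * AB.2) ∈ forms n ∧ (AB.1 + 1) * AB.2 = 5 * AB.2 := by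
  unfold baseForms at h
  unfold forms
  split_ifs at h ⊢ <;> simp only [Finset.mem_insert, Finset.mem_singleton] at h <;>
    rcases h with rfl | h <;> try rcases h with rfl | h
  all_goals first | subst h | skip
  all_goals simp

lemma IsExceptional.five_mul_formValue {n : ℕ} (hn : IsExceptional n) {AB : ℤ × ℤ}
    (h : AB ∈ baseForms n) (x y : ℤ) :
    5 * formValue n (5 * AB.1, 5 * AB.2) x y = formValue n AB (5 * x + AB.2 * y) y := by
  obtain ⟨h1, h2, h3⟩ := mem_forms_of_mem_baseForms h
  have e1 := hn.mul_formValue h1 (5 * x + AB.2 * y) y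
  have e2 := hn.mul_formValue h2 x y
  simp only at e2
  have hA : AB.1 ≠ 0 := (forms_pos (A := AB.1) (B := AB.2) h1).1.ne'
  apply mul_left_cancel₀ hA
  have h4 : AB.1 * (5 * x + AB.2 * y) + AB.2 * y = 5 * AB.1 * x + 5 * AB.2 * y := by
    linear_combination y * h3
  rw [h4] at e1
  linear_combination e2 - e1

section

variable {n N : ℕ} (χ : MulChar (ZMod N) ℤ)

/-- The weight supported on the sublattice coming from the partner form. -/
noncomputable def boxWeight (n : ℕ) (AB z : ℤ × ℤ) : ℝ :=
  (χ (formValue n AB z.1 z.2 : ZMod N) : ℝ) *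
    if ((z.1 - AB.2 * z.2 : ℤ) : ZMod 5) = 0 then 1 else 0

noncomputable def rowWeight (n : ℕ) (AB z : ℤ × ℤ) : ℝ :=
  (χ (formValue n AB z.1 z.2 : ZMod N) : ℝ) *
    if ((z.1 - AB.2 * z.2 : ℤ) : ZMod 5) = 0 then -4 else 1

variable {χ}

lemma IsTwist.abs_boxWeight_le (hχ : IsTwist n N χ) (AB z : ℤ × ℤ) : |boxWeight χ n AB z| ≤ 1 := by
  have h : |(χ (formValue n AB z.1 z.2 : ZMod N) : ℝ)| ≤ 1 := by exact_mod_cast hχ.abs_le _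
  unfold boxWeight
  split_ifs <;> simp [h]

lemma IsTwist.abs_rowWeight_le (hχ : IsTwist n N χ) (AB z : ℤ × ℤ) : |rowWeight χ n AB z| ≤ 4 := by
  have h : |(χ (formValue n AB z.1 z.2 : ZMod N) : ℝ)| ≤ 1 := by exact_mod_cast hχ.abs_le _
  unfold rowWeight
  split_ifs
  · rw [abs_mul, abs_neg]
    norm_num
    linarith
  · rw [mul_one]
    linarith

lemma IsTwist.tsum_partner (hn : IsExceptional n) (hχ : IsTwist n N χ) {AB : ℤ × ℤ}
    (h : AB ∈ baseForms n) (s : ℝ) :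
    ∑' z : ℤ × ℤ, (χ (formValue n (5 * AB.1, 5 * AB.2) z.1 z.2 : ZMod N) : ℝ) *
        (formValue n (5 * AB.1, 5 * AB.2) z.1 z.2 : ℝ) ^ (-s) =
      -(5 ^ s * ∑' z : ℤ × ℤ, boxWeight χ n AB z * (formValue n AB z.1 z.2 : ℝ) ^ (-s)) := by
  let g : ℤ × ℤ → ℤ × ℤ := fun z => (5 * z.1 + AB.2 * z.2, z.2)
  have hg : Function.Injective g := by
    rintro ⟨x, y⟩ ⟨x', y'⟩ hxy
    simp only [g, Prod.mk.injEq] at hxy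
    obtain ⟨h1, rfl⟩ := hxy
    ext
    · simp only
      omega
    · rfl
  rw [← hg.tsum_eq (f := fun z : ℤ × ℤ => boxWeight χ n AB z *
    (formValue n AB z.1 z.2 : ℝ) ^ (-s)), ← tsum_mul_left, ← tsum_neg]
  · refine tsum_congr fun z => ?_
    have h1 := hn.five_mul_formValue h z.1 z.2
    have h2 : (χ (formValue n (5 * AB.1, 5 * AB.2) z.1 z.2 : ZMod N) : ℤ) =
        -χ (formValue n AB (5 * z.1 + AB.2 * z.2) z.2 : ZMod N) := by
      rw [← h1]
      push_cast
      rw [map_mul, hχ.five]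
      ring
    have h3 : (0 : ℝ) ≤ formValue n AB (5 * z.1 + AB.2 * z.2) z.2 := by
      exact_mod_cast hn.formValue_nonneg (mem_forms_of_mem_baseForms h).1 _ _
    have h4 : (formValue n (5 * AB.1, 5 * AB.2) z.1 z.2 : ℝ) =
        (formValue n AB (5 * z.1 + AB.2 * z.2) z.2 : ℝ) / 5 := by
      rw [← h1]
      push_cast
      ring
    have h5 : ((5 * z.1 + AB.2 * z.2 - AB.2 * z.2 : ℤ) : ZMod 5) = 0 := by
      rw [add_sub_cancel_right, Int.cast_mul]
      rw [show ((5 : ℤ) : ZMod 5) = 0 by rfl, zero_mul]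
    simp only [g, boxWeight]
    rw [h2, h4, Real.div_rpow h3 (by norm_num), Real.rpow_neg (by norm_num : (0 : ℝ) ≤ 5),
      if_pos h5]
    push_cast
    field_simp
  · intro z hz
    have h1 : ((z.1 - AB.2 * z.2 : ℤ) : ZMod 5) = 0 := by
      by_contra h0
      rw [Function.mem_support, boxWeight, if_neg h0, mul_zero, zero_mul] at hz
      exact hz rfl
    obtain ⟨k, hk⟩ := (ZMod.intCast_zmod_eq_zero_iff_dvd _ 5).mp h1
    refine ⟨(k, z.2), Prod.ext ?_ rfl⟩
    simp only [g]
    push_cast at hk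
    linarith

lemma IsTwist.sum_tsum_eq (hn : IsExceptional n) (hχ : IsTwist n N χ) {s : ℝ} (hs : 1 < s) :
    ∑ AB ∈ forms n, ∑' z : ℤ × ℤ, (χ (formValue n AB z.1 z.2 : ZMod N) : ℝ) *
        (formValue n AB z.1 z.2 : ℝ) ^ (-s) =
      ∑ AB ∈ baseForms n,
        (∑' z : ℤ × ℤ, rowWeight χ n AB z * (formValue n AB z.1 z.2 : ℝ) ^ (-s) -
          (5 ^ s - 5) *
            ∑' z : ℤ × ℤ, boxWeight χ n AB z * (formValue n AB z.1 z.2 : ℝ) ^ (-s)) := by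
  rw [sum_forms]
  refine Finset.sum_congr rfl fun AB h => ?_
  have h1 := (mem_forms_of_mem_baseForms h).1
  have s1 := hn.summable_mul_formValue h1 (hχ.abs_rowWeight_le AB) hs
  have s2 := hn.summable_mul_formValue h1 (hχ.abs_boxWeight_le AB) hs
  have e : ∑' z : ℤ × ℤ, (χ (formValue n AB z.1 z.2 : ZMod N) : ℝ) *
        (formValue n AB z.1 z.2 : ℝ) ^ (-s) =
      ∑' z : ℤ × ℤ, rowWeight χ n AB z * (formValue n AB z.1 z.2 : ℝ) ^ (-s) +
        5 * ∑' z : ℤ × ℤ, boxWeight χ n AB z * (formValue n AB z.1 z.2 : ℝ) ^ (-s) := by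
    rw [← tsum_mul_left, ← s1.tsum_add (s2.mul_left 5)]
    refine tsum_congr fun z => ?_
    simp only [rowWeight, boxWeight]
    split_ifs <;> ring
  rw [e, hχ.tsum_partner hn h]
  ring

lemma IsTwist.coprime (hχ : IsTwist n N χ) : Nat.Coprime 5 N := by
  by_contra h
  have h1 : ¬IsUnit ((5 : ℕ) : ZMod N) := fun h' => h ((ZMod.isUnit_iff_coprime 5 N).mp h')
  have h2 := χ.map_nonunit h1
  have h3 := hχ.five
  push_cast at h2
  omega

lemma sum_fin_mul [NeZero N] (hN : Nat.Coprime 5 N) (F : ZMod N → ℝ) (G : ZMod 5 → ℝ) :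
    ∑ r : Fin (5 * N), F ((r : ℕ) : ZMod N) * G ((r : ℕ) : ZMod 5) = (∑ a, F a) * ∑ b, G b := by
  rw [Fintype.sum_mul_sum, ← Fintype.sum_prod_type']
  have hbij : Function.Bijective fun r : Fin (5 * N) =>
      (((r : ℕ) : ZMod N), ((r : ℕ) : ZMod 5)) := by
    rw [Fintype.bijective_iff_injective_and_card]
    constructor
    · intro r r' hr
      simp only [Prod.mk.injEq, ZMod.natCast_eq_natCast_iff] at hr
      have h1 := (Nat.modEq_and_modEq_iff_modEq_mul hN).mp ⟨hr.2, hr.1⟩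
      exact Fin.ext (Nat.ModEq.eq_of_lt_of_lt h1 r.2 r'.2)
    · simp [ZMod.card, mul_comm]
  exact hbij.sum_comp fun p => F p.1 * G p.2

lemma sum_fin_eq_mul [NeZero N] (hN : Nat.Coprime 5 N) (F : ZMod N → ℝ) (G : ZMod 5 → ℝ)
    {H : Fin (5 * N) → ℝ} (h : ∀ r, H r = F ((r : ℕ) : ZMod N) * G ((r : ℕ) : ZMod 5)) :
    ∑ r, H r = (∑ a, F a) * ∑ b, G b := by
  rw [← sum_fin_mul hN]
  exact Finset.sum_congr rfl fun r _ => h r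

/-- The form reduced modulo `N`. -/
def formMod (N n : ℕ) (AB : ℤ × ℤ) (a b : ZMod N) : ZMod N :=
  AB.1 * a ^ 2 + 2 * AB.2 * a * b + (((n + AB.2 ^ 2) / AB.1 : ℤ) : ZMod N) * b ^ 2

lemma formValue_cast (AB : ℤ × ℤ) (x y : ℤ) :
    (formValue n AB x y : ZMod N) = formMod N n AB x y := by
  simp only [formValue, formMod]
  push_cast
  ring

lemma IsTwist.sum_formMod [NeZero N] (hn : IsExceptional n) (hχ : IsTwist n N χ) {AB : ℤ × ℤ}
    (h : AB ∈ forms n) : ∑ p : ZMod N × ZMod N, (χ (formMod N n AB p.1 p.2) : ℝ) = 0 := by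
  obtain ⟨u, v, huv⟩ := hχ.norm_neg
  obtain ⟨A, B⟩ := AB
  obtain ⟨C, hC⟩ := hn.dvd_of_mem_forms h
  have hdiv : ((n : ℤ) + B ^ 2) / A = C := by
    rw [hC, Int.mul_ediv_cancel_left _ (forms_pos h).1.ne']
  have hC' : (n : ZMod N) + B ^ 2 = A * C := by exact_mod_cast congrArg (Int.cast : ℤ → ZMod N) hC
  have hunit : IsUnit (u ^ 2 + n * v ^ 2) := by
    by_contra h0
    rw [χ.map_nonunit h0] at huv
    omega
  let g : ZMod N × ZMod N → ZMod N × ZMod N := fun p =>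
    ((u - B * v) * p.1 - v * C * p.2, v * A * p.1 + (v * B + u) * p.2)
  have hg : Function.Bijective g := by
    rw [← Finite.injective_iff_bijective]
    rintro ⟨x, y⟩ ⟨x', y'⟩ hxy
    simp only [g, Prod.mk.injEq] at hxy
    obtain ⟨h1, h2⟩ := hxy
    refine Prod.ext (hunit.mul_left_cancel ?_) (hunit.mul_left_cancel ?_)
    · dsimp only
      linear_combination (v * B + u) * h1 + v * C * h2 + (x - x') * v ^ 2 * hC'
    · dsimp only
      linear_combination (-v * A) * h1 + (u - B * v) * h2 + (y - y') * v ^ 2 * hC'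
  have h1 : ∑ p : ZMod N × ZMod N, (χ (formMod N n (A, B) p.1 p.2) : ℝ) =
      -∑ p : ZMod N × ZMod N, (χ (formMod N n (A, B) p.1 p.2) : ℝ) := by
    conv_lhs => rw [← hg.sum_comp]
    rw [← Finset.sum_neg_distrib]
    refine Finset.sum_congr rfl fun p _ => ?_
    have h2 : formMod N n (A, B) (g p).1 (g p).2 =
        (u ^ 2 + n * v ^ 2) * formMod N n (A, B) p.1 p.2 := by
      simp only [formMod, g, hdiv]
      linear_combination (-v ^ 2 * (A * p.1 ^ 2 + 2 * B * p.1 * p.2 + C * p.2 ^ 2)) * hC'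
    rw [h2, map_mul, huv]
    push_cast
    ring
  linarith

lemma intCast_eq_zero_iff_natCast_eq (t c : ℤ) (r : ℕ) :
    ((t * ((5 * N : ℕ) : ℤ) + (r : ℕ) - c : ℤ) : ZMod 5) = 0 ↔ (r : ZMod 5) = c := by
  have h5 : ((5 : ℕ) : ZMod 5) = 0 := rfl
  rw [← sub_eq_zero (a := (r : ZMod 5))]
  push_cast at h5 ⊢
  rw [h5]
  ring_nf

lemma IsTwist.sum_rowWeight [NeZero N] (hχ : IsTwist n N χ) (AB w : ℤ × ℤ) :
    ∑ r, rowWeight χ n AB (rowEquiv (5 * N) (w, r)) = 0 := by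
  rw [sum_fin_eq_mul hχ.coprime (fun a => (χ (formMod N n AB a w.2) : ℝ))
    (fun b => if b = ((AB.2 * w.2 : ℤ) : ZMod 5) then (-4 : ℝ) else 1)]
  · rw [Finset.sum_ite, Finset.sum_const, Finset.sum_const, Finset.filter_eq', Finset.filter_ne']
    simp [ZMod.card]
  · intro r
    simp only [rowWeight, rowEquiv, Equiv.coe_fn_mk, formValue_cast,
      intCast_eq_zero_iff_natCast_eq]
    push_cast
    simp

lemma IsTwist.sum_boxWeight [NeZero N] (hn : IsExceptional n) (hχ : IsTwist n N χ)
    {AB : ℤ × ℤ} (h : AB ∈ forms n) (w : ℤ × ℤ) :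
    ∑ r, boxWeight χ n AB (boxEquiv (5 * N) (w, r)) = 0 := by
  have h5 : (5 : ZMod 5) = 0 := rfl
  rw [Fintype.sum_prod_type_right]
  have h2 (r' : Fin (5 * N)) : ∑ r, boxWeight χ n AB (boxEquiv (5 * N) (w, r, r')) =
      ∑ a : ZMod N, (χ (formMod N n AB a ((r' : ℕ) : ZMod N)) : ℝ) := by
    rw [sum_fin_eq_mul hχ.coprime
      (fun a => (χ (formMod N n AB a ((r' : ℕ) : ZMod N)) : ℝ))
      (fun b => if b = ((AB.2 * (w.2 * ((5 * N : ℕ) : ℤ) + (r' : ℕ)) : ℤ) : ZMod 5)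
        then (1 : ℝ) else 0)]
    · simp
    · intro r
      simp only [boxWeight, boxEquiv, Equiv.coe_fn_mk, formValue_cast,
        intCast_eq_zero_iff_natCast_eq]
      push_cast
      simp
  have h3 := hχ.sum_formMod hn h
  rw [Fintype.sum_prod_type_right] at h3
  rw [Finset.sum_congr rfl fun r' _ => h2 r', sum_fin_eq_mul hχ.coprime
    (fun b => ∑ a : ZMod N, (χ (formMod N n AB a b) : ℝ)) (fun _ => 1) (by simp), h3, zero_mul]

theorem IsTwist.tendsto_sum_forms [NeZero N] (hn : IsExceptional n) (hχ : IsTwist n N χ) :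
    Tendsto (fun s : ℝ => ∑ AB ∈ forms n, ∑' z : ℤ × ℤ,
        (χ (formValue n AB z.1 z.2 : ZMod N) : ℝ) * (formValue n AB z.1 z.2 : ℝ) ^ (-s)) (𝓝[>] 1)
      (𝓝 (∑ AB ∈ baseForms n,
        ∑' w, blockSum n AB (rowEquiv (5 * N)) (rowWeight χ n AB) 1 w)) := by
  have h1 : Tendsto (fun s : ℝ => ∑ AB ∈ baseForms n,
        (∑' z : ℤ × ℤ, rowWeight χ n AB z * (formValue n AB z.1 z.2 : ℝ) ^ (-s) -
          (5 ^ s - 5) *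
            ∑' z : ℤ × ℤ, boxWeight χ n AB z * (formValue n AB z.1 z.2 : ℝ) ^ (-s))) (𝓝[>] 1)
      (𝓝 (∑ AB ∈ baseForms n,
        ∑' w, blockSum n AB (rowEquiv (5 * N)) (rowWeight χ n AB) 1 w)) := by
    refine tendsto_finsetSum _ fun AB h => ?_
    have hf := (mem_forms_of_mem_baseForms h).1
    have t1 := (hn.tendsto_tsum_row hf (hχ.abs_rowWeight_le AB) (hχ.sum_rowWeight AB)).2
    have t2 := hn.tendsto_tsum_box hf (hχ.abs_boxWeight_le AB) (hχ.sum_boxWeight hn hf)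
    have t3 : Tendsto (fun s : ℝ => (5 : ℝ) ^ s - 5) (𝓝[>] 1) (𝓝 0) := by
      have : ContinuousAt (fun s : ℝ => (5 : ℝ) ^ s - 5) 1 :=
        (Real.continuousAt_const_rpow (by norm_num)).sub continuousAt_const
      have h0 := this.tendsto.mono_left (nhdsWithin_le_nhds (s := Set.Ioi 1))
      simpa using h0
    simpa using t1.sub (t3.mul t2)
  refine h1.congr' ?_
  filter_upwards [self_mem_nhdsWithin] with s hs
  exact (hχ.sum_tsum_eq hn hs).symm

end

end NonunitSquares

namespace NonunitSquares

open Complex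

lemma summable_inv_sq_add_sq (a : ℝ) {b : ℝ} (hb : 0 < b) :
    Summable fun t : ℤ => ((t + a) ^ 2 + b ^ 2)⁻¹ := by
  have h1 := (Real.summable_one_div_int_add_rpow a 2).mpr (by norm_num)
  refine h1.of_norm_bounded_eventually ?_
  have hfin : {t : ℤ | (t : ℝ) + a = 0}.Finite := by
    refine Set.Subsingleton.finite fun x hx y hy => ?_
    have hx' : (x : ℝ) + a = 0 := hx
    have hy' : (y : ℝ) + a = 0 := hy
    exact_mod_cast (by linarith : (x : ℝ) = y)
  filter_upwards [hfin.compl_mem_cofinite] with t ht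
  have ht' : (t : ℝ) + a ≠ 0 := ht
  have h2 : 0 < ((t : ℝ) + a) ^ 2 := by positivity
  rw [Real.norm_of_nonneg (by positivity), one_div, show (2 : ℝ) = ((2 : ℕ) : ℝ) by norm_num,
    Real.rpow_natCast, sq_abs]
  exact inv_anti₀ h2 (le_add_of_nonneg_right (by positivity))

lemma abs_tsum_inv_sq_add_sq_sub_le (a : ℝ) {b : ℝ} (hb : 0 < b) :
    |∑' t : ℤ, ((t + a) ^ 2 + b ^ 2)⁻¹ - Real.pi / b| ≤
      Real.pi / b * (2 * Real.exp (-2 * Real.pi * b) / (1 - Real.exp (-2 * Real.pi * b))) := by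
  have hs := summable_inv_sq_add_sq a hb
  set f : ℤ → ℝ := fun t => ((t + a) ^ 2 + b ^ 2)⁻¹ with hf
  let z : UpperHalfPlane := ⟨a + b * I, by simpa using hb⟩
  have hz : (z : ℂ) = a + b * I := rfl
  have hzi : (z : ℂ) ∈ Complex.integerComplement := UpperHalfPlane.coe_mem_integerComplement z
  have him (t : ℤ) : (1 / ((z : ℂ) + t)).im = -(b * f t) := by
    have h1 : normSq ((z : ℂ) + t) = (t + a) ^ 2 + b ^ 2 := by
      rw [hz, normSq_apply]
      simp
      ring
    rw [one_div, inv_im, h1]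
    simp [hz, hf, div_eq_mul_inv]
  have hcot := Complex.hasSum_im ((summable_cotTerm hzi).hasSum)
  have hrep := cot_series_rep' hzi
  have hsum1 : ∑' n : ℕ, (cotTerm (z : ℂ) n).im = (∑' n : ℕ, cotTerm (z : ℂ) n).im := hcot.tsum_eq
  have hterm (n : ℕ) : (cotTerm (z : ℂ) n).im = -(b * f (n + 1)) + -(b * f (-(n + 1))) := by
    rw [cotTerm, add_im, ← him, ← him]
    push_cast
    rw [add_comm]
    ring_nf
  have hs1 : Summable fun n : ℕ => f (n + 1) :=
    hs.comp_injective (i := fun n : ℕ => (n : ℤ) + 1) fun m n h => by simpa using h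
  have hs0 : Summable fun n : ℕ => f n := hs.comp_injective Nat.cast_injective
  have hs2 : Summable fun n : ℕ => f (-(n + 1)) :=
    hs.comp_injective (i := fun n : ℕ => -((n : ℤ) + 1)) fun m n h => by simpa using h
  have htot : ∑' t : ℤ, f t = f 0 + (∑' n : ℕ, f (n + 1) + ∑' n : ℕ, f (-(n + 1))) := by
    rw [tsum_of_nat_of_neg_add_one hs0 hs2, hs0.tsum_eq_zero_add, add_assoc]
    push_cast
    rfl
  have hkey : (Real.pi * cot (Real.pi * z)).im = -(b * ∑' t : ℤ, f t) := by
    have h1 : ((Real.pi * cot (Real.pi * z)) - 1 / (z : ℂ)).im =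
        -(b * (∑' n : ℕ, f (n + 1) + ∑' n : ℕ, f (-(n + 1)))) := by
      rw [hrep, show (∑' n : ℕ, (1 / ((z : ℂ) - (n + 1)) + 1 / ((z : ℂ) + (n + 1)))) =
        ∑' n : ℕ, cotTerm (z : ℂ) n from rfl, ← hsum1]
      simp only [hterm]
      rw [(hs1.mul_left b).neg.tsum_add (hs2.mul_left b).neg, tsum_neg, tsum_neg, tsum_mul_left,
        tsum_mul_left]
      ring
    have h0 := him 0
    rw [sub_im] at h1
    simp only [Int.cast_zero, add_zero] at h0
    rw [htot]
    linarith
  have hq := UpperHalfPlane.norm_exp_two_pi_I_lt_one z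
  set Q := cexp (2 * Real.pi * I * z) with hQ
  have hnorm : ‖Q‖ = Real.exp (-2 * Real.pi * b) := by
    rw [hQ, norm_exp, hz]
    congr 1
    simp
  have h3 := pi_mul_cot_pi_q_exp z
  rw [tsum_geometric_of_norm_lt_one hq] at h3
  have hQ1 : 1 - Q ≠ 0 := by
    rw [sub_ne_zero]
    rintro h
    rw [← h, norm_one] at hq
    exact lt_irrefl _ hq
  have h4 : (Real.pi : ℂ) * cot (Real.pi * z) =
      -(Real.pi * I) - (2 * Real.pi : ℝ) * (I * (Q * (1 - Q)⁻¹)) := by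
    rw [h3]
    push_cast
    linear_combination (-2 * Real.pi * I) * mul_inv_cancel₀ hQ1
  have h5 : ∑' t : ℤ, f t - Real.pi / b = Real.pi / b * (2 * (Q * (1 - Q)⁻¹).re) := by
    rw [h4, sub_im, im_ofReal_mul, I_mul_im] at hkey
    simp only [neg_im, im_ofReal_mul, I_im, mul_one] at hkey
    generalize (Q * (1 - Q)⁻¹).re = r at hkey ⊢
    field_simp
    linarith
  have h6 : |(Q * (1 - Q)⁻¹).re| ≤ ‖Q‖ / (1 - ‖Q‖) := by
    refine (abs_re_le_norm _).trans ?_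
    rw [norm_mul, norm_inv, div_eq_mul_inv]
    have h7 : 1 - ‖Q‖ ≤ ‖1 - Q‖ := by simpa using norm_sub_norm_le 1 Q
    exact mul_le_mul_of_nonneg_left (inv_anti₀ (sub_pos.mpr hq) h7) (norm_nonneg _)
  have h8 : 0 < Real.pi / b := by positivity
  rw [h5, abs_mul, abs_of_pos h8, abs_mul, abs_two, ← hnorm, mul_div_assoc]
  gcongr

end NonunitSquares

namespace NonunitSquares

section

variable {n : ℕ} {AB : ℤ × ℤ} {P : ℕ} [NeZero P] {W : ℤ × ℤ → ℝ}

lemma IsExceptional.formValue_rowEquiv (hn : IsExceptional n) (h : AB ∈ forms n) (t y : ℤ)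
    (r : Fin P) :
    (formValue n AB (rowEquiv P ((t, y), r)).1 (rowEquiv P ((t, y), r)).2 : ℝ) =
      AB.1 * P ^ 2 * ((t + ((r : ℕ) + AB.2 / AB.1 * y) / P) ^ 2 +
        (√n * |(y : ℝ)| / (AB.1 * P)) ^ 2) := by
  have hA : (0 : ℝ) < AB.1 := by exact_mod_cast (forms_pos (A := AB.1) (B := AB.2) h).1
  have hP : (0 : ℝ) < P := by exact_mod_cast NeZero.pos P
  have h1 := congrArg (Int.cast : ℤ → ℝ)
    (hn.mul_formValue h (rowEquiv P ((t, y), r)).1 (rowEquiv P ((t, y), r)).2)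
  simp only [rowEquiv, Equiv.coe_fn_mk] at h1 ⊢
  push_cast at h1
  apply mul_left_cancel₀ hA.ne'
  rw [h1, div_pow, mul_pow, Real.sq_sqrt (Nat.cast_nonneg n), sq_abs]
  field_simp
  ring

lemma IsExceptional.abs_tsum_blockSum_row_le (hn : IsExceptional n) (h : AB ∈ forms n)
    (hA4 : AB.1 ≤ 4) (hP140 : P ≤ 140) (hM : ∀ z, |W z| ≤ 4)
    (hper : ∀ t y r, W (rowEquiv P ((t, y), r)) = W (rowEquiv P ((0, y), r)))
    (hW : ∀ w, ∑ r, W (rowEquiv P (w, r)) = 0) {y : ℤ} (hy : y ≠ 0) :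
    |∑' t : ℤ, blockSum n AB (rowEquiv P) W 1 (t, y)| ≤
      1 / 10 * Real.exp (-√n / 90) ^ y.natAbs := by
  have hA : (0 : ℝ) < AB.1 := by exact_mod_cast (forms_pos (A := AB.1) (B := AB.2) h).1
  have hA4' : (AB.1 : ℝ) ≤ 4 := by exact_mod_cast hA4
  have hP : (0 : ℝ) < P := by exact_mod_cast NeZero.pos P
  have hP140' : (P : ℝ) ≤ 140 := by exact_mod_cast hP140
  have hy1 : (1 : ℝ) ≤ |(y : ℝ)| := by exact_mod_cast Int.one_le_abs hy
  have hn1 : (1000 : ℝ) ≤ √n := by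
    apply Real.le_sqrt_of_sq_le
    have : ((10 ^ 6 : ℕ) : ℝ) ≤ n := by exact_mod_cast hn.large
    norm_num at this ⊢
    exact this
  set b : ℝ := √n * |(y : ℝ)| / (AB.1 * P) with hb
  have hb0 : 0 < b := by positivity
  set q : ℝ := Real.exp (-2 * Real.pi * b) with hq
  let a : Fin P → ℝ := fun r => ((r : ℕ) + AB.2 / AB.1 * y) / P
  let S : Fin P → ℝ := fun r => ∑' t : ℤ, ((t + a r) ^ 2 + b ^ 2)⁻¹
  have hS (r : Fin P) : |S r - Real.pi / b| ≤ Real.pi / b * (2 * q / (1 - q)) :=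
    abs_tsum_inv_sq_add_sq_sub_le (a r) hb0
  have hrow : ∑' t : ℤ, blockSum n AB (rowEquiv P) W 1 (t, y) =
      (AB.1 * P ^ 2 : ℝ)⁻¹ * ∑ r, W (rowEquiv P ((0, y), r)) * (S r - Real.pi / b) := by
    have h1 (t : ℤ) : blockSum n AB (rowEquiv P) W 1 (t, y) = ∑ r : Fin P,
        (AB.1 * P ^ 2 : ℝ)⁻¹ * W (rowEquiv P ((0, y), r)) * ((t + a r) ^ 2 + b ^ 2)⁻¹ := by
      refine Finset.sum_congr rfl fun r _ => ?_
      rw [hn.formValue_rowEquiv h, hper, Real.rpow_neg_one, mul_inv]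
      ring
    simp only [h1]
    rw [Summable.tsum_finsetSum fun r _ => (summable_inv_sq_add_sq (a r) hb0).mul_left _]
    simp only [mul_sub, Finset.sum_sub_distrib]
    rw [← Finset.sum_mul, hW, zero_mul, mul_zero, sub_zero, Finset.mul_sum]
    exact Finset.sum_congr rfl fun r _ => by rw [tsum_mul_left, mul_assoc]
  have hqE : q ≤ Real.exp (-√n / 90) ^ y.natAbs := by
    rw [← Real.exp_nat_mul, hq, Real.exp_le_exp, Nat.cast_natAbs, Int.cast_abs]
    have hb1 : √n * |(y : ℝ)| / 560 ≤ b := by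
      rw [hb]
      gcongr
      nlinarith
    nlinarith [Real.pi_gt_d2]
  have hq2 : q ≤ 1 / 2 := by
    refine hqE.trans ((pow_le_of_le_one (Real.exp_pos _).le ?_ (by simpa using hy)).trans ?_)
    · rw [Real.exp_le_one_iff]
      linarith
    · calc Real.exp (-√n / 90) ≤ Real.exp (-1) := Real.exp_le_exp.mpr (by linarith)
        _ ≤ _ := by linarith [Real.exp_neg_one_lt_d9]
  have hq0 : 0 < q := Real.exp_pos _
  have hbound : |∑ r, W (rowEquiv P ((0, y), r)) * (S r - Real.pi / b)| ≤
      P * (4 * (Real.pi / b * (2 * q / (1 - q)))) := by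
    refine (Finset.abs_sum_le_sum_abs _ _).trans ?_
    refine (Finset.sum_le_sum (g := fun _ => 4 * (Real.pi / b * (2 * q / (1 - q))))
      fun r _ => ?_).trans_eq (by simp)
    rw [abs_mul]
    exact mul_le_mul (hM _) (hS r) (abs_nonneg _) (by norm_num)
  rw [hrow, abs_mul, abs_of_pos (by positivity)]
  refine (mul_le_mul_of_nonneg_left hbound (by positivity)).trans ?_
  have e1 : (AB.1 * P ^ 2 : ℝ)⁻¹ * (P * (4 * (Real.pi / b * (2 * q / (1 - q))))) =
      8 * Real.pi / (√n * |(y : ℝ)|) * (q / (1 - q)) := by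
    rw [hb]
    have : 1 - q ≠ 0 := by linarith
    field_simp
    ring
  rw [e1]
  have e2 : q / (1 - q) ≤ 2 * q := by
    rw [div_le_iff₀ (by linarith)]
    nlinarith
  have e3 : 8 * Real.pi / (√n * |(y : ℝ)|) ≤ 1 / 20 := by
    rw [div_le_iff₀ (by positivity)]
    nlinarith [Real.pi_lt_d2]
  calc _ ≤ 1 / 20 * (2 * q) :=
        mul_le_mul e3 e2 (div_nonneg hq0.le (by linarith)) (by norm_num)
    _ ≤ _ := by linarith

lemma abs_tsum_sub_le {g : ℤ × ℤ → ℝ} (hg : Summable g) {E : ℝ} (hE0 : 0 ≤ E) (hE : E ≤ 1 / 2)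
    {c : ℝ} (hc : ∀ y : ℤ, y ≠ 0 → |∑' t : ℤ, g (t, y)| ≤ c * E ^ y.natAbs) :
    |∑' w, g w - ∑' t : ℤ, g (t, 0)| ≤ 4 * c * E := by
  have hswap : Summable fun w : ℤ × ℤ => g (w.2, w.1) :=
    (Equiv.prodComm ℤ ℤ).summable_iff.mpr hg
  have h1 : ∑' w, g w = ∑' y : ℤ, ∑' t : ℤ, g (t, y) := by
    rw [← (Equiv.prodComm ℤ ℤ).tsum_eq, ← hswap.tsum_prod]
    rfl
  set F : ℤ → ℝ := fun y => ∑' t : ℤ, g (t, y) with hF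
  have hFs : Summable F := hswap.prod
  have hs1 : Summable fun k : ℕ => F (k + 1) :=
    hFs.comp_injective (i := fun n : ℕ => (n : ℤ) + 1) fun m n h => by simpa using h
  have hs0 : Summable fun k : ℕ => F k := hFs.comp_injective Nat.cast_injective
  have hs2 : Summable fun k : ℕ => F (-(k + 1)) :=
    hFs.comp_injective (i := fun n : ℕ => -((n : ℤ) + 1)) fun m n h => by simpa using h
  have h2 : ∑' y, F y - F 0 = ∑' k : ℕ, F (k + 1) + ∑' k : ℕ, F (-(k + 1)) := by
    rw [tsum_of_nat_of_neg_add_one hs0 hs2, hs0.tsum_eq_zero_add]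
    push_cast
    ring
  have hgeo : HasSum (fun k : ℕ => c * E ^ (k + 1)) (c * E * (1 - E)⁻¹) := by
    simp only [pow_succ', ← mul_assoc]
    exact (hasSum_geometric_of_lt_one hE0 (by linarith)).mul_left (c * E)
  have hc0 : 0 ≤ c * E := by
    have := (abs_nonneg _).trans (hc 1 one_ne_zero)
    simpa using this
  have hinv : (1 - E)⁻¹ ≤ 2 := by
    rw [inv_le_comm₀ (by linarith) (by norm_num)]
    linarith
  have b1 : |∑' k : ℕ, F (k + 1)| ≤ c * E * (1 - E)⁻¹ := by
    rw [← Real.norm_eq_abs]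
    refine tsum_of_norm_bounded hgeo fun k => ?_
    have := hc (k + 1) (by omega)
    rwa [show ((k : ℤ) + 1).natAbs = k + 1 by omega] at this
  have b2 : |∑' k : ℕ, F (-(k + 1))| ≤ c * E * (1 - E)⁻¹ := by
    rw [← Real.norm_eq_abs]
    refine tsum_of_norm_bounded hgeo fun k => ?_
    have := hc (-(k + 1)) (by omega)
    rwa [show (-((k : ℤ) + 1)).natAbs = k + 1 by omega] at this
  rw [h1, h2]
  refine (abs_add_le _ _).trans ?_
  nlinarith

end

end NonunitSquares

namespace NonunitSquares

open Filter Topology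

/-- The summand `x⁻²` restricted to multiples of `d`. -/
noncomputable def invSqOn (d x : ℤ) : ℝ := if d ∣ x then ((x : ℝ) ^ 2)⁻¹ else 0

lemma hasSum_inv_sq : HasSum (fun x : ℤ => ((x : ℝ) ^ 2)⁻¹) (Real.pi ^ 2 / 3) := by
  have h1 : HasSum (fun k : ℕ => ((k : ℝ) ^ 2)⁻¹) (Real.pi ^ 2 / 6) := by
    simpa using hasSum_zeta_two
  have h2 : HasSum (fun k : ℕ => (((k + 1 : ℕ) : ℝ) ^ 2)⁻¹) (Real.pi ^ 2 / 6) := by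
    rw [hasSum_nat_add_iff (f := fun k : ℕ => ((k : ℝ) ^ 2)⁻¹) 1]
    simpa using h1
  have h3 := HasSum.of_nat_of_neg_add_one (f := fun x : ℤ => ((x : ℝ) ^ 2)⁻¹)
    (by exact_mod_cast h1) (m' := Real.pi ^ 2 / 6) (by
      convert h2 using 2 with k
      push_cast
      ring)
  convert h3 using 1
  ring

lemma hasSum_invSqOn {d : ℤ} (hd : d ≠ 0) :
    HasSum (invSqOn d) (Real.pi ^ 2 / 3 / d ^ 2) := by
  have hinj : Function.Injective fun x : ℤ => d * x := mul_right_injective₀ hd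
  rw [← hinj.hasSum_iff]
  · have h1 : invSqOn d ∘ (fun x : ℤ => d * x) = fun x : ℤ => ((d : ℝ) ^ 2)⁻¹ * ((x : ℝ) ^ 2)⁻¹ := by
      ext x
      simp [invSqOn, mul_pow, mul_comm]
    rw [h1, div_eq_mul_inv, mul_comm (Real.pi ^ 2 / 3)]
    exact hasSum_inv_sq.mul_left _
  · intro x hx
    rw [invSqOn, if_neg]
    rintro ⟨y, rfl⟩
    exact hx ⟨y, rfl⟩

lemma tsum_sum_residues {P : ℕ} [NeZero P] {f : ℤ → ℝ} (hf : Summable f) :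
    ∑' t : ℤ, ∑ r : Fin P, f (t * P + (r : ℕ)) = ∑' x, f x := by
  have h1 : Summable fun c : ℤ × Fin P => f (c.1 * P + (c.2 : ℕ)) :=
    (Int.divModEquiv P).symm.summable_iff.mpr hf
  have h2 := (Int.divModEquiv P).symm.tsum_eq f
  simp only [Int.divModEquiv_symm_apply] at h2
  rw [← h2, h1.tsum_prod]
  exact tsum_congr fun t => (tsum_fintype _).symm

section

variable {n : ℕ} {AB : ℤ × ℤ}

lemma IsExceptional.tsum_blockSum_zero_row (hn : IsExceptional n) (h : AB ∈ forms n) {P : ℕ}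
    [NeZero P] {W : ℤ × ℤ → ℝ} (hM : ∀ z, |W z| ≤ 4) :
    ∑' t : ℤ, blockSum n AB (rowEquiv P) W 1 (t, 0) =
      (AB.1 : ℝ)⁻¹ * ∑' x : ℤ, W (x, 0) * ((x : ℝ) ^ 2)⁻¹ := by
  have hA : (0 : ℝ) < AB.1 := by exact_mod_cast (forms_pos (A := AB.1) (B := AB.2) h).1
  have h1 (x : ℤ) : (formValue n AB x 0 : ℝ) = AB.1 * (x : ℝ) ^ 2 := by
    apply mul_left_cancel₀ hA.ne'
    have := congrArg (Int.cast : ℤ → ℝ) (hn.mul_formValue h x 0)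
    push_cast at this
    rw [this]
    ring
  have hs : Summable fun x : ℤ => W (x, 0) * ((x : ℝ) ^ 2)⁻¹ := by
    refine Summable.of_norm_bounded (hasSum_inv_sq.summable.mul_left 4) fun x => ?_
    rw [norm_mul, Real.norm_of_nonneg (r := ((x : ℝ) ^ 2)⁻¹) (by positivity)]
    exact mul_le_mul_of_nonneg_right (hM _) (by positivity)
  rw [← tsum_mul_left, ← tsum_sum_residues (P := P) (hs.mul_left _)]
  refine tsum_congr fun t => Finset.sum_congr rfl fun r _ => ?_
  simp only [rowEquiv, Equiv.coe_fn_mk]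
  rw [h1, Real.rpow_neg_one, mul_inv]
  push_cast
  ring

variable {p : ℕ} {χ : MulChar (ZMod (4 * p)) ℤ}

lemma IsTwist.apply_sq (hχ : IsTwist n (4 * p) χ) (hp : p = 3 ∨ p = 7) (x : ℤ) :
    χ ((x : ZMod (4 * p)) ^ 2) = if 2 ∣ x ∨ (p : ℤ) ∣ x then 0 else 1 := by
  have hu : IsUnit (x : ZMod (4 * p)) ↔ ¬(2 ∣ x ∨ (p : ℤ) ∣ x) := by
    rw [ZMod.coe_int_isUnit_iff_isCoprime]
    push_cast
    have h2 : IsCoprime (2 : ℤ) x ↔ ¬ 2 ∣ x := Int.prime_two.irreducible.coprime_iff_not_dvd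
    have h3 : IsCoprime (p : ℤ) x ↔ ¬ (p : ℤ) ∣ x := by
      refine (Nat.prime_iff_prime_int.mp ?_).irreducible.coprime_iff_not_dvd
      rcases hp with rfl | rfl <;> norm_num
    rw [show (4 : ℤ) = 2 * 2 by norm_num, IsCoprime.mul_left_iff, IsCoprime.mul_left_iff, h2, h3]
    tauto
  rw [map_pow]
  split_ifs with h
  · rw [χ.map_nonunit (by tauto)]
    norm_num
  · have h0 : χ x ≠ 0 := ((hu.mpr h).map χ).ne_zero
    rcases hχ.quadratic x with h1 | h1 | h1
    · exact absurd h1 h0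
    all_goals rw [h1]; norm_num

lemma IsTwist.rowWeight_zero (hχ : IsTwist n (4 * p) χ) (hp : p = 3 ∨ p = 7) (x : ℤ) :
    rowWeight χ n (1, 0) (x, 0) * ((x : ℝ) ^ 2)⁻¹ =
      invSqOn 1 x - invSqOn 2 x - invSqOn p x + invSqOn (2 * p) x - 5 * invSqOn 5 x +
        5 * invSqOn 10 x + 5 * invSqOn (5 * p) x - 5 * invSqOn (10 * p) x := by
  have h1 : formValue n (1, 0) x 0 = x ^ 2 := by simp [formValue]
  rw [rowWeight, h1]
  push_cast
  rw [hχ.apply_sq hp]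
  have h5 : (x : ZMod 5) = 0 ↔ 5 ∣ x := by
    have := ZMod.intCast_zmod_eq_zero_iff_dvd x 5
    exact_mod_cast this
  have e1 : (2 * p : ℤ) ∣ x ↔ 2 ∣ x ∧ (p : ℤ) ∣ x := by rcases hp with rfl | rfl <;> omega
  have e2 : 10 ∣ x ↔ 2 ∣ x ∧ 5 ∣ x := by omega
  have e3 : (5 * p : ℤ) ∣ x ↔ 5 ∣ x ∧ (p : ℤ) ∣ x := by rcases hp with rfl | rfl <;> omega
  have e4 : (10 * p : ℤ) ∣ x ↔ 2 ∣ x ∧ 5 ∣ x ∧ (p : ℤ) ∣ x := by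
    rcases hp with rfl | rfl <;> omega
  simp only [sub_zero, h5, invSqOn, e1, e2, e3, e4, one_dvd, if_true]
  by_cases a1 : 2 ∣ x <;> by_cases a2 : 5 ∣ x <;> by_cases a3 : (p : ℤ) ∣ x <;>
    simp only [a1, a2, a3, and_true, and_false, true_or, or_true, or_self,
      if_true, if_false] <;> push_cast <;> ring

lemma IsTwist.tsum_rowWeight_zero (hχ : IsTwist n (4 * p) χ) (hp : p = 3 ∨ p = 7) :
    ∑' x : ℤ, rowWeight χ n (1, 0) (x, 0) * ((x : ℝ) ^ 2)⁻¹ =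
      Real.pi ^ 2 / 5 * (1 - 1 / (p : ℝ) ^ 2) := by
  have hp0 : (p : ℤ) ≠ 0 := by rcases hp with rfl | rfl <;> norm_num
  have hp0' : (p : ℝ) ≠ 0 := by exact_mod_cast hp0
  simp only [hχ.rowWeight_zero hp]
  have h := ((((((((hasSum_invSqOn one_ne_zero).sub (hasSum_invSqOn two_ne_zero)).sub
    (hasSum_invSqOn hp0)).add (hasSum_invSqOn (mul_ne_zero two_ne_zero hp0))).sub
    ((hasSum_invSqOn (show (5 : ℤ) ≠ 0 by norm_num)).mul_left 5)).add
    ((hasSum_invSqOn (show (10 : ℤ) ≠ 0 by norm_num)).mul_left 5)).add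
    ((hasSum_invSqOn (mul_ne_zero (show (5 : ℤ) ≠ 0 by norm_num) hp0)).mul_left 5)).sub
    ((hasSum_invSqOn (mul_ne_zero (show (10 : ℤ) ≠ 0 by norm_num) hp0)).mul_left 5))
  rw [h.tsum_eq]
  push_cast
  field_simp
  ring

lemma rowWeight_even
    (h : AB ∈ baseForms n) (h1 : AB ≠ (1, 0)) (x : ℤ) : rowWeight χ n AB (x, 0) = 0 := by
  have hA : (2 : ℤ) ∣ AB.1 := by
    unfold baseForms at h
    split_ifs at h <;> simp only [Finset.mem_insert, Finset.mem_singleton] at h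
    · rcases h with h | rfl | rfl
      · exact absurd h h1
      all_goals norm_num
    · rcases h with h | rfl
      · exact absurd h h1
      · norm_num
  have h2 : (χ (formValue n AB x 0 : ZMod (4 * p)) : ℤ) = 0 := by
    apply χ.map_nonunit
    rw [ZMod.coe_int_isUnit_iff_isCoprime]
    intro hc
    have h3 : (2 : ℤ) ∣ formValue n AB x 0 := by
      simpa [formValue] using hA.mul_right (x ^ 2)
    have h4 : (2 : ℤ) ∣ ((4 * p : ℕ) : ℤ) := by
      push_cast
      exact ⟨2 * p, by ring⟩
    exact absurd (hc.isUnit_of_dvd' h4 h3) (by decide)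
  simp [rowWeight, h2]

lemma rowWeight_rowEquiv_add {N : ℕ} [NeZero N] {χ : MulChar (ZMod N) ℤ} (t y : ℤ)
    (r : Fin (5 * N)) :
    rowWeight χ n AB (rowEquiv (5 * N) ((t, y), r)) =
      rowWeight χ n AB (rowEquiv (5 * N) ((0, y), r)) := by
  have h5 : (5 : ZMod 5) = 0 := rfl
  simp only [rowWeight, rowEquiv, Equiv.coe_fn_mk, formValue_cast]
  push_cast
  simp [h5]

/-- The value at `1` of the product of the two L-series is close to a rational multiple of
`π ^ 2`. -/
lemma IsTwist.abs_sum_sub_le (hn : IsExceptional n) (hχ : IsTwist n (4 * p) χ)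
    (hp : p = 3 ∨ p = 7) [NeZero (4 * p)] :
    |∑ AB ∈ baseForms n, ∑' w, blockSum n AB (rowEquiv (5 * (4 * p))) (rowWeight χ n AB) 1 w -
      Real.pi ^ 2 / 5 * (1 - 1 / (p : ℝ) ^ 2)| ≤ 6 / 5 * Real.exp (-√n / 90) := by
  set T : ℤ × ℤ → ℝ := fun AB =>
    ∑' w, blockSum n AB (rowEquiv (5 * (4 * p))) (rowWeight χ n AB) 1 w with hT
  have hn1 : (1000 : ℝ) ≤ √n := by
    apply Real.le_sqrt_of_sq_le
    have : ((10 ^ 6 : ℕ) : ℝ) ≤ n := by exact_mod_cast hn.large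
    norm_num at this ⊢
    exact this
  have hE : Real.exp (-√n / 90) ≤ 1 / 2 :=
    calc Real.exp (-√n / 90) ≤ Real.exp (-1) := Real.exp_le_exp.mpr (by linarith)
        _ ≤ _ := by linarith [Real.exp_neg_one_lt_d9]
  have h1 (AB : ℤ × ℤ) (h : AB ∈ baseForms n) :
      |T AB - if AB = (1, 0) then Real.pi ^ 2 / 5 * (1 - 1 / (p : ℝ) ^ 2) else 0| ≤
        2 / 5 * Real.exp (-√n / 90) := by
    have hf := (mem_forms_of_mem_baseForms h).1
    have hA4 : AB.1 ≤ 4 := by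
      unfold baseForms at h
      split_ifs at h <;> simp only [Finset.mem_insert, Finset.mem_singleton] at h
      · rcases h with rfl | rfl | rfl <;> norm_num
      · rcases h with rfl | rfl <;> norm_num
    have hs := (hn.tendsto_tsum_row hf (hχ.abs_rowWeight_le AB) (hχ.sum_rowWeight AB)).1
    have h2 := abs_tsum_sub_le hs (Real.exp_pos _).le hE fun y hy =>
      hn.abs_tsum_blockSum_row_le hf hA4 (by omega) (hχ.abs_rowWeight_le AB)
        rowWeight_rowEquiv_add (hχ.sum_rowWeight AB) hy
    rw [hn.tsum_blockSum_zero_row hf (hχ.abs_rowWeight_le AB)] at h2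
    split_ifs with h3
    · subst h3
      rw [hχ.tsum_rowWeight_zero hp] at h2
      refine le_of_eq_of_le ?_ (h2.trans_eq (by ring))
      simp [hT]
    · simp only [rowWeight_even h h3, zero_mul, tsum_zero, mul_zero] at h2
      exact h2.trans_eq (by ring)
  have h4 : ∑ AB ∈ baseForms n,
      (if AB = (1, 0) then Real.pi ^ 2 / 5 * (1 - 1 / (p : ℝ) ^ 2) else 0) =
        Real.pi ^ 2 / 5 * (1 - 1 / (p : ℝ) ^ 2) := by
    rw [Finset.sum_ite_eq', if_pos]
    unfold baseForms
    split_ifs <;> simp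
  have h5 : (baseForms n).card ≤ 3 := by
    unfold baseForms
    split_ifs <;> simp
  rw [← h4, ← Finset.sum_sub_distrib]
  refine (Finset.abs_sum_le_sum_abs _ _).trans ((Finset.sum_le_sum h1).trans ?_)
  rw [Finset.sum_const, nsmul_eq_mul]
  have h6 : ((baseForms n).card : ℝ) ≤ 3 := by exact_mod_cast h5
  nlinarith [Real.exp_pos (-√n / 90)]

end

end NonunitSquares

namespace NonunitSquares

open scoped NumberTheorySymbols

section

variable {D : ℤ} {k : ℕ}

lemma jacobiSym_mod_eq (hk : D.natAbs = k) {m : ℕ} (hm : Odd m) : J(D | m % (4 * k)) = J(D | m) := by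
  rw [← hk, ← jacobiSym.mod_right D hm]

lemma odd_mod_four_mul {m : ℕ} : Odd (m % (4 * k)) ↔ Odd m := by
  rw [Nat.odd_iff, Nat.odd_iff, Nat.mod_mod_of_dvd m ⟨2 * k, by ring⟩]

variable [NeZero k]

/-- The Dirichlet character modulo `4 * |D|` given on odd numbers by the Jacobi symbol of `D`. -/
def jacobiChar (D : ℤ) (k : ℕ) [NeZero k] (hk : D.natAbs = k) :
    MulChar (ZMod (4 * k)) ℤ where
  toFun a := if Odd a.val then J(D | a.val) else 0
  map_one' := by
    have : Fact (1 < 4 * k) := ⟨by have := NeZero.pos k; omega⟩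
    simp [ZMod.val_one]
  map_mul' a b := by
    simp only [ZMod.val_mul, odd_mod_four_mul, Nat.odd_mul]
    by_cases ha : Odd a.val
    · by_cases hb : Odd b.val
      · simp only [ha, hb, and_self, if_true]
        rw [jacobiSym_mod_eq hk (ha.mul hb), jacobiSym.mul_right' _ ha.pos.ne' hb.pos.ne']
      · simp [hb]
    · simp [ha]
  map_nonunit' a ha := by
    split_ifs with h
    · have : NeZero a.val := ⟨h.pos.ne'⟩
      rw [jacobiSym.eq_zero_iff_not_coprime]
      intro h1
      apply ha
      rw [← ZMod.natCast_zmod_val a, ZMod.isUnit_iff_coprime]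
      have h2 : Nat.Coprime D.natAbs a.val := h1
      rw [hk] at h2
      exact Nat.Coprime.mul_right ((Nat.coprime_two_right.mpr h).pow_right 2) h2.symm
    · rfl

lemma jacobiChar_natCast (hk : D.natAbs = k) (m : ℕ) :
    jacobiChar D k hk (m : ZMod (4 * k)) = if Odd m then J(D | m) else 0 := by
  change (if Odd (m : ZMod (4 * k)).val then J(D | (m : ZMod (4 * k)).val) else 0) = _
  rw [ZMod.val_natCast]
  simp only [odd_mod_four_mul]
  split_ifs with h
  · exact jacobiSym_mod_eq hk h
  · rfl

lemma jacobiChar_isQuadratic (hk : D.natAbs = k) : (jacobiChar D k hk).IsQuadratic := by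
  intro a
  rw [← ZMod.natCast_zmod_val a, jacobiChar_natCast]
  split_ifs
  · exact jacobiSym.trichotomy _ _
  · exact Or.inl rfl

end

lemma IsExceptional.exists_sq_add_eq {n : ℕ} (hn : IsExceptional n) {p : ℕ}
    (hp : p = 3 ∨ p = 7) : ∃ u v m : ℕ, Odd m ∧ u ^ 2 + n * v ^ 2 ≡ m [MOD (4 * p)] ∧
      J(p | m) = -1 := by
  have hl := hn.large
  have h8 := hn.mod_eight
  have key (t : ℤ) : ¬(p : ℤ) ∣ t ^ 2 + n := fun h => by
    have := hn.le_prime p (by rcases hp with rfl | rfl <;> norm_num)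
      (by omega) (by omega) t h
    omega
  rcases hp with rfl | rfl
  · have k0 := key 0
    have k1 := key 1
    norm_num at k0 k1
    have h3 : n % 3 = 1 := by omega
    have h : n % 12 = 7 ∨ n % 12 = 10 := by omega
    rcases h with h | h
    · exact ⟨0, 1, 7, by decide, by simp [Nat.ModEq, h], by norm_num⟩
    · exact ⟨3, 1, 7, by decide, by simp [Nat.ModEq, Nat.add_mod, h], by norm_num⟩
  · have k0 := key 0
    have k1 := key 1
    have k2 := key 2
    have k3 := key 3
    norm_num at k0 k1 k2 k3
    have h7 : n % 7 = 1 ∨ n % 7 = 2 ∨ n % 7 = 4 := by omega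
    have h4 : n % 4 = 3 ∨ n % 4 = 2 := by omega
    have h : n % 28 = 11 ∨ n % 28 = 15 ∨ n % 28 = 23 ∨ n % 28 = 2 ∨ n % 28 = 18 ∨ n % 28 = 22 := by
      omega
    rcases h with h | h | h | h | h | h
    · exact ⟨0, 1, 11, by decide, by simp [Nat.ModEq, h], by norm_num⟩
    · exact ⟨0, 1, 15, by decide, by simp [Nat.ModEq, h], by norm_num⟩
    · exact ⟨0, 1, 23, by decide, by simp [Nat.ModEq, h], by norm_num⟩
    · exact ⟨1, 4, 5, by decide,
        by simp [Nat.ModEq, Nat.add_mod, Nat.mul_mod, h], by norm_num⟩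
    · exact ⟨1, 2, 17, by decide,
        by simp [Nat.ModEq, Nat.add_mod, Nat.mul_mod, h], by norm_num⟩
    · exact ⟨1, 1, 23, by decide, by simp [Nat.ModEq, Nat.add_mod, h], by norm_num⟩

section

variable {n p : ℕ} [NeZero p]

lemma IsExceptional.isTwist (hn : IsExceptional n) (hp : p = 3 ∨ p = 7) :
    IsTwist n (4 * p) (jacobiChar p p (Int.natAbs_natCast p)) where
  quadratic := jacobiChar_isQuadratic _
  two_dvd := ⟨2 * p, by ring⟩
  five := by
    rw [show (5 : ZMod (4 * p)) = ((5 : ℕ) : ZMod (4 * p)) by norm_num, jacobiChar_natCast,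
      if_pos (by decide)]
    rcases hp with rfl | rfl <;> norm_num
  norm_neg := by
    obtain ⟨u, v, m, hm, h1, h2⟩ := hn.exists_sq_add_eq hp
    refine ⟨u, v, ?_⟩
    have h3 := (ZMod.natCast_eq_natCast_iff _ _ _).mpr h1
    push_cast at h3
    rw [h3, jacobiChar_natCast, if_pos hm, h2]

open Filter Topology Complex

/-- A real character viewed as a complex Dirichlet character. -/
noncomputable abbrev complexChar {N : ℕ} (χ : MulChar (ZMod N) ℤ) : DirichletCharacter ℂ N :=
  χ.ringHomComp (Int.castRingHom ℂ)

lemma complexChar_ne_one {N : ℕ} {χ : MulChar (ZMod N) ℤ} {a : ZMod N} (ha : χ a = -1) :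
    complexChar χ ≠ 1 := by
  intro h
  have h1 : complexChar χ a = ((χ a : ℤ) : ℂ) := rfl
  have h2 : IsUnit a := by
    by_contra h0
    rw [χ.map_nonunit h0] at ha
    omega
  rw [h, ha, MulChar.one_apply h2] at h1
  norm_num at h1

/-- The character of the field generated by the square root of `-p * n`. -/
def psi (p n : ℕ) [NeZero p] [NeZero n] : MulChar (ZMod (4 * (p * n))) ℤ :=
  jacobiChar (-(p * n : ℤ)) (p * n) (by rw [Int.natAbs_neg]; exact_mod_cast Int.natAbs_natCast _)

lemma psi_natCast [NeZero n] (m : ℕ) :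
    psi p n (m : ZMod (4 * (p * n))) =
      jacobiChar p p (Int.natAbs_natCast p) (m : ZMod (4 * p)) * J(-n | m) := by
  rw [psi, jacobiChar_natCast, jacobiChar_natCast, neg_mul_eq_mul_neg, jacobiSym.mul_left]
  split_ifs <;> simp

lemma IsExceptional.norm_LFunction_mul_sub_le [NeZero n] (hn : IsExceptional n)
    (hp : p = 3 ∨ p = 7) (hψ : complexChar (psi p n) ≠ 1) :
    ‖(complexChar (jacobiChar p p (Int.natAbs_natCast p))).LFunction 1 *
      (complexChar (psi p n)).LFunction 1 -
      (Real.pi ^ 2 / 10 * (1 - 1 / (p : ℝ) ^ 2) : ℝ)‖ ≤ 3 / 5 * Real.exp (-√n / 90) := by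
  have hχ := hn.isTwist hp
  set χ := jacobiChar p p (Int.natAbs_natCast p) with hχ_def
  have h1 : Continuous fun s : ℝ =>
      (complexChar χ).LFunction s * (complexChar (psi p n)).LFunction s :=
    ((DirichletCharacter.differentiable_LFunction (complexChar_ne_one hχ.five)).continuous.comp
      continuous_ofReal).mul
    ((DirichletCharacter.differentiable_LFunction hψ).continuous.comp continuous_ofReal)
  have h2 := (h1.tendsto 1).mono_left (nhdsWithin_le_nhds (s := Set.Ioi 1))
  have h3 := (continuous_ofReal.tendsto _).comp ((hχ.tendsto_sum_forms hn).div_const 2)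
  have h4 := tendsto_nhds_unique_of_eventuallyEq h2 h3 (by
    filter_upwards [self_mem_nhdsWithin] with s hs
    have hs' : 1 < (s : ℂ).re := by simpa using hs
    rw [DirichletCharacter.LFunction_eq_LSeries _ hs', DirichletCharacter.LFunction_eq_LSeries _ hs']
    have h5 := hχ.LSeries_mul_LSeries hn hs
    simp only [← psi_natCast, hχ_def] at h5
    exact h5)
  rw [ofReal_one] at h4
  rw [h4, ← ofReal_sub, norm_real, Real.norm_eq_abs]
  have h6 := hχ.abs_sum_sub_le hn hp
  rw [show ∀ T : ℝ, T / 2 - Real.pi ^ 2 / 10 * (1 - 1 / (p : ℝ) ^ 2) =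
    (T - Real.pi ^ 2 / 5 * (1 - 1 / (p : ℝ) ^ 2)) / 2 by intro T; ring, abs_div, abs_two]
  linarith

end

end NonunitSquares

namespace NonunitSquares

open Filter Topology Complex

lemma summable_periodSum_bound (N : ℕ) :
    Summable fun t : ℕ => 2 * (N : ℝ) ^ 2 * (1 / ((t + 1 : ℕ) : ℝ) ^ 2) :=
  ((summable_nat_add_iff 1).mpr (Real.summable_one_div_nat_pow.mpr one_lt_two)).mul_left _

section

variable {N : ℕ} [NeZero N] (χ : MulChar (ZMod N) ℤ)

/-- A period of the Dirichlet series of `χ`. -/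
noncomputable def periodSum (s : ℝ) (t : ℕ) : ℝ :=
  ∑ a : Fin N, (χ ((a : ℕ) + 1 : ℕ) : ℝ) * ((a + N * t + 1 : ℕ) : ℝ) ^ (-s)

lemma LFunction_eq_tsum_periodSum {s : ℝ} (hs : 1 < s) :
    (complexChar χ).LFunction s = ((∑' t, periodSum χ s t : ℝ) : ℂ) := by
  have hsum : LSeriesSummable (fun n => complexChar χ n) s :=
    DirichletCharacter.LSeriesSummable_of_one_lt_re _ (by simpa using hs)
  have hterm (m : ℕ) : LSeries.term (fun n => complexChar χ n) s (m + 1) =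
      (((χ ((m + 1 : ℕ) : ZMod N) : ℝ) * ((m + 1 : ℕ) : ℝ) ^ (-s) : ℝ) : ℂ) := by
    rw [LSeries.term_of_ne_zero (by omega), ofReal_mul, Complex.ofReal_cpow (by positivity),
      ofReal_neg, Complex.cpow_neg, div_eq_mul_inv, ofReal_natCast]
    rfl
  have h1 : Summable (fun m : ℕ => (χ ((m + 1 : ℕ) : ZMod N) : ℝ) * ((m + 1 : ℕ) : ℝ) ^ (-s)) := by
    rw [← Complex.summable_ofReal]
    simpa only [← hterm] using (summable_nat_add_iff 1).mpr hsum
  rw [DirichletCharacter.LFunction_eq_LSeries _ (by simpa using hs), LSeries,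
    hsum.tsum_eq_zero_add, LSeries.term_zero, zero_add]
  simp only [hterm]
  rw [← Complex.ofReal_tsum, ← (Nat.divModEquiv N).symm.tsum_eq]
  have h2 := ((Nat.divModEquiv N).symm.summable_iff.mpr h1).tsum_prod
  simp only [Function.comp_apply] at h2
  rw [h2]
  congr 2
  ext t
  rw [tsum_fintype, periodSum]
  refine Finset.sum_congr rfl fun a _ => ?_
  rw [Nat.divModEquiv_symm_apply]
  congr 3
  · push_cast
    simp
  · push_cast
    ring

variable {χ}

lemma sum_fin_char_eq_zero (hχ : complexChar χ ≠ 1) :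
    ∑ a : Fin N, (χ ((a : ℕ) + 1 : ℕ) : ℝ) = 0 := by
  have h0 := MulChar.sum_eq_zero_of_ne_one hχ
  have h1 : ∑ a : ZMod N, χ a = 0 := by
    have : ((∑ a : ZMod N, χ a : ℤ) : ℂ) = 0 := by rw [← h0]; push_cast; rfl
    exact_mod_cast this
  rw [← Int.cast_sum, ← Int.cast_zero, ← h1]
  congr 1
  rw [← Equiv.sum_comp (Equiv.addRight (1 : ZMod N))]
  refine Fintype.sum_equiv ((ZMod.finEquiv N).toEquiv) _ _ fun a => ?_
  simp only [Equiv.coe_addRight, Nat.cast_add, Nat.cast_one]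
  congr 2
  obtain ⟨k, rfl⟩ := Nat.exists_eq_succ_of_ne_zero (NeZero.ne N)
  exact (Fin.cast_val_eq_self a)

lemma abs_periodSum_le (hq : χ.IsQuadratic) (hχ : complexChar χ ≠ 1) {s : ℝ}
    (hs : s ∈ Set.Icc (1 : ℝ) 2) (t : ℕ) :
    |periodSum χ s t| ≤ 2 * N ^ 2 * (1 / ((t + 1 : ℕ) : ℝ) ^ 2) := by
  have hN : (1 : ℝ) ≤ N := by exact_mod_cast NeZero.pos N
  have h1 : periodSum χ s t = ∑ a : Fin N, (χ ((a : ℕ) + 1 : ℕ) : ℝ) *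
      (((a + N * t + 1 : ℕ) : ℝ) ^ (-s) - ((N * t + 1 : ℕ) : ℝ) ^ (-s)) := by
    simp only [mul_sub, Finset.sum_sub_distrib, ← Finset.sum_mul, sum_fin_char_eq_zero hχ]
    rw [zero_mul, sub_zero, periodSum]
  have hbound (a : Fin N) : |(χ ((a : ℕ) + 1 : ℕ) : ℝ) *
      (((a + N * t + 1 : ℕ) : ℝ) ^ (-s) - ((N * t + 1 : ℕ) : ℝ) ^ (-s))| ≤
      2 / ((t + 1 : ℕ) : ℝ) ^ 2 * N := by
    have hle : |(χ ((a : ℕ) + 1 : ℕ) : ℝ)| ≤ 1 := by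
      rcases hq ((a : ℕ) + 1 : ℕ) with h | h | h <;> rw [h] <;> norm_num
    have ht : ((t + 1 : ℕ) : ℝ) ≤ ((N * t + 1 : ℕ) : ℝ) := by
      push_cast
      nlinarith [(Nat.cast_nonneg t : (0 : ℝ) ≤ t)]
    have hd : |((a + N * t + 1 : ℕ) : ℝ) - ((N * t + 1 : ℕ) : ℝ)| ≤ N := by
      have : ((a : ℕ) : ℝ) ≤ N := by exact_mod_cast a.is_lt.le
      push_cast
      rw [show ((a : ℕ) : ℝ) + N * t + 1 - (N * t + 1) = (a : ℕ) by ring,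
        abs_of_nonneg (Nat.cast_nonneg _)]
      exact this
    rw [abs_mul]
    calc _ ≤ 1 * (2 / ((t + 1 : ℕ) : ℝ) ^ 2 * |((a + N * t + 1 : ℕ) : ℝ) - ((N * t + 1 : ℕ) : ℝ)|) := by
          refine mul_le_mul hle (abs_rpow_neg_sub_le (by push_cast; linarith [(Nat.cast_nonneg t : (0 : ℝ) ≤ t)])
            (ht.trans ?_) ht hs) (abs_nonneg _) zero_le_one
          push_cast
          linarith [(Nat.cast_nonneg (a : ℕ) : (0 : ℝ) ≤ (a : ℕ))]
      _ ≤ _ := by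
          rw [one_mul]
          exact mul_le_mul_of_nonneg_left hd (by positivity)
  rw [h1]
  calc _ ≤ ∑ a : Fin N, 2 / ((t + 1 : ℕ) : ℝ) ^ 2 * N :=
        (Finset.abs_sum_le_sum_abs _ _).trans (Finset.sum_le_sum fun a _ => hbound a)
    _ = _ := by
        rw [Finset.sum_const, Finset.card_univ, Fintype.card_fin, nsmul_eq_mul]
        ring

lemma summable_periodSum (hq : χ.IsQuadratic) (hχ : complexChar χ ≠ 1) :
    Summable (periodSum χ 1) :=
  Summable.of_norm_bounded (summable_periodSum_bound N)
    fun t => abs_periodSum_le hq hχ (by norm_num) t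

theorem LFunction_one_eq_tsum_periodSum (hq : χ.IsQuadratic) (hχ : complexChar χ ≠ 1) :
    (complexChar χ).LFunction 1 = ((∑' t, periodSum χ 1 t : ℝ) : ℂ) := by
  have h1 : Tendsto (fun s : ℝ => ∑' t, periodSum χ s t) (𝓝[>] 1)
      (𝓝 (∑' t, periodSum χ 1 t)) := by
    refine tendsto_tsum_of_dominated_convergence (summable_periodSum_bound N) (fun t => ?_) ?_
    · have : ContinuousAt (fun s => periodSum χ s t) 1 := by
        unfold periodSum
        refine tendsto_finsetSum _ fun i _ => Tendsto.const_mul _ ?_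
        exact (Real.continuousAt_const_rpow' (by norm_num)).comp continuous_neg.continuousAt
      exact this.tendsto.mono_left nhdsWithin_le_nhds
    · filter_upwards [eventually_mem_Icc] with s hs t
      exact abs_periodSum_le hq hχ hs t
  have h2 : Tendsto (fun s : ℝ => (complexChar χ).LFunction s) (𝓝[>] 1)
      (𝓝 ((complexChar χ).LFunction (1 : ℝ))) :=
    (((DirichletCharacter.differentiable_LFunction hχ).continuous.comp
      continuous_ofReal).tendsto 1).mono_left nhdsWithin_le_nhds
  rw [ofReal_one] at h2
  refine tendsto_nhds_unique h2 (((continuous_ofReal.tendsto _).comp h1).congr' ?_)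
  filter_upwards [self_mem_nhdsWithin] with s hs
  exact (LFunction_eq_tsum_periodSum χ hs).symm

end

end NonunitSquares

namespace NonunitSquares

open Filter Topology Complex

lemma hasSum_inv_add_sub {x : ℝ} (hx : x ∈ Set.Ioo (0 : ℝ) 1) :
    HasSum (fun t : ℕ => (1 / (x + t) - 1 / (t + 1 - x) : ℂ)) (Real.pi * cot (Real.pi * x)) := by
  have hmem : (x : ℂ) ∈ integerComplement := by
    rw [mem_integerComplement_iff]
    rintro ⟨k, hk⟩
    have hk' : (k : ℝ) = x := by exact_mod_cast hk
    rw [← hk'] at hx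
    have h0 : 0 < k := by exact_mod_cast hx.1
    have h1 : k < 1 := by exact_mod_cast hx.2
    omega
  have htel : HasSum (fun t : ℕ => 1 / (x + t) - 1 / (x + (t + 1))) (1 / x) := by
    have hpos (t : ℕ) : 0 < x + t := by linarith [hx.1, (Nat.cast_nonneg t : (0 : ℝ) ≤ t)]
    rw [hasSum_iff_tendsto_nat_of_nonneg fun t => ?_]
    · have h1 (n : ℕ) : ∑ t ∈ Finset.range n, (1 / (x + t) - 1 / (x + (t + 1))) =
          1 / x - 1 / (x + n) := by
        have := Finset.sum_range_sub' (fun t : ℕ => 1 / (x + t)) n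
        simpa using this
      simp only [h1]
      have h2 : Tendsto (fun n : ℕ => 1 / (x + n)) atTop (𝓝 0) := by
        simp only [one_div]
        exact tendsto_inv_atTop_zero.comp (tendsto_atTop_add_const_left _ _ tendsto_natCast_atTop_atTop)
      simpa using tendsto_const_nhds.sub h2
    · exact sub_nonneg.mpr (one_div_le_one_div_of_le (hpos t) (by linarith))
  have hcot := (summable_cotTerm hmem).hasSum
  rw [show (fun n => cotTerm (x : ℂ) n) = cotTerm (x : ℂ) from rfl] at hcot
  have hrep : ∑' n, cotTerm (x : ℂ) n = Real.pi * cot (Real.pi * x) - 1 / x :=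
    (cot_series_rep' hmem).symm
  rw [hrep] at hcot
  have htel' : HasSum (fun t : ℕ => (1 / (x + t) - 1 / (x + (t + 1)) : ℂ)) (1 / x) := by
    have := Complex.hasSum_ofReal.mpr htel
    push_cast at this
    exact this
  have h := htel'.add hcot
  rw [add_sub_cancel] at h
  refine h.congr_fun fun t => ?_
  rw [cotTerm, show (x : ℂ) - (t + 1) = -(t + 1 - x) by ring, div_neg]
  ring

lemma sum_natCast_mul_pow {N : ℕ} {w : ℂ} (hw : w ≠ 1) (hN : w ^ N = 1) :
    ∑ k ∈ Finset.range N, (k : ℂ) * w ^ k = N / (w - 1) := by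
  have hg : ∑ k ∈ Finset.range N, w ^ k = 0 := by
    rw [geom_sum_eq hw, hN, sub_self, zero_div]
  have h1 := Finset.sum_range_sub (fun k : ℕ => (k : ℂ) * w ^ k) N
  rw [eq_div_iff (sub_ne_zero.mpr hw)]
  rw [hN] at h1
  have h2 : ∑ k ∈ Finset.range N, (((k + 1 : ℕ) : ℂ) * w ^ (k + 1) - k * w ^ k) =
      (∑ k ∈ Finset.range N, (k : ℂ) * w ^ k) * (w - 1) + w * ∑ k ∈ Finset.range N, w ^ k := by
    rw [Finset.sum_mul, Finset.mul_sum, ← Finset.sum_add_distrib]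
    refine Finset.sum_congr rfl fun k _ => ?_
    push_cast
    ring
  rw [hg, mul_zero, add_zero] at h2
  rw [← h2, h1]
  simp

lemma sum_zmod_val {E : Type*} [AddCommMonoid E] (N : ℕ) [NeZero N] (f : ℕ → E) :
    ∑ k : ZMod N, f k.val = ∑ k ∈ Finset.range N, f k := by
  obtain ⟨K, rfl⟩ := Nat.exists_eq_succ_of_ne_zero (NeZero.ne N)
  exact Fin.sum_univ_eq_sum_range f (K + 1)

section

variable {N : ℕ} [NeZero N]

open ZMod in
lemma cot_eq_sum_stdAddChar {j : ZMod N} (hj : j ≠ 0) :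
    cot (Real.pi * ((j.val / N : ℝ) : ℂ)) =
      I * (1 + 2 / N * ∑ k : ZMod N, (k.val : ℂ) * stdAddChar (j * k)) := by
  have hN : (N : ℂ) ≠ 0 := by exact_mod_cast NeZero.ne N
  set w : ℂ := stdAddChar j with hw
  have hw1 : w ≠ 1 := by
    rw [hw, ← (stdAddChar (N := N)).map_zero_eq_one]
    exact fun h => hj (injective_stdAddChar h)
  have hpow (k : ℕ) : w ^ k = stdAddChar (j * (k : ZMod N)) := by
    rw [hw, ← AddChar.map_nsmul_eq_pow, nsmul_eq_mul, mul_comm]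
  have hexp : Complex.exp (2 * I * (Real.pi * ((j.val / N : ℝ) : ℂ))) = w := by
    rw [hw, stdAddChar_apply, toCircle_apply]
    congr 1
    push_cast
    ring
  have hsum : ∑ k : ZMod N, (k.val : ℂ) * stdAddChar (j * k) = N / (w - 1) := by
    rw [← sum_natCast_mul_pow hw1 (by rw [hpow]; simp),
      ← sum_zmod_val N fun k : ℕ => (k : ℂ) * w ^ k]
    simp [hpow]
  rw [Complex.cot_eq_exp_ratio, hexp, hsum]
  have h1 : w - 1 ≠ 0 := sub_ne_zero.mpr hw1
  have h2 : 1 - w ≠ 0 := sub_ne_zero.mpr hw1.symm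
  field_simp
  rw [I_sq]
  ring

end

end NonunitSquares

namespace NonunitSquares

open Filter Topology Complex

lemma char_zero_of_odd {N : ℕ} {χ : MulChar (ZMod N) ℤ} (hodd : χ (-1) = -1) : χ 0 = 0 := by
  refine χ.map_nonunit fun h => ?_
  have h1 : (1 : ZMod N) = 0 := by
    have := isUnit_zero_iff.mp h
    exact this.symm
  have h2 : (-1 : ZMod N) = 1 := by rw [h1, neg_zero]
  rw [h2, map_one] at hodd
  norm_num at hodd

section

variable {N : ℕ} [NeZero N] {χ : MulChar (ZMod N) ℤ}

lemma periodSum_one_eq (h0 : χ 0 = 0) (t : ℕ) :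
    periodSum χ 1 t = ∑ j : ZMod N, (χ j : ℝ) * (1 / (N * t + j.val)) := by
  rw [periodSum, ← Equiv.sum_comp (Equiv.addRight (1 : ZMod N))]
  refine Fintype.sum_equiv ((ZMod.finEquiv N).toEquiv) _ _ fun a => ?_
  have ha : (ZMod.finEquiv N).toEquiv a + 1 = (((a : ℕ) + 1 : ℕ) : ZMod N) := by
    obtain ⟨k, rfl⟩ := Nat.exists_eq_succ_of_ne_zero (NeZero.ne N)
    rw [Nat.cast_add, Nat.cast_one]
    congr 1
    exact (Fin.cast_val_eq_self a).symm
  simp only [Equiv.coe_addRight, ha]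
  rcases (show (a : ℕ) + 1 ≤ N from a.is_lt).lt_or_eq with h | h
  · rw [ZMod.val_natCast_of_lt h, Real.rpow_neg_one]
    push_cast
    ring_nf
  · simp [h, h0]

lemma LFunction_one_eq_sum_cot (hq : χ.IsQuadratic) (hχ : complexChar χ ≠ 1)
    (hodd : χ (-1) = -1) :
    (complexChar χ).LFunction 1 =
      1 / (2 * N) * ∑ j : ZMod N, complexChar χ j * (Real.pi * cot (Real.pi * ((j.val / N : ℝ) : ℂ))) := by
  have h0 := char_zero_of_odd hodd
  have hN : (0 : ℝ) < N := by exact_mod_cast NeZero.pos N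
  have hN' : (N : ℂ) ≠ 0 := by exact_mod_cast hN.ne'
  have hs := Complex.hasSum_ofReal.mpr (summable_periodSum hq hχ).hasSum
  rw [LFunction_one_eq_tsum_periodSum hq hχ]
  refine hs.unique ?_
  have h1 : HasSum (fun t : ℕ => 1 / (2 * N) * ∑ j : ZMod N, complexChar χ j *
      (1 / (((j.val / N : ℝ) : ℂ) + t) - 1 / (t + 1 - ((j.val / N : ℝ) : ℂ))))
      (1 / (2 * N) * ∑ j : ZMod N, complexChar χ j *
        (Real.pi * cot (Real.pi * ((j.val / N : ℝ) : ℂ)))) := by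
    refine (hasSum_sum fun j _ => ?_).mul_left _
    by_cases hj : j = 0
    · have : complexChar χ j = ((χ j : ℤ) : ℂ) := rfl
      rw [this, hj, h0]
      simp
    · refine (hasSum_inv_add_sub ⟨?_, ?_⟩).mul_left _
      · have : 0 < j.val := Nat.pos_of_ne_zero ((ZMod.val_ne_zero j).mpr hj)
        positivity
      · rw [div_lt_one hN]
        exact_mod_cast j.val_lt
  refine h1.congr_fun fun t => ?_
  have hneg : periodSum χ 1 t = -∑ j : ZMod N, (χ j : ℝ) * (1 / (N * t + (-j).val)) := by
    rw [periodSum_one_eq h0, ← Equiv.sum_comp (Equiv.neg (ZMod N)), ← Finset.sum_neg_distrib]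
    refine Finset.sum_congr rfl fun j _ => ?_
    rw [Equiv.neg_apply, ← neg_one_mul j, map_mul, hodd]
    push_cast
    ring
  have hsum : periodSum χ 1 t = 1 / 2 * ∑ j : ZMod N, ((χ j : ℝ) * (1 / (N * t + j.val)) -
      (χ j : ℝ) * (1 / (N * t + (-j).val))) := by
    rw [Finset.sum_sub_distrib, ← periodSum_one_eq h0]
    linarith
  rw [hsum, ofReal_mul, ofReal_sum, Finset.mul_sum, Finset.mul_sum]
  refine Finset.sum_congr rfl fun j _ => ?_
  have hc : complexChar χ j = (((χ j : ℤ) : ℝ) : ℂ) := by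
    rw [ofReal_intCast]
    rfl
  rw [hc]
  by_cases hj : j = 0
  · simp [hj, h0]
  · have hval : (((-j).val : ℕ) : ℝ) = N - j.val := by
      have : NeZero j := ⟨hj⟩
      rw [ZMod.val_neg_of_ne_zero, Nat.cast_sub j.val_lt.le]
    have hjp : (0 : ℝ) < j.val := by
      exact_mod_cast Nat.pos_of_ne_zero ((ZMod.val_ne_zero j).mpr hj)
    have hjN : (j.val : ℝ) < N := by exact_mod_cast j.val_lt
    have ht : (0 : ℝ) ≤ t := Nat.cast_nonneg t
    have e1 : (N : ℝ) * t + j.val ≠ 0 := by positivity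
    have e2 : (N : ℝ) * t + (N - j.val) ≠ 0 := by nlinarith
    have e3 : (j.val / N : ℝ) + t ≠ 0 := by positivity
    have e4 : (t : ℝ) + 1 - (j.val / N : ℝ) ≠ 0 := by
      have : (j.val / N : ℝ) < 1 := (div_lt_one hN).mpr hjN
      linarith
    have key : 1 / 2 * ((χ j : ℝ) * (1 / (N * t + j.val)) - (χ j : ℝ) * (1 / (N * t + (N - j.val)))) =
        1 / (2 * N) * ((χ j : ℝ) * (1 / ((j.val : ℝ) / N + t) - 1 / (t + 1 - (j.val : ℝ) / N))) := by
      have a1 : 1 / ((j.val : ℝ) / N + t) = N * (1 / (N * t + j.val)) := by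
        field_simp
        ring
      have a2 : 1 / (t + 1 - (j.val : ℝ) / N) = N * (1 / (N * t + (N - j.val))) := by
        rw [mul_one_div, div_eq_div_iff e4 e2]
        field_simp
        ring
      rw [a1, a2]
      field_simp
    rw [hval, ← ofReal_mul, key]
    push_cast
    ring

open ZMod DirichletCharacter in
theorem LFunction_one_eq_of_odd (hq : χ.IsQuadratic) (hprim : (complexChar χ).IsPrimitive)
    (hodd : χ (-1) = -1) : ∃ T : ℤ,
    (complexChar χ).LFunction 1 = ((Real.pi * T / (N * √N) : ℝ) : ℂ) := by
  have hN : (0 : ℝ) < N := by exact_mod_cast NeZero.pos N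
  have hN' : (N : ℂ) ≠ 0 := by exact_mod_cast hN.ne'
  have hχ : complexChar χ ≠ 1 := complexChar_ne_one hodd
  have h0 := char_zero_of_odd hodd
  set ψ := complexChar χ with hψ
  set τ := gaussSum ψ stdAddChar with hτ
  have hinv : ψ⁻¹ = ψ := (hq.comp _).inv
  have hshift (k : ZMod N) : ∑ j : ZMod N, ψ j * stdAddChar (j * k) = ψ k * τ := by
    have := gaussSum_mulShift_of_isPrimitive (stdAddChar (N := N)) hprim k
    rw [hinv] at this
    rw [← this, gaussSum]
    refine Finset.sum_congr rfl fun j _ => ?_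
    rw [AddChar.mulShift_apply, mul_comm k]
  have hψneg (k : ZMod N) : ψ (-k) = -ψ k := by
    have h1 : ψ (-1) = -1 := by
      change (((χ (-1) : ℤ)) : ℂ) = -1
      rw [hodd]
      norm_num
    rw [← neg_one_mul, map_mul, h1, neg_one_mul]
  have hft : 𝓕 (ψ : ZMod N → ℂ) = fun k => -τ * ψ k := by
    ext k
    rw [hprim.fourierTransform_eq_inv_mul_gaussSum, hinv, hψneg]
    ring
  have hsq : τ ^ 2 = -N := by
    have h1 := congr_fun (dft_dft (ψ : ZMod N → ℂ)) 1
    rw [hft, dft_const_mul, hft] at h1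
    simp only [hψneg, map_one] at h1
    simp at h1
    linear_combination h1
  have hreal : I * τ = (√N : ℝ) ∨ I * τ = -(√N : ℝ) := by
    rw [← sq_eq_sq_iff_eq_or_eq_neg, mul_pow, I_sq, hsq, ← ofReal_pow, Real.sq_sqrt hN.le]
    push_cast
    ring
  have hL : ψ.LFunction 1 = Real.pi * (I * τ) / N ^ 2 * ((∑ k : ZMod N, k.val * χ k : ℤ) : ℂ) := by
    rw [LFunction_one_eq_sum_cot hq hχ hodd]
    have h1 (j : ZMod N) : ψ j * (Real.pi * cot (Real.pi * ((j.val / N : ℝ) : ℂ))) =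
        Real.pi * I * ψ j + 2 * Real.pi * I / N * ∑ k : ZMod N, k.val * (ψ j * stdAddChar (j * k)) := by
      by_cases hj : j = 0
      · have : ψ j = 0 := by
          change (((χ j : ℤ)) : ℂ) = 0
          rw [hj, h0, Int.cast_zero]
        simp [this]
      · rw [cot_eq_sum_stdAddChar hj]
        simp only [mul_left_comm _ (ψ j), ← Finset.mul_sum]
        field_simp
    rw [Finset.sum_congr rfl fun j _ => h1 j, Finset.sum_add_distrib, ← Finset.mul_sum,
      MulChar.sum_eq_zero_of_ne_one hχ, ← Finset.mul_sum, Finset.sum_comm]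
    simp only [← Finset.mul_sum, hshift]
    have h2 : ((∑ k : ZMod N, k.val * χ k : ℤ) : ℂ) * τ = ∑ k : ZMod N, k.val * (ψ k * τ) := by
      push_cast
      rw [Finset.sum_mul]
      refine Finset.sum_congr rfl fun k _ => ?_
      rw [mul_assoc]
      rfl
    rw [← h2]
    field_simp
    ring
  have hs : √(N : ℝ) ^ 2 = N := Real.sq_sqrt hN.le
  have hs0 : √(N : ℝ) ≠ 0 := (Real.sqrt_pos.mpr hN).ne'
  have key (T : ℤ) : Real.pi * √N / N ^ 2 * T = Real.pi * T / (N * √N) := by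
    field_simp
    rw [hs]
  rcases hreal with h | h
  · refine ⟨∑ k : ZMod N, k.val * χ k, ?_⟩
    rw [hL, h, ← key]
    push_cast
    ring
  · refine ⟨-∑ k : ZMod N, k.val * χ k, ?_⟩
    rw [hL, h, ← key]
    push_cast
    ring

end

end NonunitSquares

namespace NonunitSquares

open scoped NumberTheorySymbols
open DirichletCharacter hiding Odd

section

variable {k : ℕ}

lemma jacobiSym_neg_four_mul_sub_one (hk : k ≠ 0) : J(-(k : ℤ) | 4 * k - 1) = -1 := by
  have hodd : Odd (4 * k - 1) := ⟨2 * k - 1, by omega⟩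
  have h4 : (4 * k - 1) % 4 = 3 := by omega
  have h1 : J((4 * k : ℤ) | 4 * k - 1) = 1 := by
    rw [← jacobiSym.one_left (4 * k - 1)]
    refine jacobiSym.mod_left' ?_
    rw [show (4 * k : ℤ) = 1 + ((4 * k - 1 : ℕ) : ℤ) by
      push_cast [show 1 ≤ 4 * k by omega]
      ring, Int.add_emod_right]
  have h2 : J((2 : ℤ) | 4 * k - 1) ^ 2 = 1 := by
    refine jacobiSym.sq_one ?_
    rw [Int.gcd_comm]
    simpa [Int.gcd] using hodd.coprime_two_right
  rw [show (4 * k : ℤ) = 2 * 2 * k by ring, jacobiSym.mul_left, jacobiSym.mul_left, ← sq, h2,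
    one_mul] at h1
  rw [neg_eq_neg_one_mul, jacobiSym.mul_left, h1, jacobiSym.at_neg_one hodd,
    ZMod.χ₄_nat_three_mod_four h4, mul_one]

lemma exists_jacobiSym_eq_neg_one {q : ℕ} (hq : q.Prime) (hq2 : q ≠ 2) :
    ∃ r : ℕ, J(r | q) = -1 := by
  have : Fact q.Prime := ⟨hq⟩
  obtain ⟨a, ha⟩ := FiniteField.exists_nonsquare (F := ZMod q) (by rwa [ZMod.ringChar_zmod_n])
  refine ⟨a.val, ?_⟩
  rw [← jacobiSym.legendreSym.to_jacobiSym, legendreSym.eq_neg_one_iff]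
  simpa using ha

/-- A witness against the Jacobi symbol of `-k` having a smaller period. -/
lemma exists_modEq_one_jacobiSym_eq_neg_one (hsq : Squarefree k) (hk : k % 4 = 1 ∨ k % 4 = 2)
    {q M : ℕ} (hq : q.Prime) (hM : q * M = 4 * k) :
    ∃ c : ℕ, c ≡ 1 [MOD M] ∧ Odd c ∧ J(-(k : ℤ) | c) = -1 := by
  by_cases hq2 : q = 2
  · subst hq2
    rcases hk with hk | hk
    · have hodd : Odd (1 + 2 * k) := ⟨k, by ring⟩
      refine ⟨1 + 2 * k, ?_, hodd, ?_⟩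
      · rw [show M = 2 * k by omega]
        simp [Nat.ModEq]
      · rw [neg_eq_neg_one_mul, jacobiSym.mul_left, jacobiSym.at_neg_one hodd,
          ZMod.χ₄_nat_three_mod_four (by omega),
          jacobiSym.quadratic_reciprocity_one_mod_four hk hodd,
          show J(((1 + 2 * k : ℕ) : ℤ) | k) = J(1 | k) from
            jacobiSym.mod_left' (by push_cast; simp), jacobiSym.one_left, mul_one]
    · obtain ⟨m, rfl⟩ : ∃ m, k = 2 * m := ⟨k / 2, by omega⟩
      have hm : Odd m := Nat.odd_iff.mpr (by omega)
      have hodd : Odd (1 + 4 * m) := ⟨2 * m, by ring⟩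
      refine ⟨1 + 4 * m, ?_, hodd, ?_⟩
      · rw [show M = 4 * m by omega]
        simp [Nat.ModEq]
      · rw [show (-((2 * m : ℕ) : ℤ)) = -1 * 2 * m by push_cast; ring, jacobiSym.mul_left,
          jacobiSym.mul_left, jacobiSym.at_neg_one hodd, ZMod.χ₄_nat_one_mod_four (by omega),
          jacobiSym.at_two hodd, ZMod.χ₈_nat_eq_if_mod_eight, if_neg (by omega),
          if_neg (by obtain ⟨t, rfl⟩ := hm; omega),
          jacobiSym.quadratic_reciprocity_one_mod_four' hm (by omega),
          show J(((1 + 4 * m : ℕ) : ℤ) | m) = J(1 | m) from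
            jacobiSym.mod_left' (by push_cast; simp), jacobiSym.one_left]
        norm_num
  · have hqk : q ∣ k := by
      have h1 : q ∣ 4 * k := ⟨M, hM.symm⟩
      refine (Nat.Coprime.dvd_of_dvd_mul_left ?_ h1)
      exact (Nat.Coprime.pow_right 2 ((Nat.coprime_primes hq Nat.prime_two).mpr hq2) :)
    obtain ⟨m, rfl⟩ := hqk
    have hqm : Nat.Coprime q m := Nat.coprime_of_squarefree_mul hsq
    have hM' : M = 4 * m := by
      refine Nat.eq_of_mul_eq_mul_left hq.pos ?_
      rw [hM]
      ring
    have hcop : Nat.Coprime M q := by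
      rw [hM']
      exact (Nat.Coprime.mul_left
        (Nat.Coprime.pow_left 2 ((Nat.coprime_primes Nat.prime_two hq).mpr (Ne.symm hq2)) :)
        hqm.symm)
    obtain ⟨r, hr⟩ := exists_jacobiSym_eq_neg_one hq hq2
    obtain ⟨c, hc1, hc2⟩ := Nat.chineseRemainder hcop 1 r
    rw [hM'] at hc1
    have hc4 : c % 4 = 1 := hc1.of_mul_right m
    have hodd : Odd c := Nat.odd_iff.mpr (by omega)
    refine ⟨c, hM' ▸ hc1, hodd, ?_⟩
    have hm : J(-(m : ℤ) | c) = 1 := by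
      rw [jacobiSym.mod_right _ hodd, Int.natAbs_neg, Int.natAbs_natCast, hc1,
        Nat.mod_eq_of_lt (by have : m ≠ 0 := by rintro rfl; simp at hsq
                             omega), jacobiSym.one_right]
    rw [show (-((q * m : ℕ) : ℤ)) = q * -m by push_cast; ring, jacobiSym.mul_left, hm, mul_one,
      jacobiSym.quadratic_reciprocity_one_mod_four' (hq.odd_of_ne_two hq2) hc4, ← hr]
    exact jacobiSym.mod_left' (by exact_mod_cast hc2)

variable [NeZero k]

lemma jacobiChar_neg_one (hk : (-(k : ℤ)).natAbs = k) : jacobiChar (-k) k hk (-1) = -1 := by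
  have hk0 : k ≠ 0 := NeZero.ne k
  have h1 : (-1 : ZMod (4 * k)) = ((4 * k - 1 : ℕ) : ZMod (4 * k)) := by
    rw [Nat.cast_sub (by omega), ZMod.natCast_self, zero_sub, Nat.cast_one]
  rw [h1, jacobiChar_natCast, if_pos ⟨2 * k - 1, by omega⟩, jacobiSym_neg_four_mul_sub_one hk0]

lemma isPrimitive_jacobiChar (hk : (-(k : ℤ)).natAbs = k) (hsq : Squarefree k)
    (hk4 : k % 4 = 1 ∨ k % 4 = 2) : (complexChar (jacobiChar (-k) k hk)).IsPrimitive := by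
  set χ := complexChar (jacobiChar (-k) k hk) with hχ
  by_contra hne
  obtain ⟨d, hd⟩ := conductor_dvd_level χ
  have hd1 : d ≠ 1 := by
    rintro rfl
    exact hne (by rw [IsPrimitive]; omega)
  obtain ⟨q, hq, e, rfl⟩ := Nat.exists_prime_and_dvd hd1
  have hM : q * (χ.conductor * e) = 4 * k := by rw [mul_left_comm]; exact hd.symm
  obtain ⟨c, hc1, hc2, hc3⟩ := exists_modEq_one_jacobiSym_eq_neg_one hsq hk4 hq hM
  have hdvd : χ.conductor * e ∣ 4 * k := Dvd.intro_left q hM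
  have hf := FactorsThrough.mono χ (factorsThrough_conductor χ) (Dvd.intro _ rfl) hdvd
  have hval : χ (c : ZMod (4 * k)) = -1 := by
    change ((jacobiChar (-k) k hk c : ℤ) : ℂ) = -1
    rw [jacobiChar_natCast, if_pos hc2, hc3]
    norm_num
  have hu : IsUnit (c : ZMod (4 * k)) := by
    by_contra h
    rw [MulChar.map_nonunit χ h] at hval
    norm_num at hval
  have h1 : hu.unit ∈ (ZMod.unitsMap hdvd).ker := by
    rw [MonoidHom.mem_ker, Units.ext_iff]
    simp only [ZMod.unitsMap_def, Units.coe_map, IsUnit.unit_spec, Units.val_one]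
    have h2 : ((c : ℕ) : ZMod (χ.conductor * e)) = ((1 : ℕ) : ZMod _) :=
      (ZMod.natCast_eq_natCast_iff _ _ _).mpr hc1
    simpa using h2
  have h2 := (factorsThrough_iff_ker_unitsMap hdvd).mp hf h1
  rw [MonoidHom.mem_ker, Units.ext_iff, MulChar.coe_toUnitHom, IsUnit.unit_spec, hval] at h2
  norm_num at h2

end

lemma IsExceptional.not_dvd_three_or_seven {n p : ℕ} (hn : IsExceptional n) (hp : p = 3 ∨ p = 7) :
    ¬p ∣ n := by
  intro h
  have hl := hn.large
  have := hn.le_prime p (by rcases hp with rfl | rfl <;> norm_num) (by omega) (by omega) 0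
    (by simpa using Int.natCast_dvd_natCast.mpr h)
  omega

lemma IsExceptional.squarefree {n : ℕ} (hn : IsExceptional n) : Squarefree n := by
  rw [Nat.squarefree_iff_prime_squarefree]
  intro x hx hxn
  have hl := hn.large
  have h8 := hn.mod_eight
  by_cases hx2 : x = 2
  · subst hx2
    omega
  by_cases hx5 : x = 5
  · subst hx5
    exact hn.not_dvd hxn
  have h1 := hn.le_prime x hx hx2 hx5 0
    (by simpa using Int.natCast_dvd_natCast.mpr (dvd_of_mul_left_dvd hxn))
  have h2 : x * x ≤ n := Nat.le_of_dvd (by omega) hxn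
  have h3 : 5 * (x * x) ≤ n := by
    refine Nat.le_of_dvd (by omega) (Nat.Coprime.mul_dvd_of_dvd_of_dvd ?_ hn.five_dvd hxn)
    have := (Nat.coprime_primes Nat.prime_five hx).mpr (Ne.symm hx5)
    exact this.mul_right this
  have h4 : x < 10 := by nlinarith
  omega

theorem IsExceptional.LFunction_psi_one {n p : ℕ} [NeZero p] [NeZero n] (hn : IsExceptional n)
    (hp : p = 3 ∨ p = 7) : complexChar (psi p n) ≠ 1 ∧ ∃ T : ℤ, (complexChar (psi p n)).LFunction 1 =
      ((Real.pi * T / ((4 * (p * n) : ℕ) * √(4 * (p * n) : ℕ)) : ℝ) : ℂ) := by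
  have hcop : Nat.Coprime p n := by
    rw [Nat.Prime.coprime_iff_not_dvd (by rcases hp with rfl | rfl <;> norm_num)]
    exact hn.not_dvd_three_or_seven hp
  have hsq : Squarefree (p * n) := by
    rw [Nat.squarefree_mul hcop]
    refine ⟨?_, hn.squarefree⟩
    rcases hp with rfl | rfl <;> exact Nat.Prime.prime (by norm_num) |>.squarefree
  have h4 : p * n % 4 = 1 ∨ p * n % 4 = 2 := by
    have := hn.mod_eight
    rcases hp with rfl | rfl <;> omega
  have hk : (-((p * n : ℕ) : ℤ)).natAbs = p * n := by rw [Int.natAbs_neg, Int.natAbs_natCast]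
  have hpsi : psi p n = jacobiChar (-((p * n : ℕ) : ℤ)) (p * n) hk := by
    unfold psi
    congr 1
  have hodd : psi p n (-1) = -1 := by rw [hpsi, jacobiChar_neg_one]
  exact ⟨complexChar_ne_one hodd, LFunction_one_eq_of_odd (by rw [hpsi]; exact jacobiChar_isQuadratic _)
    (by rw [hpsi]; exact isPrimitive_jacobiChar hk hsq h4) hodd⟩

end NonunitSquares

namespace NonunitSquares

open Filter Topology

lemma tendsto_sum_period {N : ℕ} [NeZero N] (w : Fin N → ℝ) {G Q : ℝ → ℝ}
    (hG : ∀ x ∈ Set.Icc (0 : ℝ) 1, HasDerivAt G (Q x) x) (hQ : ContinuousOn Q (Set.Icc 0 1))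
    (hP : ∀ x ∈ Set.Icc (0 : ℝ) 1, Q x * (1 - x ^ N) = ∑ a, w a * x ^ (a : ℕ)) :
    Tendsto (fun T => ∑ t ∈ Finset.range T, ∑ a, w a * (1 / ((a : ℕ) + N * t + 1 : ℝ))) atTop
      (𝓝 (G 1 - G 0)) := by
  have hIcc : Set.uIcc (0 : ℝ) 1 = Set.Icc 0 1 := Set.uIcc_of_le zero_le_one
  obtain ⟨C, hC⟩ := isCompact_Icc.exists_bound_of_continuousOn hQ
  have hC0 : 0 ≤ C := (norm_nonneg _).trans (hC 0 (by simp))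
  have hint (T : ℕ) : IntervalIntegrable (fun x => Q x * x ^ T) MeasureTheory.volume 0 1 := by
    refine ContinuousOn.intervalIntegrable ?_
    rw [hIcc]
    exact hQ.mul (by fun_prop)
  have hint0 : IntervalIntegrable Q MeasureTheory.volume 0 1 :=
    ContinuousOn.intervalIntegrable (by rwa [hIcc])
  have hpartial (T : ℕ) : ∑ t ∈ Finset.range T, ∑ a, w a * (1 / ((a : ℕ) + N * t + 1 : ℝ)) =
      G 1 - G 0 - ∫ x in (0 : ℝ)..1, Q x * x ^ (N * T) := by
    rw [← intervalIntegral.integral_eq_sub_of_hasDerivAt (fun x hx => hG x (hIcc ▸ hx)) hint0,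
      ← intervalIntegral.integral_sub hint0 (hint _)]
    have h1 : ∀ x ∈ Set.uIcc (0 : ℝ) 1, Q x - Q x * x ^ (N * T) =
        ∑ t ∈ Finset.range T, ∑ a, w a * x ^ ((a : ℕ) + N * t) := by
      intro x hx
      rw [hIcc] at hx
      have h2 := mul_neg_geom_sum (x ^ N) T
      rw [← pow_mul] at h2
      rw [show Q x - Q x * x ^ (N * T) = Q x * (1 - x ^ (N * T)) by ring, ← h2, ← mul_assoc, hP x hx,
        Finset.mul_sum]
      refine Finset.sum_congr rfl fun t _ => ?_
      rw [Finset.sum_mul]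
      refine Finset.sum_congr rfl fun a _ => ?_
      rw [pow_add, pow_mul]
      ring
    rw [intervalIntegral.integral_congr h1, intervalIntegral.integral_finsetSum fun t _ =>
      (Continuous.intervalIntegrable (by fun_prop) _ _)]
    refine Finset.sum_congr rfl fun t _ => ?_
    rw [intervalIntegral.integral_finsetSum fun a _ =>
      (Continuous.intervalIntegrable (by fun_prop) _ _)]
    refine Finset.sum_congr rfl fun a _ => ?_
    rw [intervalIntegral.integral_const_mul, integral_pow]
    push_cast
    simp
  simp only [hpartial]
  have hlim : Tendsto (fun T : ℕ => ∫ x in (0 : ℝ)..1, Q x * x ^ (N * T)) atTop (𝓝 0) := by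
    have hbd (T : ℕ) : ‖∫ x in (0 : ℝ)..1, Q x * x ^ (N * T)‖ ≤ C * (1 / ((T : ℝ) + 1)) := by
      have h1 : ‖∫ x in (0 : ℝ)..1, Q x * x ^ (N * T)‖ ≤ ∫ x in (0 : ℝ)..1, C * x ^ T := by
        refine intervalIntegral.norm_integral_le_of_norm_le zero_le_one
          (Eventually.of_forall fun x hx => ?_) (Continuous.intervalIntegrable (by fun_prop) _ _)
        have hx' : x ∈ Set.Icc (0 : ℝ) 1 := ⟨hx.1.le, hx.2⟩
        rw [norm_mul, norm_pow, Real.norm_of_nonneg hx'.1]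
        exact mul_le_mul (hC x hx') (pow_le_pow_of_le_one hx'.1 hx'.2
          (Nat.le_mul_of_pos_left T (NeZero.pos N))) (pow_nonneg hx'.1 _) hC0
      rw [intervalIntegral.integral_const_mul, integral_pow] at h1
      simpa using h1
    refine squeeze_zero_norm hbd ?_
    simpa using (tendsto_one_div_add_atTop_nhds_zero_nat (𝕜 := ℝ)).const_mul C
  simpa using tendsto_const_nhds.sub hlim

/-- A Dirichlet series of period `N` with values `w` on one period, summed in closed form from a
factorization `(E + d * O) * (E - d * O)` of a cyclotomic polynomial. -/
lemma tendsto_sum_period_log {N : ℕ} [NeZero N] (w : Fin N → ℝ) {E E' O O' : ℝ → ℝ} {d : ℝ} (hd : 0 < d)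
    (hE : ∀ x, HasDerivAt E (E' x) x) (hO : ∀ x, HasDerivAt O (O' x) x)
    (hE' : Continuous E') (hO' : Continuous O')
    (hE0 : ∀ x ∈ Set.Icc (0 : ℝ) 1, 0 < E x) (hO0 : ∀ x ∈ Set.Icc (0 : ℝ) 1, 0 ≤ O x)
    (hpos : ∀ x ∈ Set.Icc (0 : ℝ) 1, 0 < E x ^ 2 - d ^ 2 * O x ^ 2)
    (hP : ∀ x ∈ Set.Icc (0 : ℝ) 1, (O' x * E x - E' x * O x) * (1 - x ^ N) =
      (E x ^ 2 - d ^ 2 * O x ^ 2) * ∑ a, w a * x ^ (a : ℕ))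
    (h0 : O 0 = 0) (h1 : E 1 ^ 2 - d ^ 2 * O 1 ^ 2 = 1) :
    Tendsto (fun T => ∑ t ∈ Finset.range T, ∑ a, w a * (1 / ((a : ℕ) + N * t + 1 : ℝ))) atTop
      (𝓝 (Real.log (E 1 + d * O 1) / d)) := by
  have hp (x) (hx : x ∈ Set.Icc (0 : ℝ) 1) : 0 < E x + d * O x :=
    add_pos_of_pos_of_nonneg (hE0 x hx) (mul_nonneg hd.le (hO0 x hx))
  have hm (x) (hx : x ∈ Set.Icc (0 : ℝ) 1) : 0 < E x - d * O x := by
    have h : 0 < (E x + d * O x) * (E x - d * O x) := by linarith [hpos x hx]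
    exact (pos_iff_pos_of_mul_pos h).mp (hp x hx)
  have hEc : Continuous E := continuous_iff_continuousAt.mpr fun x => (hE x).continuousAt
  have hOc : Continuous O := continuous_iff_continuousAt.mpr fun x => (hO x).continuousAt
  have := tendsto_sum_period w
    (G := fun x => (Real.log (E x + d * O x) - Real.log (E x - d * O x)) / (2 * d))
    (Q := fun x => (O' x * E x - E' x * O x) / (E x ^ 2 - d ^ 2 * O x ^ 2)) (fun x hx => ?_)
    (ContinuousOn.div (by fun_prop) (by fun_prop) fun x hx => (hpos x hx).ne') (fun x hx => ?_)
  · convert this using 2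
    have hx1 : (1 : ℝ) ∈ Set.Icc (0 : ℝ) 1 := by simp
    have e1 : E 1 - d * O 1 = (E 1 + d * O 1)⁻¹ :=
      eq_inv_of_mul_eq_one_left (by linarith)
    rw [h0, e1, Real.log_inv, mul_zero, add_zero, sub_zero]
    field_simp
    ring
  · have a1 := (hp x hx).ne'
    have a2 := (hm x hx).ne'
    have a3 := (hpos x hx).ne'
    have := ((((hE x).add ((hO x).const_mul d)).log a1).sub
      (((hE x).sub ((hO x).const_mul d)).log a2)).div_const (2 * d)
    refine this.congr_deriv ?_
    simp only [Pi.add_apply, Pi.sub_apply]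
    have a4 : E x ^ 2 - d ^ 2 * O x ^ 2 = (E x + d * O x) * (E x - d * O x) := by ring
    rw [a4]
    field_simp
    ring
  · rw [div_mul_eq_mul_div, hP x hx, mul_div_cancel_left₀ _ (hpos x hx).ne']

end NonunitSquares

namespace NonunitSquares

open Filter Topology
open scoped NumberTheorySymbols

lemma LFunction_one_eq_of_tendsto {N : ℕ} [NeZero N] {χ : MulChar (ZMod N) ℤ} (hq : χ.IsQuadratic)
    (hχ : complexChar χ ≠ 1) {v : ℝ} (h : Tendsto (fun T => ∑ t ∈ Finset.range T,
      ∑ a : Fin N, (χ ((a : ℕ) + 1 : ℕ) : ℝ) * (1 / ((a : ℕ) + N * t + 1 : ℝ))) atTop (𝓝 v)) :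
    (complexChar χ).LFunction 1 = v := by
  rw [LFunction_one_eq_tsum_periodSum hq hχ,
    tendsto_nhds_unique (summable_periodSum hq hχ).hasSum.tendsto_sum_nat (h.congr fun T => ?_)]
  refine Finset.sum_congr rfl fun t _ => ?_
  refine Finset.sum_congr rfl fun a _ => ?_
  rw [Real.rpow_neg_one]
  push_cast
  rw [one_div]

lemma LFunction_three : (complexChar (jacobiChar (3 : ℕ) 3 (Int.natAbs_natCast 3))).LFunction 1 =
    ((Real.log (2 + √3) / √3 : ℝ) : ℂ) := by
  have hval (m : ℕ) := jacobiChar_natCast (Int.natAbs_natCast 3) m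
  have h5 : jacobiChar (3 : ℕ) 3 (Int.natAbs_natCast 3) (5 : ℕ) = -1 := by
    rw [hval, if_pos (by decide)]
    norm_num
  have hs : √(3 : ℝ) ^ 2 = 3 := Real.sq_sqrt (by norm_num)
  refine LFunction_one_eq_of_tendsto (jacobiChar_isQuadratic _) (complexChar_ne_one h5) ?_
  have := tendsto_sum_period_log (N := 4 * 3)
    (fun a => (jacobiChar (3 : ℕ) 3 (Int.natAbs_natCast 3) ((a : ℕ) + 1 : ℕ) : ℝ))
    (E := fun x => x ^ 2 + 1) (E' := fun x => 2 * x) (O := fun x => x) (O' := fun x => 1)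
    (d := √3) (by positivity) (fun x => by simpa using (hasDerivAt_pow 2 x).add_const 1)
    (fun x => hasDerivAt_id x) (by fun_prop) (by fun_prop)
    (fun x hx => by positivity) (fun x hx => hx.1)
    (fun x hx => by rw [hs]; nlinarith [sq_nonneg (x ^ 2 - 1 / 2)])
    (fun x hx => ?_) rfl (by rw [hs]; norm_num)
  · convert this using 4
    norm_num
  · simp only [hval, hs]
    rw [Fin.sum_univ_eq_sum_range (fun a => (((if Odd (a + 1) then J((3 : ℕ) | a + 1) else 0 : ℤ)) : ℝ) * x ^ a)]
    simp [Finset.sum_range_succ, Nat.odd_iff]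
    norm_num
    ring

lemma LFunction_seven : (complexChar (jacobiChar (7 : ℕ) 7 (Int.natAbs_natCast 7))).LFunction 1 =
    ((Real.log (8 + 3 * √7) / √7 : ℝ) : ℂ) := by
  have hval (m : ℕ) := jacobiChar_natCast (Int.natAbs_natCast 7) m
  have h5 : jacobiChar (7 : ℕ) 7 (Int.natAbs_natCast 7) (5 : ℕ) = -1 := by
    rw [hval, if_pos (by decide)]
    norm_num
  have hs : √(7 : ℝ) ^ 2 = 7 := Real.sq_sqrt (by norm_num)
  refine LFunction_one_eq_of_tendsto (jacobiChar_isQuadratic _) (complexChar_ne_one h5) ?_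
  have := tendsto_sum_period_log (N := 4 * 7)
    (fun a => (jacobiChar (7 : ℕ) 7 (Int.natAbs_natCast 7) ((a : ℕ) + 1 : ℕ) : ℝ))
    (E := fun x => x ^ 6 + 3 * x ^ 4 + 3 * x ^ 2 + 1)
    (E' := fun x => 6 * x ^ 5 + 3 * (4 * x ^ 3) + 3 * (2 * x))
    (O := fun x => x ^ 5 + x ^ 3 + x) (O' := fun x => 5 * x ^ 4 + 3 * x ^ 2 + 1)
    (d := √7) (by positivity)
    (fun x => by
      simpa using (((hasDerivAt_pow 6 x).add ((hasDerivAt_pow 4 x).const_mul 3)).add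
        ((hasDerivAt_pow 2 x).const_mul 3)).add_const 1)
    (fun x => (((hasDerivAt_pow 5 x).add (hasDerivAt_pow 3 x)).add
      (hasDerivAt_id x)).congr_deriv (by norm_num))
    (by fun_prop) (by fun_prop)
    (fun x hx => by positivity) (fun x hx => by have := hx.1; positivity)
    (fun x hx => ?_) (fun x hx => ?_) (by norm_num) (by rw [hs]; norm_num)
  · convert this using 4
    norm_num
    ring
  · rw [hs]
    have h1 : 0 ≤ 1 - x ^ 2 := by nlinarith [hx.1, hx.2]
    rcases eq_or_lt_of_le hx.1 with h0 | h0
    · rw [← h0]; norm_num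
    · have : 0 < (1 - x ^ 2) * (1 + x ^ 4 + x ^ 8) + x ^ 12 := by positivity
      linarith
  · simp only [hval, hs]
    rw [Fin.sum_univ_eq_sum_range (fun a => (((if Odd (a + 1) then J((7 : ℕ) | a + 1) else 0 : ℤ)) : ℝ) * x ^ a)]
    simp [Finset.sum_range_succ, Nat.odd_iff]
    norm_num
    ring

end NonunitSquares

namespace NonunitSquares

lemma one_le_log_three : 1 ≤ Real.log (2 + √3) := by
  rw [Real.le_log_iff_exp_le (by positivity)]
  have h1 : (1.7 : ℝ) ≤ √3 := Real.le_sqrt_of_sq_le (by norm_num)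
  linarith [Real.exp_one_lt_d9]

lemma two_le_log_seven : 2 ≤ Real.log (8 + 3 * √7) := by
  rw [Real.le_log_iff_exp_le (by positivity), show (2 : ℝ) = 1 + 1 by norm_num, Real.exp_add]
  have h1 : (2 : ℝ) ≤ √7 := Real.le_sqrt_of_sq_le (by norm_num)
  nlinarith [Real.exp_one_lt_d9, Real.exp_pos 1]

variable {n : ℕ}

lemma IsExceptional.abs_sub_le_of_norm_le (hn : 0 < n) {p : ℕ} (hp : 0 < p) {T : ℤ} {l e : ℝ}
    (h : ‖((l / √p : ℝ) : ℂ) * ((Real.pi * T / ((4 * (p * n) : ℕ) * √(4 * (p * n) : ℕ)) : ℝ) : ℂ) -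
      (Real.pi ^ 2 / 10 * (1 - 1 / (p : ℝ) ^ 2) : ℝ)‖ ≤ 3 / 5 * e) :
    |T * l - 4 / 5 * Real.pi * ((p : ℝ) ^ 2 - 1) * (n * √n)| ≤ 8 / 5 * (p : ℝ) ^ 2 * (n * √n) * e := by
  have hn' : (0 : ℝ) < n := by exact_mod_cast hn
  have hp' : (0 : ℝ) < p := by exact_mod_cast hp
  rw [← Complex.ofReal_mul, ← Complex.ofReal_sub, Complex.norm_real, Real.norm_eq_abs] at h
  have h4 : √(4 * (p * n) : ℕ) = 2 * √p * √n := by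
    rw [show ((4 * (p * n) : ℕ) : ℝ) = 2 ^ 2 * (p * n) by push_cast; ring,
      Real.sqrt_mul (by norm_num), Real.sqrt_sq (by norm_num), Real.sqrt_mul hp'.le, mul_assoc]
  have hsp : √(p : ℝ) ^ 2 = p := Real.sq_sqrt hp'.le
  have hpi := Real.pi_pos
  have hx : 0 < n * √n := by positivity
  have h5 : T * l - 4 / 5 * Real.pi * ((p : ℝ) ^ 2 - 1) * (n * √n) =
      8 * (p : ℝ) ^ 2 * (n * √n) / Real.pi * (l / √p * (Real.pi * T / ((4 * (p * n) : ℕ) *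
        √(4 * (p * n) : ℕ))) - Real.pi ^ 2 / 10 * (1 - 1 / (p : ℝ) ^ 2)) := by
    rw [h4]
    push_cast
    field_simp
    rw [hsp]
    ring
  rw [h5, abs_mul, abs_of_pos (by positivity)]
  refine (mul_le_mul_of_nonneg_left h (by positivity)).trans ?_
  rw [div_mul_eq_mul_div, div_le_iff₀ hpi]
  have : 0 ≤ e := by linarith [abs_nonneg (l / √p * (Real.pi * T / ((4 * (p * n) : ℕ) *
        √(4 * (p * n) : ℕ))) - Real.pi ^ 2 / 10 * (1 - 1 / (p : ℝ) ^ 2))]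
  have : 0 ≤ (p : ℝ) ^ 2 * (n * √n) * e := by positivity
  nlinarith [Real.pi_gt_three]

/-- An exceptional number yields a very small linear form in two logarithms. -/
theorem IsExceptional.exists_small_linear_form (hn : IsExceptional n) :
    ∃ b₁ b₂ : ℕ, 0 < b₁ ∧ 0 < b₂ ∧ (b₁ : ℝ) ≤ 150 * (n * √n) ∧ (b₂ : ℝ) ≤ 150 * (n * √n) ∧
      |b₁ * Real.log (2 + √3) - b₂ * Real.log (8 + 3 * √7)| ≤
        165 * (n * √n) * Real.exp (-√n / 90) := by
  have hn0 : 0 < n := by have := hn.large; omega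
  have : NeZero n := ⟨hn0.ne'⟩
  have hsq : 1000 ≤ √(n : ℝ) := by
    refine Real.le_sqrt_of_sq_le ?_
    have : ((10 ^ 6 : ℕ) : ℝ) ≤ n := by exact_mod_cast hn.large
    norm_num at this ⊢
    exact this
  have he : Real.exp (-√n / 90) ≤ 1 / 12 := by
    have h1 := Real.add_one_le_exp (√n / 90)
    rw [neg_div, Real.exp_neg, ← one_div]
    exact one_div_le_one_div_of_le (by norm_num) (by linarith)
  have hx : 0 < n * √n := by positivity
  set e := Real.exp (-√n / 90)
  have he0 : 0 < e := Real.exp_pos _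
  obtain ⟨hψ3, T3, hT3⟩ := hn.LFunction_psi_one (p := 3) (Or.inl rfl)
  obtain ⟨hψ7, T7, hT7⟩ := hn.LFunction_psi_one (p := 7) (Or.inr rfl)
  have h3 := hn.norm_LFunction_mul_sub_le (p := 3) (Or.inl rfl) hψ3
  have h7 := hn.norm_LFunction_mul_sub_le (p := 7) (Or.inr rfl) hψ7
  rw [LFunction_three, hT3] at h3
  rw [LFunction_seven, hT7] at h7
  have h3' := IsExceptional.abs_sub_le_of_norm_le hn0 (p := 3) (by norm_num) h3
  have h7' := IsExceptional.abs_sub_le_of_norm_le hn0 (p := 7) (by norm_num) h7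
  clear hψ3 hT3 hψ7 hT7 h3 h7
  have hl3 := one_le_log_three
  have hl7 := two_le_log_seven
  set l3 := Real.log (2 + √3)
  set l7 := Real.log (8 + 3 * √7)
  set x := n * √(n : ℝ)
  norm_num at h3' h7'
  have hxe : x * e ≤ x / 12 := by nlinarith
  have hxe0 : 0 < x * e := by positivity
  have hpx : 3 * x ≤ Real.pi * x ∧ Real.pi * x ≤ 3.15 * x :=
    ⟨by nlinarith [Real.pi_gt_three], by nlinarith [Real.pi_lt_d2]⟩
  rw [abs_le] at h3' h7'
  have hT3 : 0 < T3 := by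
    by_contra! h
    have : (T3 : ℝ) ≤ 0 := by exact_mod_cast h
    nlinarith
  have hT7 : 0 < T7 := by
    by_contra! h
    have : (T7 : ℝ) ≤ 0 := by exact_mod_cast h
    nlinarith
  lift T3 to ℕ using hT3.le
  lift T7 to ℕ using hT7.le
  push_cast at h3' h7' hT3 hT7
  refine ⟨6 * T3, T7, by omega, by omega, ?_, ?_, ?_⟩
  · push_cast
    nlinarith [(Nat.cast_nonneg T3 : (0 : ℝ) ≤ T3)]
  · nlinarith [(Nat.cast_nonneg T7 : (0 : ℝ) ≤ T7)]
  · push_cast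
    rw [abs_le]
    constructor <;> nlinarith

end NonunitSquares

namespace NonunitSquares

open QuadraticAlgebra

/-- The ring `ℤ[√3][√7]`. -/
abbrev Biquadratic : Type := QuadraticAlgebra (QuadraticAlgebra ℤ 3 0) 7 0

/-- The ring homomorphism `ℤ[√3][√7] → ℝ` attached to a choice of square roots. -/
noncomputable def biquadraticEval (s t : ℝ) (hs : s ^ 2 = 3) (ht : t ^ 2 = 7) : Biquadratic →+* ℝ where
  toFun z := z.re.re + z.re.im * s + (z.im.re + z.im.im * s) * t
  map_one' := by simp
  map_zero' := by simp
  map_add' x y := by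
    simp only [re_add, im_add]
    push_cast
    ring
  map_mul' x y := by
    have h7 : ((7 : QuadraticAlgebra ℤ 3 0).re : ℤ) = 7 ∧ ((7 : QuadraticAlgebra ℤ 3 0).im : ℤ) = 0 :=
      ⟨rfl, rfl⟩
    simp only [re_mul, im_mul, re_add, im_add, re_zero, im_zero, h7.1, h7.2]
    push_cast
    linear_combination (-(x.re.im : ℝ) * y.re.im - (x.re.im * y.im.im + x.im.im * y.re.im) * t -
      7 * x.im.im * y.im.im) * hs -
      ((x.im.re + x.im.im * s) * (y.im.re + y.im.im * s)) * ht

lemma exists_int_eq_det {ι : Type*} [Fintype ι] [DecidableEq ι] (z : ι → ι → ℤ) (u v : ι → ι → ℕ) :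
    ∃ a b c d : ℤ, ∀ s t : ℝ, s ^ 2 = 3 → t ^ 2 = 7 →
      (Matrix.of fun i j => (z i j : ℝ) * (2 + s) ^ u i j * (8 + 3 * t) ^ v i j).det =
        a + b * s + (c + d * s) * t := by
  let x : Biquadratic := ⟨⟨2, 1⟩, 0⟩
  let y : Biquadratic := ⟨8, 3⟩
  let w : Biquadratic := (Matrix.of fun i j => (z i j : Biquadratic) * x ^ u i j * y ^ v i j).det
  refine ⟨w.re.re, w.re.im, w.im.re, w.im.im, fun s t hs ht => ?_⟩
  have hx : biquadraticEval s t hs ht x = 2 + s := by simp [biquadraticEval, x]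
  have hy : biquadraticEval s t hs ht y = 8 + 3 * t := by
    change ((8 : ℤ) : ℝ) + ((0 : ℤ) : ℝ) * s + (((3 : ℤ) : ℝ) + ((0 : ℤ) : ℝ) * s) * t = _
    push_cast
    ring
  change _ = biquadraticEval s t hs ht w
  rw [RingHom.map_det]
  congr 1
  ext i j
  simp [hx, hy]

lemma eq_zero_of_sq_eq_mul_sq {m : ℕ} (hm : ¬IsSquare m) {x y : ℤ} (h : x ^ 2 = m * y ^ 2) :
    x = 0 ∧ y = 0 := by
  have hy : y = 0 := by
    by_contra hy
    have hy' : (y : ℝ) ≠ 0 := by exact_mod_cast hy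
    have hirr := (irrational_sqrt_natCast_iff (n := m)).mpr hm
    refine hirr ⟨|x / y|, ?_⟩
    have h' : (x : ℝ) ^ 2 = m * (y : ℝ) ^ 2 := by exact_mod_cast h
    push_cast
    rw [← Real.sqrt_sq_eq_abs, div_pow, h', mul_div_cancel_right₀ _ (by positivity)]
  refine ⟨?_, hy⟩
  rw [hy] at h
  simpa using h

lemma biquadratic_ne_zero {a b c d : ℤ} {s t : ℝ} (hs : s ^ 2 = 3) (ht : t ^ 2 = 7)
    (h : a + b * s + (c + d * s) * t = 0) : a = 0 ∧ b = 0 ∧ c = 0 ∧ d = 0 := by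
  have hns {m : ℕ} (k : ℕ) (h1 : k ^ 2 < m) (h2 : m < (k + 1) ^ 2) : ¬IsSquare m := by
    rintro ⟨r, rfl⟩
    have h3 : k < r := by nlinarith
    have h4 : r < k + 1 := by nlinarith
    omega
  have h1 : ((a ^ 2 + 3 * b ^ 2 - 7 * c ^ 2 - 21 * d ^ 2 : ℤ) : ℝ) + (2 * (a * b - 7 * c * d) : ℤ) * s = 0 := by
    push_cast
    linear_combination (a + b * s - (c + d * s) * t) * h - (b ^ 2 - d ^ 2 * t ^ 2) * hs +
      (c ^ 2 + 2 * c * d * s + 3 * d ^ 2) * ht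
  have h2 : (a ^ 2 + 3 * b ^ 2 - 7 * c ^ 2 - 21 * d ^ 2 : ℤ) ^ 2 =
      ((3 : ℕ) : ℤ) * (2 * (a * b - 7 * c * d) : ℤ) ^ 2 := by
    set A : ℤ := a ^ 2 + 3 * b ^ 2 - 7 * c ^ 2 - 21 * d ^ 2
    set B : ℤ := 2 * (a * b - 7 * c * d)
    have : (A : ℝ) ^ 2 = 3 * (B : ℝ) ^ 2 := by linear_combination (A - B * s) * h1 + B ^ 2 * hs
    exact_mod_cast this
  obtain ⟨h3, h4⟩ := eq_zero_of_sq_eq_mul_sq (hns 1 (by norm_num) (by norm_num)) h2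
  have h5 : (a ^ 2 - 3 * b ^ 2 - (7 * c ^ 2 - 21 * d ^ 2)) *
      (a ^ 2 - 3 * b ^ 2 + (7 * c ^ 2 - 21 * d ^ 2)) = 0 := by
    have h6 : a * b = 7 * c * d := by omega
    linear_combination (a ^ 2 + 3 * b ^ 2 + (7 * c ^ 2 + 21 * d ^ 2)) * h3 -
      12 * (a * b + 7 * c * d) * h6
  rcases mul_eq_zero.mp h5 with h6 | h6
  · have e1 := eq_zero_of_sq_eq_mul_sq (m := 7) (x := a) (y := c) (hns 2 (by norm_num) (by norm_num))
      (by push_cast; linarith)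
    have e2 := eq_zero_of_sq_eq_mul_sq (m := 7) (x := b) (y := d) (hns 2 (by norm_num) (by norm_num))
      (by push_cast; linarith)
    exact ⟨e1.1, e2.1, e1.2, e2.2⟩
  · have e1 := eq_zero_of_sq_eq_mul_sq (m := 21) (x := a) (y := d) (hns 4 (by norm_num) (by norm_num))
      (by push_cast; linarith)
    have e2 := eq_zero_of_sq_eq_mul_sq (m := 21) (x := 3 * b) (y := c) (hns 4 (by norm_num) (by norm_num))
      (by push_cast; linarith)
    exact ⟨e1.1, by have := e2.1; omega, e2.2, e1.2⟩

lemma abs_det_le_of_forall_perm {ι : Type*} [Fintype ι] [DecidableEq ι] (M : Matrix ι ι ℝ) {C : ℝ}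
    (h : ∀ σ : Equiv.Perm ι, ∏ i, |M (σ i) i| ≤ C) : |M.det| ≤ (Fintype.card ι).factorial * C := by
  rw [Matrix.det_apply']
  refine (Finset.abs_sum_le_sum_abs _ _).trans ?_
  rw [← Fintype.card_perm, ← nsmul_eq_mul]
  refine Finset.sum_le_card_nsmul _ _ _ fun σ _ => ?_
  have : |((Equiv.Perm.sign σ : ℤ) : ℝ)| = 1 := by
    rcases Int.units_eq_one_or (Equiv.Perm.sign σ) with h | h <;> simp [h]
  rw [abs_mul, this, one_mul, Finset.abs_prod]
  exact h σ

/-- Liouville's inequality for determinants with entries in `ℤ[√3][√7]`. -/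
theorem one_le_abs_det_mul {ι : Type*} [Fintype ι] [DecidableEq ι] (z : ι → ι → ℤ) (u v : ι → ι → ℕ)
    {C : ℝ} (hC : ∀ σ : Equiv.Perm ι, ∏ i, |(z (σ i) i : ℝ)| * (2 + √3) ^ u (σ i) i *
      (8 + 3 * √7) ^ v (σ i) i ≤ C)
    (hdet : (Matrix.of fun i j => (z i j : ℝ) * (2 + √3) ^ u i j * (8 + 3 * √7) ^ v i j).det ≠ 0) :
    1 ≤ |(Matrix.of fun i j => (z i j : ℝ) * (2 + √3) ^ u i j * (8 + 3 * √7) ^ v i j).det| *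
      ((Fintype.card ι).factorial * C) ^ 3 := by
  obtain ⟨a, b, c, d, h⟩ := exists_int_eq_det z u v
  have hs : √(3 : ℝ) ^ 2 = 3 := Real.sq_sqrt (by norm_num)
  have ht : √(7 : ℝ) ^ 2 = 7 := Real.sq_sqrt (by norm_num)
  have hs' : (-√(3 : ℝ)) ^ 2 = 3 := by rw [neg_sq, hs]
  have ht' : (-√(7 : ℝ)) ^ 2 = 7 := by rw [neg_sq, ht]
  have hs0 := Real.sqrt_nonneg 3
  have ht0 := Real.sqrt_nonneg 7
  have hbound {s t : ℝ} (h1 : |2 + s| ≤ 2 + √3) (h2 : |8 + 3 * t| ≤ 8 + 3 * √7) :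
      |(Matrix.of fun i j => (z i j : ℝ) * (2 + s) ^ u i j * (8 + 3 * t) ^ v i j).det| ≤
        (Fintype.card ι).factorial * C := by
    refine abs_det_le_of_forall_perm _ fun σ => le_trans ?_ (hC σ)
    refine Finset.prod_le_prod (fun i _ => abs_nonneg _) fun i _ => ?_
    rw [Matrix.of_apply, abs_mul, abs_mul, abs_pow, abs_pow]
    gcongr
  have k1 : |2 + -√3| ≤ 2 + √3 := by rw [abs_le]; constructor <;> linarith
  have k2 : |8 + 3 * -√7| ≤ 8 + 3 * √7 := by rw [abs_le]; constructor <;> linarith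
  have k3 : |2 + √3| ≤ 2 + √3 := (abs_of_nonneg (by linarith)).le
  have k4 : |8 + 3 * √7| ≤ 8 + 3 * √7 := (abs_of_nonneg (by linarith)).le
  have b1 := hbound k3 k2
  have b2 := hbound k1 k4
  have b3 := hbound k1 k2
  rw [h _ _ hs ht] at hdet ⊢
  rw [h _ _ hs ht'] at b1
  rw [h _ _ hs' ht] at b2
  rw [h _ _ hs' ht'] at b3
  have hz (s t : ℝ) (hs : s ^ 2 = 3) (ht : t ^ 2 = 7) : (a + b * s + (c + d * s) * t : ℝ) ≠ 0 := by
    intro h0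
    obtain ⟨rfl, rfl, rfl, rfl⟩ := biquadratic_ne_zero hs ht h0
    simp at hdet
  have hprod : (a + b * √3 + (c + d * √3) * √7 : ℝ) * ((a + b * √3 + (c + d * √3) * -√7) *
      (a + b * -√3 + (c + d * -√3) * √7) * (a + b * -√3 + (c + d * -√3) * -√7)) =
      (((a ^ 2 + 3 * b ^ 2 - 7 * c ^ 2 - 21 * d ^ 2) ^ 2 - 3 * (2 * (a * b - 7 * c * d)) ^ 2 : ℤ) : ℝ) := by
    have e1 (s : ℝ) (hs : s ^ 2 = 3) : (a + b * s + (c + d * s) * √7 : ℝ) *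
        (a + b * s + (c + d * s) * -√7) =
        (a ^ 2 + 3 * b ^ 2 - 7 * c ^ 2 - 21 * d ^ 2) + (2 * (a * b - 7 * c * d)) * s := by
      linear_combination (b ^ 2 - d ^ 2 * √7 ^ 2) * hs - (c ^ 2 + 2 * c * d * s + 3 * d ^ 2) * ht
    calc _ = ((a + b * √3 + (c + d * √3) * √7 : ℝ) * (a + b * √3 + (c + d * √3) * -√7)) *
          ((a + b * -√3 + (c + d * -√3) * √7) * (a + b * -√3 + (c + d * -√3) * -√7)) := by ring
      _ = _ := by
        rw [e1 _ hs, e1 _ hs']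
        push_cast
        linear_combination (-(2 * (a * b - 7 * c * d)) ^ 2 : ℝ) * hs
  have hne := mul_ne_zero (hz _ _ hs ht) (mul_ne_zero (mul_ne_zero (hz _ _ hs ht') (hz _ _ hs' ht))
    (hz _ _ hs' ht'))
  have habs := congrArg abs hprod
  rw [hprod, Int.cast_ne_zero] at hne
  have h1 := Int.one_le_abs hne
  rw [abs_mul, ← Int.cast_abs] at habs
  have h2 : (1 : ℝ) ≤ ((|(a ^ 2 + 3 * b ^ 2 - 7 * c ^ 2 - 21 * d ^ 2) ^ 2 -
      3 * (2 * (a * b - 7 * c * d)) ^ 2| : ℤ) : ℝ) := by exact_mod_cast h1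
  rw [← habs] at h2
  refine h2.trans (mul_le_mul_of_nonneg_left ?_ (abs_nonneg _))
  have hC0 := (abs_nonneg _).trans b1
  rw [abs_mul, abs_mul, pow_succ, pow_two]
  exact mul_le_mul (mul_le_mul b1 b2 (abs_nonneg _) hC0) b3 (abs_nonneg _) (mul_nonneg hC0 hC0)

end NonunitSquares

namespace NonunitSquares

open Polynomial

section

variable {ι : Type*} [Fintype ι] [DecidableEq ι]

lemma natDegree_det_le_card_mul {M : Matrix ι ι ℝ[X]} {d : ℕ} (h : ∀ i j, (M i j).natDegree ≤ d) :
    M.det.natDegree ≤ Fintype.card ι * d := by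
  rw [Matrix.det_apply']
  refine natDegree_sum_le_of_forall_le _ _ fun σ _ => ?_
  refine (natDegree_mul_le).trans ?_
  rw [natDegree_intCast, zero_add]
  refine (natDegree_prod_le _ _).trans ?_
  simpa using Finset.sum_le_card_nsmul Finset.univ (fun i => (M (σ i) i).natDegree) d fun i _ => h _ _

lemma coeff_det_card_mul {M : Matrix ι ι ℝ[X]} {d : ℕ} (h : ∀ i j, (M i j).natDegree ≤ d) :
    M.det.coeff (Fintype.card ι * d) = (Matrix.of fun i j => (M i j).coeff d).det := by
  rw [Matrix.det_apply', Matrix.det_apply', finsetSum_coeff]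
  refine Finset.sum_congr rfl fun σ _ => ?_
  rw [coeff_intCast_mul]
  congr 1
  exact coeff_prod_of_natDegree_le Finset.univ _ d fun i _ => h _ _

end

/-- An exponential polynomial in two variables along a line does not vanish on a large grid. -/
lemma exists_sum_eval_ne_zero {L d R : ℕ} {x y α β : ℝ} (hα : 1 < α) (hβ : 0 < β)
    (hinj : Function.Injective fun q : Fin R × Fin R => (q.1 : ℕ) * x + (q.2 : ℕ) * y)
    (hR : L * d < R ^ 2) {p : Fin L → ℝ[X]} (hd : ∀ l, (p l).natDegree ≤ d) (hp : ∃ l, p l ≠ 0) :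
    ∃ r s : ℕ, r < L + R ∧ s < R ∧
      ∑ l : Fin L, (p l).eval (r * x + s * y) * α ^ ((l : ℕ) * r) * β ^ ((l : ℕ) * s) ≠ 0 := by
  classical
  by_contra! hzero
  set I : Finset (Fin L) := Finset.univ.filter fun l => p l ≠ 0 with hI
  have hIne : I.Nonempty := by
    obtain ⟨l, hl⟩ := hp
    exact ⟨l, by simpa [hI] using hl⟩
  set m := I.card with hm
  have hmL : m ≤ L := (Finset.card_le_univ I).trans_eq (Fintype.card_fin L)
  let e : Fin m ≃ I := I.equivFin.symm
  have hpe (i : Fin m) : p (e i) ≠ 0 :=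
    (Finset.mem_filter.mp (e i).2).2
  let P : Matrix (Fin m) (Fin m) ℝ[X] := Matrix.of fun ρ i =>
    taylor ((ρ : ℕ) * x) (p (e i)) * C (α ^ (((e i : Fin L) : ℕ) * (ρ : ℕ)))
  let Q : Matrix (Fin m) (Fin m) ℝ[X] := Matrix.of fun ρ i =>
    X ^ (d - (p (e i)).natDegree) * P ρ i
  have hP (ρ i) : P ρ i = taylor ((ρ : ℕ) * x) (p (e i)) * C (α ^ (((e i : Fin L) : ℕ) * (ρ : ℕ))) := rfl
  have hQ (ρ i) : Q ρ i = X ^ (d - (p (e i)).natDegree) * P ρ i := rfl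
  have hdetQ : Q.det = (∏ i, X ^ (d - (p (e i)).natDegree)) * P.det := Matrix.det_mul_row _ _
  have hαne (k : ℕ) : α ^ k ≠ 0 := by positivity
  have hPdeg (ρ i) : (P ρ i).natDegree = (p (e i)).natDegree := by
    rw [hP, natDegree_mul_C (hαne _), natDegree_taylor]
  have hPne (ρ i) : P ρ i ≠ 0 := by
    rw [hP]
    refine mul_ne_zero ?_ (C_ne_zero.mpr (hαne _))
    intro h
    exact hpe i (taylor_injective _ (by rw [h, map_zero]))
  have hQdeg (ρ i) : (Q ρ i).natDegree ≤ d := by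
    rw [hQ, natDegree_X_pow_mul _ (hPne ρ i), hPdeg]
    have := hd (e i)
    omega
  have hQcoeff (ρ i) : (Q ρ i).coeff d = (p (e i)).leadingCoeff * (α ^ ((e i : Fin L) : ℕ)) ^ (ρ : ℕ) := by
    have h1 : d = (p (e i)).natDegree + (d - (p (e i)).natDegree) := by
      have := hd (e i)
      omega
    rw [hQ]
    conv_lhs => rw [h1, Nat.add_sub_cancel_left]
    rw [coeff_X_pow_mul, hP, coeff_mul_C, coeff_taylor_natDegree, pow_mul]
  have hQ0 : Q.det ≠ 0 := by
    intro h0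
    have h1 := coeff_det_card_mul hQdeg
    rw [h0, coeff_zero] at h1
    have h2 : (Matrix.of fun i j => (Q i j).coeff d) = Matrix.of fun ρ i =>
        (p (e i)).leadingCoeff * (Matrix.vandermonde fun i => α ^ ((e i : Fin L) : ℕ)).transpose ρ i := by
      ext ρ i
      rw [Matrix.of_apply, hQcoeff]
      rfl
    rw [h2, Matrix.det_mul_row, Matrix.det_transpose] at h1
    refine mul_ne_zero ?_ ?_ h1.symm
    · exact Finset.prod_ne_zero_iff.mpr fun i _ => leadingCoeff_ne_zero.mpr (hpe i)
    · rw [Matrix.det_vandermonde_ne_zero_iff]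
      intro i j hij
      have := (pow_right_injective₀ (by linarith) hα.ne').eq_iff.mp hij
      exact e.injective (Subtype.ext (Fin.ext this))
  refine hQ0 (eq_zero_of_natDegree_lt_card_of_eval_eq_zero _ hinj (fun q => ?_)
    ((natDegree_det_le_card_mul hQdeg).trans_lt ?_))
  · rw [hdetQ, eval_mul]
    refine mul_eq_zero_of_right _ ?_
    set z := (q.1 : ℕ) * x + (q.2 : ℕ) * y
    change evalRingHom z P.det = 0
    rw [RingHom.map_det]
    refine Matrix.exists_mulVec_eq_zero_iff.mp ⟨fun i =>
      α ^ (((e i : Fin L) : ℕ) * (q.1 : ℕ)) * β ^ (((e i : Fin L) : ℕ) * (q.2 : ℕ)), ?_, ?_⟩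
    · intro h
      have := congrFun h ⟨0, hIne.card_pos⟩
      exact (by positivity : (0 : ℝ) < _).ne' this
    · ext ρ
      have hz := hzero (ρ + q.1) q.2 (by have := ρ.2; have := q.1.2; omega) q.2.2
      rw [← Finset.sum_subset (Finset.subset_univ I) fun l _ hl => ?_, ← Finset.sum_coe_sort,
        ← e.sum_comp] at hz
      · rw [Pi.zero_apply, ← hz, Matrix.mulVec, dotProduct]
        refine Finset.sum_congr rfl fun i _ => ?_
        simp only [RingHom.mapMatrix_apply, Matrix.map_apply, coe_evalRingHom, hP,
          eval_mul, eval_C, taylor_eval]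
        rw [mul_add, pow_add]
        have : z + (ρ : ℕ) * x = ((ρ + q.1 : ℕ) : ℝ) * x + (q.2 : ℕ) * y := by
          push_cast
          ring
        rw [this]
        ring
      · have : p l = 0 := by simpa [hI] using hl
        simp [this]
  · rw [Fintype.card_prod, Fintype.card_fin, Fintype.card_fin]
    nlinarith [Nat.mul_le_mul_right d hmL]

/-- A matrix with linearly independent columns has an invertible square submatrix. -/
lemma exists_det_submatrix_ne_zero {m n : Type*} [Fintype m] [Fintype n] [DecidableEq n]
    (A : Matrix m n ℝ) (h : ∀ v, A.mulVec v = 0 → v = 0) :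
    ∃ f : n → m, (Matrix.of fun i j => A (f i) j).det ≠ 0 := by
  obtain ⟨κ, a, ha, hspan, hli⟩ := exists_linearIndependent' ℝ A.row
  have : Fintype κ := Fintype.ofInjective a ha
  have hrank : A.rank = Fintype.card n := by
    have h1 : Function.Injective A.mulVecLin := by
      rw [injective_iff_map_eq_zero]
      exact h
    rw [Matrix.rank, LinearMap.finrank_range_of_inj h1, Module.finrank_fintype_fun_eq_card]
  have hcard : Fintype.card n = Fintype.card κ := by
    rw [← hrank, Matrix.rank_eq_finrank_span_row, ← hspan, finrank_span_eq_card hli]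
  let e : n ≃ κ := Fintype.equivOfCardEq hcard
  refine ⟨fun i => a (e i), ?_⟩
  have h2 : LinearIndependent ℝ (Matrix.of fun i j => A (a (e i)) j).row := hli.comp e e.injective
  have := Matrix.linearIndependent_rows_iff_isUnit.mp h2
  rw [Matrix.isUnit_iff_isUnit_det] at this
  exact this.ne_zero

end NonunitSquares

namespace NonunitSquares

open Filter Topology

lemma sum_range_card_le_sum (s : Finset ℕ) : ∑ i ∈ Finset.range s.card, i ≤ ∑ i ∈ s, i := by
  induction s using Finset.induction_on_max with
  | empty => simp
  | insert a s h ih =>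
    have ha : a ∉ s := fun h' => (h a h').false
    rw [Finset.card_insert_of_notMem ha, Finset.sum_insert ha, Finset.sum_range_succ]
    have : s.card ≤ a := by
      simpa using Finset.card_le_card (fun x hx => Finset.mem_range.mpr (h x hx) : s ⊆ Finset.range a)
    omega

lemma card_mul_card_sub_one_div_two_le_sum {ι : Type*} [Fintype ι] {ν : ι → ℕ} (h : Function.Injective ν) :
    Fintype.card ι * (Fintype.card ι - 1) / 2 ≤ ∑ i, ν i := by
  have h1 := sum_range_card_le_sum (Finset.univ.image ν)
  rw [Finset.card_image_of_injective _ h, Finset.card_univ, Finset.sum_range_id,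
    Finset.sum_image h.injOn] at h1
  exact h1

section

variable {ι : Type*} [Fintype ι] [DecidableEq ι]

lemma pow_mul_abs_det_le_of_sum {a : ι → ℕ → ℝ} {x : ι → ℝ} {X ρ : ℝ} (hx : ∀ i, |x i| ≤ X) (hρ : 1 ≤ ρ)
    (hX : 0 ≤ X) (T : ℕ) :
    ρ ^ (Fintype.card ι * (Fintype.card ι - 1) / 2) *
      |(Matrix.of fun i j => ∑ n ∈ Finset.range T, a j n * x i ^ n).det| ≤
      (Fintype.card ι).factorial * ∏ j, ∑ n ∈ Finset.range T, |a j n| * (ρ * X) ^ n := by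
  have h1 : (Matrix.of fun i j => ∑ n ∈ Finset.range T, a j n * x i ^ n).det =
      ∑ ν ∈ Fintype.piFinset fun _ : ι => Finset.range T,
        (∏ j, a j (ν j)) * (Matrix.of fun i j => x i ^ ν j).det := by
    rw [← Matrix.det_transpose]
    have h2 := (Matrix.detRowAlternating (n := ι) (R := ℝ)).toMultilinearMap.map_sum_finset
      (fun j n => a j n • fun i => x i ^ n) (fun _ => Finset.range T)
    have h3 : (Matrix.of fun i j => ∑ n ∈ Finset.range T, a j n * x i ^ n).transpose =
        fun j => ∑ n ∈ Finset.range T, a j n • fun i => x i ^ n := by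
      ext j i
      simp
    rw [h3]
    refine h2.trans (Finset.sum_congr rfl fun ν _ => ?_)
    rw [MultilinearMap.map_smul_univ, smul_eq_mul, ← Matrix.det_transpose]
    rfl
  rw [h1, Finset.prod_univ_sum, Finset.mul_sum]
  refine (mul_le_mul_of_nonneg_left (Finset.abs_sum_le_sum_abs _ _) (by positivity)).trans ?_
  rw [Finset.mul_sum]
  refine Finset.sum_le_sum fun ν _ => ?_
  rw [abs_mul, Finset.abs_prod, Finset.prod_mul_distrib, ← mul_assoc, mul_comm (ρ ^ _), mul_assoc,
    mul_left_comm _ (∏ j, |a j (ν j)|)]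
  refine mul_le_mul_of_nonneg_left ?_ (Finset.prod_nonneg fun _ _ => abs_nonneg _)
  by_cases hν : Function.Injective ν
  · have h2 : |(Matrix.of fun i j => x i ^ ν j).det| ≤ (Fintype.card ι).factorial * ∏ j, X ^ ν j := by
      refine abs_det_le_of_forall_perm _ fun σ => ?_
      refine Finset.prod_le_prod (fun _ _ => abs_nonneg _) fun i _ => ?_
      rw [Matrix.of_apply, abs_pow]
      exact pow_le_pow_left₀ (abs_nonneg _) (hx _) _
    have h3 : ∏ j, (ρ * X) ^ ν j = ρ ^ (∑ j, ν j) * ∏ j, X ^ ν j := by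
      rw [← Finset.prod_pow_eq_pow_sum, ← Finset.prod_mul_distrib]
      exact Finset.prod_congr rfl fun _ _ => mul_pow _ _ _
    rw [h3, mul_left_comm]
    exact mul_le_mul (pow_le_pow_right₀ hρ (card_mul_card_sub_one_div_two_le_sum hν)) h2
      (abs_nonneg _) (by positivity)
  · have h2 : (Matrix.of fun i j => x i ^ ν j).det = 0 := by
      rw [Function.Injective] at hν
      push Not at hν
      obtain ⟨j, k, hjk, hne⟩ := hν
      refine Matrix.det_zero_of_column_eq hne fun i => ?_
      simp [hjk]
    rw [h2, abs_zero, mul_zero]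
    have : 0 ≤ ρ * X := by positivity
    positivity

lemma pow_mul_abs_det_le_of_hasSum {a : ι → ℕ → ℝ} {x : ι → ℝ} {X ρ : ℝ} {f g : ι → ℝ → ℝ}
    (hx : ∀ i, |x i| ≤ X) (hρ : 1 ≤ ρ) (hX : 0 ≤ X)
    (hf : ∀ j y, HasSum (fun n => a j n * y ^ n) (f j y))
    (hg : ∀ j y, 0 ≤ y → HasSum (fun n => |a j n| * y ^ n) (g j y)) :
    ρ ^ (Fintype.card ι * (Fintype.card ι - 1) / 2) * |(Matrix.of fun i j => f j (x i)).det| ≤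
      (Fintype.card ι).factorial * ∏ j, g j (ρ * X) := by
  have h1 : Tendsto (fun T => (Matrix.of fun i j => ∑ n ∈ Finset.range T, a j n * x i ^ n).det) atTop
      (𝓝 (Matrix.of fun i j => f j (x i)).det) := by
    have hc : Continuous fun M : ι → ι → ℝ => (Matrix.of M).det := Continuous.matrix_det continuous_id
    refine (hc.tendsto (fun i j => f j (x i))).comp ?_
    rw [tendsto_pi_nhds]
    intro i
    rw [tendsto_pi_nhds]
    intro j
    exact (hf j (x i)).tendsto_sum_nat
  have h2 : Tendsto (fun T => ∏ j, ∑ n ∈ Finset.range T, |a j n| * (ρ * X) ^ n) atTop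
      (𝓝 (∏ j, g j (ρ * X))) :=
    tendsto_finsetProd _ fun j _ => (hg j _ (by positivity)).tendsto_sum_nat
  exact le_of_tendsto_of_tendsto' (h1.abs.const_mul _) (h2.const_mul _)
    fun T => pow_mul_abs_det_le_of_sum hx hρ hX T

end

lemma hasSum_pow_mul_exp (c : ℝ) (k : ℕ) (y : ℝ) :
    HasSum (fun n => (if k ≤ n then c ^ (n - k) / (n - k).factorial else 0) * y ^ n)
      (y ^ k * Real.exp (c * y)) := by
  rw [← hasSum_nat_add_iff' k, Finset.sum_eq_zero, sub_zero]
  · have h1 := (NormedSpace.expSeries_div_hasSum_exp (c * y)).mul_left (y ^ k)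
    rw [← Real.exp_eq_exp_ℝ] at h1
    refine h1.congr_fun ?_
    intro n
    simp
    ring
  · intro n hn
    rw [if_neg (by simpa using hn), zero_mul]

/-- An interpolation determinant of the functions `y ↦ y ^ k * exp (c * y)` is small. -/
theorem pow_mul_abs_det_pow_mul_exp_le {ι : Type*} [Fintype ι] [DecidableEq ι] {k : ι → ℕ} {c : ι → ℝ}
    {x : ι → ℝ} {X ρ : ℝ} (hx : ∀ i, |x i| ≤ X) (hρ : 1 ≤ ρ) (hX : 0 ≤ X) (hc : ∀ j, 0 ≤ c j) :
    ρ ^ (Fintype.card ι * (Fintype.card ι - 1) / 2) *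
      |(Matrix.of fun i j => x i ^ k j * Real.exp (c j * x i)).det| ≤
      (Fintype.card ι).factorial * ∏ j, (ρ * X) ^ k j * Real.exp (c j * (ρ * X)) := by
  refine pow_mul_abs_det_le_of_hasSum hx hρ hX (f := fun j y => y ^ k j * Real.exp (c j * y))
    (g := fun j y => y ^ k j * Real.exp (c j * y))
    (fun j y => hasSum_pow_mul_exp (c j) (k j) y) fun j y _ => ?_
  convert hasSum_pow_mul_exp (c j) (k j) y using 3 with n
  refine abs_of_nonneg ?_
  have := hc j
  split_ifs <;> positivity

end NonunitSquares

namespace NonunitSquares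

open Polynomial

lemma abs_det_sub_det_le {ι : Type*} [Fintype ι] [DecidableEq ι] {A B : Matrix ι ι ℝ} {t : ι → ι → ℝ}
    {C τ : ℝ} (hB : ∀ i j, B i j = A i j * Real.exp (t i j)) (hA : ∀ i j, |A i j| ≤ C)
    (ht : ∀ i j, |t i j| ≤ τ) (hτ : Fintype.card ι * τ ≤ 1) :
    |A.det - B.det| ≤ (Fintype.card ι).factorial * (C ^ Fintype.card ι * (2 * (Fintype.card ι * τ))) := by
  rw [Matrix.det_apply', Matrix.det_apply', ← Finset.sum_sub_distrib]
  refine (Finset.abs_sum_le_sum_abs _ _).trans ?_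
  rw [← Fintype.card_perm, ← nsmul_eq_mul]
  refine Finset.sum_le_card_nsmul _ _ _ fun σ _ => ?_
  have h1 : |((Equiv.Perm.sign σ : ℤ) : ℝ)| = 1 := by
    rcases Int.units_eq_one_or (Equiv.Perm.sign σ) with h | h <;> simp [h]
  have h2 : ∏ i, B (σ i) i = (∏ i, A (σ i) i) * Real.exp (∑ i, t (σ i) i) := by
    rw [Real.exp_sum, ← Finset.prod_mul_distrib]
    exact Finset.prod_congr rfl fun i _ => hB _ _
  have h3 : |∑ i, t (σ i) i| ≤ Fintype.card ι * τ := by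
    refine (Finset.abs_sum_le_sum_abs _ _).trans ?_
    simpa using Finset.sum_le_card_nsmul Finset.univ (fun i => |t (σ i) i|) τ fun i _ => ht _ _
  have h4 : |∏ i, A (σ i) i| ≤ C ^ Fintype.card ι := by
    rw [Finset.abs_prod]
    simpa using Finset.prod_le_prod (s := Finset.univ) (fun i _ => abs_nonneg (A (σ i) i)) fun i _ => hA (σ i) i
  have h5 := Real.abs_exp_sub_one_le (h3.trans hτ)
  rw [h2, ← mul_sub, abs_mul, h1, one_mul, ← mul_one_sub, abs_mul, abs_sub_comm 1]
  exact mul_le_mul h4 (h5.trans (by linarith)) (abs_nonneg _) ((abs_nonneg _).trans h4)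

lemma exists_interpolation_det_ne_zero {K L R : ℕ} {x y α β : ℝ} (hα : 1 < α) (hβ : 0 < β)
    (hinj : Function.Injective fun q : Fin R × Fin R => (q.1 : ℕ) * x + (q.2 : ℕ) * y)
    (hR : L * K < R ^ 2) :
    ∃ r s : Fin K × Fin L → ℕ, (∀ i, r i < L + R) ∧ (∀ i, s i < L + R) ∧
      (Matrix.of fun i j : Fin K × Fin L => (r i * x + s i * y) ^ (j.1 : ℕ) *
        α ^ ((j.2 : ℕ) * r i) * β ^ ((j.2 : ℕ) * s i)).det ≠ 0 := by
  have key := exists_det_submatrix_ne_zero (m := Fin (L + R) × Fin (L + R))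
    (Matrix.of fun i (j : Fin K × Fin L) => (((i.1 : ℕ) * x + (i.2 : ℕ) * y) ^ (j.1 : ℕ) *
        α ^ ((j.2 : ℕ) * (i.1 : ℕ)) * β ^ ((j.2 : ℕ) * (i.2 : ℕ)))) (fun v hv => ?_)
  · obtain ⟨f, hf⟩ := key
    exact ⟨fun i => (f i).1, fun i => (f i).2, fun i => (f i).1.2, fun i => (f i).2.2, hf⟩
  · by_contra hne
    let p : Fin L → ℝ[X] := fun l => ∑ k : Fin K, C (v (k, l)) * X ^ (k : ℕ)
    have hcoeff (k : Fin K) (l : Fin L) : (p l).coeff k = v (k, l) := by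
      simp only [p, finsetSum_coeff, coeff_C_mul, coeff_X_pow]
      rw [Finset.sum_eq_single k]
      · simp
      · intro k' _ hk'
        rw [if_neg fun h => hk' (Fin.ext h.symm), mul_zero]
      · simp
    obtain ⟨r, s, hr, hs, h⟩ := exists_sum_eval_ne_zero (d := K) hα hβ hinj hR (p := p)
      (fun l => natDegree_sum_le_of_forall_le _ _ fun k _ =>
        (natDegree_C_mul_X_pow_le _ _).trans k.2.le) (by
        by_contra! h0
        refine hne (funext fun q => ?_)
        rw [← hcoeff, h0, coeff_zero, Pi.zero_apply])
    apply h
    have h1 := congrFun hv (⟨r, hr⟩, ⟨s, by omega⟩)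
    rw [Pi.zero_apply, Matrix.mulVec, dotProduct, Fintype.sum_prod_type_right] at h1
    rw [← h1]
    refine Finset.sum_congr rfl fun l _ => ?_
    simp only [p, eval_finsetSum, eval_mul, eval_C, eval_pow, eval_X, Finset.sum_mul, Matrix.of_apply]
    refine Finset.sum_congr rfl fun k _ => ?_
    ring

end NonunitSquares

namespace NonunitSquares

open Real

lemma log_three_add_log_seven_le : log (2 + √3) + log (8 + 3 * √7) ≤ 5 - 4 / 5 := by
  have h3 : √3 ≤ 2 := Real.sqrt_le_iff.2 ⟨by norm_num, by norm_num⟩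
  have h7 : √7 ≤ 8 / 3 := Real.sqrt_le_iff.2 ⟨by norm_num, by norm_num⟩
  have h1 : log (2 + √3) ≤ log (2 ^ 2) := log_le_log (by positivity) (by linarith)
  have h2 : log (8 + 3 * √7) ≤ log (2 ^ 4) := log_le_log (by positivity) (by linarith)
  rw [log_pow] at h1 h2
  push_cast at h1 h2
  linarith [log_two_lt_d9]

lemma injective_mul_add_mul {S b₁ b₂ : ℕ} (hb : b₁.Coprime b₂) (hb₁ : 0 < b₁) (hS : S ≤ b₁) :
    Function.Injective fun q : Fin S × Fin S => (q.1 : ℕ) * (b₂ : ℝ) + (q.2 : ℕ) * (b₁ : ℝ) := by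
  rintro ⟨r, s⟩ ⟨r', s'⟩ h
  have h1 : (r : ℕ) * b₂ + s * b₁ = r' * b₂ + s' * b₁ := by
    simp only at h
    exact_mod_cast h
  have h2 : (r : ℕ) * b₂ ≡ r' * b₂ [MOD b₁] := by
    have h3 : ((r : ℕ) * b₂ + s * b₁) % b₁ = (r' * b₂ + s' * b₁) % b₁ := by rw [h1]
    rwa [Nat.add_mul_mod_self_right, Nat.add_mul_mod_self_right] at h3
  have h3 : (r : ℕ) = r' :=
    (Nat.ModEq.cancel_right_of_coprime hb h2).eq_of_lt_of_lt (r.2.trans_le hS) (r'.2.trans_le hS)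
  rw [h3] at h1
  have h4 : (s : ℕ) = s' := Nat.eq_of_mul_eq_mul_right hb₁ (Nat.add_left_cancel h1)
  exact Prod.ext (Fin.ext h3) (Fin.ext h4)

lemma one_le_interpolation_bound {K L S b₁ b₂ : ℕ} {w Λ : ℝ} (hK : 0 < K) (hL : 0 < L)
    (hb : b₁.Coprime b₂) (hb₁ : 0 < b₁) (hb₂ : 0 < b₂) (hS : S ≤ b₁) (hS2 : L * K < S ^ 2)
    (hw : (L + S : ℝ) * (b₁ + b₂) ≤ exp w)
    (hΛ : Λ = b₁ * log (2 + √3) - b₂ * log (8 + 3 * √7))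
    (hΛ1 : (K * L : ℕ) * (L * (L + S) * |Λ|) ≤ 1) :
    1 ≤ ((K * L).factorial : ℝ) ^ 4 * exp (K * w + 5 * L * (L + S)) ^ (3 * (K * L)) *
      (exp (K * (1 + w) + 15 * L * (L + S)) ^ (K * L) * exp (-(K * L * (K * L - 1) / 2 : ℕ)) +
        exp (K * w + 5 * L * (L + S)) ^ (K * L) * (2 * ((K * L : ℕ) * (L * (L + S) * |Λ|)))) := by
  obtain ⟨r, s, hr, hs, hdet⟩ := exists_interpolation_det_ne_zero (K := K) (L := L) (R := S)
    (x := b₂) (y := b₁) (α := 2 + √3) (β := 8 + 3 * √7) (by linarith [Real.sqrt_nonneg 3])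
    (by positivity) (injective_mul_add_mul hb hb₁ hS) hS2
  set ℓ₁ := log (2 + √3) with hℓ₁
  set ℓ₂ := log (8 + 3 * √7) with hℓ₂
  have hℓ : ℓ₁ + ℓ₂ ≤ 5 - 4 / 5 := log_three_add_log_seven_le
  have h1 : 1 ≤ ℓ₁ := one_le_log_three
  have h2 : 2 ≤ ℓ₂ := two_le_log_seven
  have hcard : Fintype.card (Fin K × Fin L) = K * L := by simp
  have hL' : (1 : ℝ) ≤ L := by exact_mod_cast hL
  have hb₁' : (1 : ℝ) ≤ b₁ := by exact_mod_cast hb₁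
  have hb₂' : (1 : ℝ) ≤ b₂ := by exact_mod_cast hb₂
  have hr' (i) : (r i : ℝ) ≤ L + S := by exact_mod_cast (hr i).le
  have hs' (i) : (s i : ℝ) ≤ L + S := by exact_mod_cast (hs i).le
  have hk' (j : Fin K × Fin L) : (j.1 : ℕ) ≤ K := j.1.2.le
  have hl' (j : Fin K × Fin L) : ((j.2 : ℕ) : ℝ) ≤ L := by exact_mod_cast j.2.2.le
  set x : Fin K × Fin L → ℝ := fun i => r i * b₂ + s i * b₁ with hx
  have hx0 (i) : 0 ≤ x i := by positivity
  have hxX (i) : x i ≤ (L + S : ℝ) * (b₁ + b₂) := by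
    have := mul_le_mul_of_nonneg_right (hr' i) (zero_le_one.trans hb₂')
    have := mul_le_mul_of_nonneg_right (hs' i) (zero_le_one.trans hb₁')
    simp only [hx]
    linarith
  have hX1 : (1 : ℝ) ≤ (L + S : ℝ) * (b₁ + b₂) :=
    one_le_mul_of_one_le_of_one_le (by linarith [(Nat.cast_nonneg S : (0 : ℝ) ≤ S)]) (by linarith)
  have hw0 : 0 ≤ w := by
    by_contra! h
    linarith [Real.exp_le_exp.2 h.le, Real.exp_zero, (Real.exp_lt_exp.2 h)]
  have hpow {k : ℕ} (hk : k ≤ K) {y : ℝ} (hy : 0 ≤ y) (hyw : y ≤ exp w) :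
      y ^ k ≤ exp (K * w) := by
    rw [Real.exp_nat_mul]
    exact (pow_le_pow_left₀ hy hyw k).trans (pow_le_pow_right₀ (Real.one_le_exp hw0) hk)
  have hαβ (i j) : (2 + √3) ^ ((j : Fin K × Fin L).2.1 * r i) * (8 + 3 * √7) ^ (j.2.1 * s i) =
      exp ((j.2 : ℕ) * (r i * ℓ₁ + s i * ℓ₂)) := by
    have h3 : (2 + √3) = exp ℓ₁ := (Real.exp_log (by positivity)).symm
    have h7 : (8 + 3 * √7) = exp ℓ₂ := (Real.exp_log (by positivity)).symm
    rw [h3, h7, ← Real.exp_nat_mul, ← Real.exp_nat_mul, ← Real.exp_add]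
    push_cast
    ring_nf
  have hentry (i j) : x i ^ (j : Fin K × Fin L).1.1 * exp ((j.2 : ℕ) * (r i * ℓ₁ + s i * ℓ₂)) ≤
      exp (K * w + 5 * L * (L + S)) := by
    rw [Real.exp_add]
    refine mul_le_mul (hpow (hk' j) (hx0 i) ((hxX i).trans hw)) (Real.exp_le_exp.2 ?_)
      (Real.exp_pos _).le (Real.exp_pos _).le
    have h3 : r i * ℓ₁ + s i * ℓ₂ ≤ (L + S) * 5 := by
      have := mul_le_mul_of_nonneg_right (hr' i) (zero_le_one.trans h1)
      have := mul_le_mul_of_nonneg_right (hs' i) (zero_le_two.trans h2)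
      have : (0 : ℝ) ≤ L + S := by positivity
      nlinarith
    calc ((j.2 : ℕ) : ℝ) * (r i * ℓ₁ + s i * ℓ₂) ≤ L * ((L + S) * 5) :=
          mul_le_mul (hl' j) h3 (by positivity) (by positivity)
      _ = _ := by ring
  set A : Matrix (Fin K × Fin L) (Fin K × Fin L) ℝ := Matrix.of fun i j =>
    x i ^ j.1.1 * exp ((j.2 : ℕ) * (r i * ℓ₁ + s i * ℓ₂)) with hA
  set c : Fin K × Fin L → ℝ := fun j => (j.2 : ℕ) * (ℓ₁ / b₂) with hc
  set B : Matrix (Fin K × Fin L) (Fin K × Fin L) ℝ := Matrix.of fun i j =>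
    x i ^ j.1.1 * exp (c j * x i) with hB
  have hAeq : (Matrix.of fun i j : Fin K × Fin L => (r i * (b₂ : ℝ) + s i * b₁) ^ (j.1 : ℕ) *
        (2 + √3) ^ ((j.2 : ℕ) * r i) * (8 + 3 * √7) ^ ((j.2 : ℕ) * s i)) = A := by
    ext i j
    simp only [Matrix.of_apply, hA, mul_assoc, hαβ, hx]
  rw [hAeq] at hdet
  have hE : 0 < exp (K * w + 5 * L * (L + S)) := Real.exp_pos _
  have hnorm : 1 ≤ |A.det| *
      ((K * L).factorial * exp (K * w + 5 * L * (L + S)) ^ (K * L)) ^ 3 := by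
    have h3 := one_le_abs_det_mul (ι := Fin K × Fin L)
      (fun i j => ((r i * b₂ + s i * b₁ : ℕ) : ℤ) ^ j.1.1)
      (fun i j => j.2.1 * r i) (fun i j => j.2.1 * s i)
      (C := exp (K * w + 5 * L * (L + S)) ^ (K * L)) (fun σ => ?_)
    · push_cast at h3
      rw [hAeq, hcard] at h3
      exact h3 hdet
    · rw [← hcard]
      refine (Finset.prod_le_prod (fun i _ => by positivity) fun i _ => ?_).trans
        (Finset.prod_const _).le
      rw [mul_assoc, hαβ]
      have h3 : |(((((r (σ i) * b₂ + s (σ i) * b₁ : ℕ) : ℤ) ^ i.1.1 : ℤ)) : ℝ)| = x (σ i) ^ i.1.1 := by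
        push_cast
        exact abs_of_nonneg (pow_nonneg (hx0 _) _)
      rw [h3]
      exact hentry (σ i) i
  have hdiff := abs_det_sub_det_le (A := A) (B := B) (t := fun i j => (j.2 : ℕ) * s i * (Λ / b₂))
    (C := exp (K * w + 5 * L * (L + S))) (τ := L * (L + S) * |Λ|) ?_ ?_ ?_ (by rwa [hcard])
  rotate_left
  · intro i j
    simp only [hA, hB, hc, hx, Matrix.of_apply, mul_assoc, ← Real.exp_add]
    rw [hΛ]
    congr 2
    field_simp
    ring
  · intro i j
    have h3 : 0 ≤ A i j := by
      simp only [hA, Matrix.of_apply]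
      exact mul_nonneg (pow_nonneg (hx0 i) _) (Real.exp_pos _).le
    rw [abs_of_nonneg h3]
    exact hentry i j
  · intro i j
    rw [abs_mul, abs_of_nonneg (by positivity : (0 : ℝ) ≤ (j.2 : ℕ) * s i), abs_div,
      Nat.abs_cast]
    exact mul_le_mul (mul_le_mul (hl' j) (hs' i) (by positivity) (by positivity))
      (div_le_self (abs_nonneg _) hb₂') (by positivity) (by positivity)
  rw [hcard] at hdiff
  have hΛ2 : |Λ| ≤ 1 := by
    refine le_trans ?_ hΛ1
    rw [← mul_assoc]
    refine le_mul_of_one_le_left (abs_nonneg _) ?_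
    have h3 : (1 : ℝ) ≤ (K * L : ℕ) := by exact_mod_cast Nat.mul_pos hK hL
    have h4 : (1 : ℝ) ≤ L + S := by linarith [(Nat.cast_nonneg S : (0 : ℝ) ≤ S)]
    exact one_le_mul_of_one_le_of_one_le h3 (one_le_mul_of_one_le_of_one_le hL' h4)
  have hanalytic := pow_mul_abs_det_pow_mul_exp_le (k := fun j : Fin K × Fin L => j.1.1) (c := c)
    (x := x) (X := (L + S : ℝ) * (b₁ + b₂)) (ρ := exp 1)
    (fun i => (abs_of_nonneg (hx0 i)).trans_le (hxX i)) (Real.one_le_exp zero_le_one)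
    (zero_le_one.trans hX1) (fun j => by positivity)
  rw [hcard, ← Real.exp_nat_mul, mul_one] at hanalytic
  have hprod : ∏ j : Fin K × Fin L, (exp 1 * ((L + S : ℝ) * (b₁ + b₂))) ^ j.1.1 *
      exp (c j * (exp 1 * ((L + S : ℝ) * (b₁ + b₂)))) ≤
      exp (K * (1 + w) + 15 * L * (L + S)) ^ (K * L) := by
    rw [← hcard]
    refine (Finset.prod_le_prod (fun j _ => by positivity) fun j _ => ?_).trans
      (Finset.prod_const _).le
    rw [Real.exp_add, mul_one_add (K : ℝ), Real.exp_add, mul_pow]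
    refine mul_le_mul (mul_le_mul ?_ (hpow (hk' j) (by positivity) hw) (by positivity)
      (Real.exp_pos _).le) (Real.exp_le_exp.2 ?_) (Real.exp_pos _).le (by positivity)
    · rw [← Real.exp_nat_mul, mul_one]
      exact Real.exp_le_exp.2 (by exact_mod_cast hk' j)
    · have h3 : c j * (exp 1 * ((L + S : ℝ) * (b₁ + b₂))) =
          (j.2 : ℕ) * (exp 1 * ((L + S) * (ℓ₁ + ℓ₂ + Λ / b₂))) := by
        simp only [hc]
        rw [hΛ]
        field_simp
        ring
      have h4 : ℓ₁ + ℓ₂ + Λ / b₂ ≤ 5 + 1 / 5 := by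
        have h5 : Λ / b₂ ≤ 1 := by
          rw [div_le_one (by linarith)]
          linarith [le_abs_self Λ]
        linarith
      have h6 : exp 1 * ((L + S) * (ℓ₁ + ℓ₂ + Λ / b₂)) ≤ 15 * (L + S) := by
        have h7 := Real.exp_one_lt_d9
        have h8 : (0 : ℝ) ≤ L + S := by positivity
        have h9 : (0 : ℝ) < exp 1 := Real.exp_pos 1
        calc exp 1 * ((L + S) * (ℓ₁ + ℓ₂ + Λ / b₂)) ≤ exp 1 * ((L + S) * (5 + 1 / 5)) := by gcongr
          _ = (exp 1 * (5 + 1 / 5)) * (L + S) := by ring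
          _ ≤ _ := mul_le_mul_of_nonneg_right (by linarith) h8
      rw [h3]
      calc ((j.2 : ℕ) : ℝ) * (exp 1 * ((L + S) * (ℓ₁ + ℓ₂ + Λ / b₂))) ≤
            (j.2 : ℕ) * (15 * (L + S)) := by gcongr
        _ ≤ L * (15 * (L + S)) := by gcongr; exact j.2.2.le
        _ = _ := by ring
  have hBdet : |B.det| ≤ (K * L).factorial *
      (exp (K * (1 + w) + 15 * L * (L + S)) ^ (K * L) * exp (-(K * L * (K * L - 1) / 2 : ℕ))) := by
    rw [Real.exp_neg, ← mul_assoc, ← div_eq_mul_inv, le_div_iff₀ (Real.exp_pos _), mul_comm]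
    exact hanalytic.trans (mul_le_mul_of_nonneg_left hprod (Nat.cast_nonneg _))
  have hAdet : |A.det| ≤ |B.det| + |A.det - B.det| := by
    have := abs_sub_abs_le_abs_sub A.det B.det
    linarith
  refine hnorm.trans ((mul_le_mul_of_nonneg_right (hAdet.trans (add_le_add hBdet hdiff))
    (by positivity)).trans (le_of_eq ?_))
  rw [mul_comm 3 (K * L), pow_mul]
  ring

end NonunitSquares

namespace NonunitSquares

open Real

lemma cast_mul_sq_le_exp {h : ℕ} (hh : 100 ≤ h) : (2 : ℝ) ^ 24 * h ^ 2 ≤ exp (h / 2) := by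
  have hh' : (100 : ℝ) ≤ h := by exact_mod_cast hh
  have h1 := Real.pow_div_factorial_le_exp (h / 2 : ℝ) (by positivity) 12
  refine le_trans ?_ h1
  have h2 : (100 : ℝ) ^ 10 * h ^ 2 ≤ h ^ 12 := by
    calc (100 : ℝ) ^ 10 * h ^ 2 ≤ (h : ℝ) ^ 10 * h ^ 2 := by gcongr
      _ = _ := by ring
  rw [div_pow, show (Nat.factorial 12 : ℝ) = 479001600 by norm_num [Nat.factorial],
    le_div_iff₀ (by norm_num), le_div_iff₀ (by norm_num)]
  nlinarith [sq_nonneg (h : ℝ)]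

theorem exp_neg_le_abs_linear_form {b₁ b₂ h : ℕ} (hb : b₁.Coprime b₂) (hb₂ : 0 < b₂)
    (hb₂₁ : b₂ ≤ b₁) (hh : 100 ≤ h) (hb₁ : 4128 * h ≤ b₁) (hexp : (b₁ : ℝ) ≤ exp h) :
    exp (-(2 ^ 47 * h ^ 4)) ≤ |b₁ * log (2 + √3) - b₂ * log (8 + 3 * √7)| := by
  have hh' : (100 : ℝ) ≤ h := by exact_mod_cast hh
  set Λ := b₁ * log (2 + √3) - b₂ * log (8 + 3 * √7) with hΛ
  by_contra! hlt
  have hN := cast_mul_sq_le_exp hh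
  have hN2 : ((2 : ℝ) ^ 24 * h ^ 2) ^ 2 ≤ exp h := by
    rw [show (h : ℝ) = (2 : ℕ) * (h / 2) by push_cast; ring, Real.exp_nat_mul]
    push_cast
    rw [show (2 : ℝ) * (h / 2) = h by ring]
    exact pow_le_pow_left₀ (by positivity) hN 2
  have hw : ((32 * h : ℕ) + (4128 * h : ℕ) : ℝ) * (b₁ + b₂) ≤ exp (3 * h / 2) := by
    have h1 : (b₂ : ℝ) ≤ b₁ := by exact_mod_cast hb₂₁
    rw [show (3 * h / 2 : ℝ) = h / 2 + h by ring, Real.exp_add]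
    calc ((32 * h : ℕ) + (4128 * h : ℕ) : ℝ) * (b₁ + b₂) ≤
          ((32 * h : ℕ) + (4128 * h : ℕ) : ℝ) * (b₁ + b₁) := by gcongr
      _ = (8320 * h) * b₁ := by push_cast; ring
      _ ≤ exp (h / 2) * exp h := by
        refine mul_le_mul (le_trans ?_ hN) hexp (by positivity) (by positivity)
        nlinarith
  have hprod : 2 * (((2 ^ 19 * h * (32 * h) : ℕ) : ℝ) *
      ((32 * h : ℕ) * ((32 * h : ℕ) + (4128 * h : ℕ)) * |Λ|)) ≤ exp (h + 1 - 2 ^ 47 * h ^ 4) := by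
    have h1 : exp ((h : ℝ) + 1 - 2 ^ 47 * h ^ 4) =
        exp h * exp 1 * exp (-(2 ^ 47 * h ^ 4)) := by
      rw [← Real.exp_add, ← Real.exp_add, sub_eq_add_neg]
    have h2 : (2 : ℝ) ≤ exp 1 := by linarith [Real.exp_one_gt_d9]
    rw [h1]
    calc _ = ((2 : ℝ) ^ 24 * h ^ 2 * (133120 * h ^ 2)) * 2 * |Λ| := by push_cast; ring
      _ ≤ ((2 : ℝ) ^ 24 * h ^ 2 * (2 ^ 24 * h ^ 2)) * 2 * |Λ| := by gcongr; norm_num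
      _ ≤ exp h * exp 1 * exp (-(2 ^ 47 * h ^ 4)) := by
        rw [← sq]
        gcongr
  have hsmall : (h : ℝ) + 1 - 2 ^ 47 * h ^ 4 ≤ 0 := by
    have : (h : ℝ) * 100 ^ 3 ≤ h ^ 4 := by
      rw [show (h : ℝ) ^ 4 = h * h ^ 3 by ring]
      gcongr
    nlinarith
  have hΛ1 : ((2 ^ 19 * h * (32 * h) : ℕ) : ℝ) *
      ((32 * h : ℕ) * ((32 * h : ℕ) + (4128 * h : ℕ)) * |Λ|) ≤ 1 := by
    have h1 : exp ((h : ℝ) + 1 - 2 ^ 47 * h ^ 4) ≤ 1 := Real.exp_le_one_iff.2 hsmall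
    linarith
  have key := one_le_interpolation_bound (K := 2 ^ 19 * h) (L := 32 * h) (S := 4128 * h)
    (by omega) (by omega) hb (by omega) hb₂ hb₁ (by nlinarith) hw hΛ hΛ1
  have hfac : ((2 ^ 19 * h * (32 * h)).factorial : ℝ) ≤ exp (2 ^ 23 * h ^ 3) := by
    calc ((2 ^ 19 * h * (32 * h)).factorial : ℝ) ≤ ((2 ^ 19 * h * (32 * h) : ℕ) : ℝ) ^
          (2 ^ 19 * h * (32 * h)) := by exact_mod_cast Nat.factorial_le_pow _
      _ ≤ exp (h / 2) ^ (2 ^ 19 * h * (32 * h)) := by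
        refine pow_le_pow_left₀ (Nat.cast_nonneg _) (le_trans (le_of_eq ?_) hN) _
        push_cast
        ring
      _ = _ := by
        rw [← Real.exp_nat_mul]
        push_cast
        ring_nf
  have hD : (2 : ℝ) ^ 47 * h ^ 4 - 2 ^ 23 * h ^ 2 - 1 ≤
      (2 ^ 19 * h * (32 * h) * (2 ^ 19 * h * (32 * h) - 1) / 2 : ℕ) := by
    have h1 : 1 ≤ 2 ^ 19 * h * (32 * h) := by nlinarith
    have h2 := Nat.div_add_mod (2 ^ 19 * h * (32 * h) * (2 ^ 19 * h * (32 * h) - 1)) 2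
    have h3 := Nat.mod_lt (2 ^ 19 * h * (32 * h) * (2 ^ 19 * h * (32 * h) - 1)) two_pos
    generalize (2 ^ 19 * h * (32 * h) * (2 ^ 19 * h * (32 * h) - 1)) / 2 = D at *
    generalize (2 ^ 19 * h * (32 * h) * (2 ^ 19 * h * (32 * h) - 1)) % 2 = m at *
    zify [h1] at h2 h3
    have h4 : (2 : ℝ) * D + m = 2 ^ 19 * h * (32 * h) * (2 ^ 19 * h * (32 * h) - 1) := by
      exact_mod_cast h2
    have h5 : (m : ℝ) < 2 := by exact_mod_cast h3
    linarith
  have hE : (2 ^ 19 * h : ℕ) * (3 * h / 2 : ℝ) + 5 * (32 * h : ℕ) * ((32 * h : ℕ) + (4128 * h : ℕ)) =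
      1452032 * (h : ℝ) ^ 2 := by
    push_cast
    ring
  have hF : (2 ^ 19 * h : ℕ) * (1 + 3 * h / 2 : ℝ) +
      15 * (32 * h : ℕ) * ((32 * h : ℕ) + (4128 * h : ℕ)) =
      2783232 * (h : ℝ) ^ 2 + 524288 * h := by
    push_cast
    ring
  rw [hE, hF, ← Real.exp_nat_mul, ← Real.exp_nat_mul, ← Real.exp_nat_mul, ← Real.exp_add] at key
  have h3 : (h : ℝ) ^ 3 * 100 ≤ h ^ 4 := by
    rw [show (h : ℝ) ^ 4 = h ^ 3 * h by ring]
    gcongr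
  have h2 : (h : ℝ) ^ 2 * 100 ≤ h ^ 3 := by
    rw [show (h : ℝ) ^ 3 = h ^ 2 * h by ring]
    gcongr
  have h1 : (h : ℝ) * 100 ≤ h ^ 2 := by nlinarith
  have hfac4 := pow_le_pow_left₀ (Nat.cast_nonneg _) hfac 4
  rw [← Real.exp_nat_mul] at hfac4
  have hone := Real.exp_one_gt_d9
  have hexp1 : exp (-1) < 1 / 2 := by
    rw [Real.exp_neg, inv_lt_comm₀ (Real.exp_pos _) (by norm_num)]
    linarith
  refine lt_irrefl (1 : ℝ) ?_
  calc (1 : ℝ) ≤ _ := key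
    _ ≤ exp ((4 : ℕ) * (2 ^ 23 * h ^ 3)) *
        exp ((3 * (2 ^ 19 * h * (32 * h)) : ℕ) * (1452032 * (h : ℝ) ^ 2)) *
        (exp ((2 ^ 19 * h * (32 * h) : ℕ) * (2783232 * (h : ℝ) ^ 2 + 524288 * h) +
          -(2 ^ 47 * h ^ 4 - 2 ^ 23 * h ^ 2 - 1)) +
        exp ((2 ^ 19 * h * (32 * h) : ℕ) * (1452032 * (h : ℝ) ^ 2)) *
          exp (h + 1 - 2 ^ 47 * h ^ 4)) := by gcongr
    _ = exp (2 ^ 25 * h ^ 3 + 3 * 2 ^ 24 * 1452032 * h ^ 4 + 2 ^ 24 * 2783232 * h ^ 4 +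
          2 ^ 24 * 524288 * h ^ 3 - 2 ^ 47 * h ^ 4 + 2 ^ 23 * h ^ 2 + 1) +
        exp (2 ^ 25 * h ^ 3 + 4 * 2 ^ 24 * 1452032 * h ^ 4 + h + 1 - 2 ^ 47 * h ^ 4) := by
      rw [mul_add, ← Real.exp_add, ← Real.exp_add, ← Real.exp_add, ← Real.exp_add]
      push_cast
      ring_nf
    _ ≤ exp (-1) + exp (-1) := by
      gcongr
      · linarith
      · linarith
    _ < 1 := by linarith

end NonunitSquares

namespace NonunitSquares

open Real

/-- The sum of the integer parts of `D * (a / b) ^ k / (2 * k + 1)` for `k < T`. -/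
def floorArtanhSum (a b D : ℕ) : ℕ → ℕ
  | 0 => 0
  | k + 1 => floorArtanhSum a b D k + D * a ^ k / (b ^ k * (2 * k + 1))

lemma floorArtanhSum_le {a b D : ℕ} (T : ℕ) :
    (floorArtanhSum a b D T : ℝ) ≤ ∑ k ∈ Finset.range T, D * (1 / (2 * k + 1) * (a / b : ℝ) ^ k) := by
  induction T with
  | zero => simp [floorArtanhSum]
  | succ T ih =>
    rw [Finset.sum_range_succ, floorArtanhSum, Nat.cast_add]
    refine add_le_add ih (Nat.cast_div_le.trans (le_of_eq ?_))
    push_cast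
    rw [div_pow, div_mul_div_comm, one_mul, mul_div_assoc, mul_comm ((b : ℝ) ^ T)]

lemma sum_le_floorArtanhSum {a b D : ℕ} (hb : 0 < b) (T : ℕ) :
    ∑ k ∈ Finset.range T, D * (1 / (2 * k + 1) * (a / b : ℝ) ^ k) ≤ floorArtanhSum a b D T + T := by
  induction T with
  | zero => simp [floorArtanhSum]
  | succ T ih =>
    rw [Finset.sum_range_succ, floorArtanhSum]
    have h1 := Nat.lt_div_mul_add (a := D * a ^ T) (b := b ^ T * (2 * T + 1)) (by positivity)
    have h2 : (D : ℝ) * (1 / (2 * T + 1) * (a / b : ℝ) ^ T) ≤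
        (D * a ^ T / (b ^ T * (2 * T + 1)) : ℕ) + 1 := by
      generalize D * a ^ T / (b ^ T * (2 * T + 1)) = q at h1
      have h3 : (D * a ^ T : ℝ) ≤ (q + 1) * (b ^ T * (2 * T + 1)) := by
        rw [add_one_mul]
        exact_mod_cast h1.le
      have hb' : (0 : ℝ) < b := by exact_mod_cast hb
      rw [div_pow, div_mul_div_comm, one_mul, ← mul_div_assoc, mul_comm (2 * (T : ℝ) + 1),
        div_le_iff₀ (by positivity)]
      exact h3
    push_cast
    linarith

lemma log_sub_log_bounds {a b D T m : ℕ} {x : ℝ} (hx : 0 < x) (hxab : x ^ 2 = a / b) (hb : 0 < b)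
    (hab : 3 * a ≤ b) (hT : 3 * (D * a ^ T) ≤ 2 * b ^ T) (hm : m ^ 2 * b ≤ a * D ^ 2)
    (hm' : a * D ^ 2 ≤ (m + 1) ^ 2 * b) :
    2 * m * floorArtanhSum a b D T ≤ (D : ℝ) ^ 2 * (log (1 + x) - log (1 - x)) ∧
    (D : ℝ) ^ 2 * (log (1 + x) - log (1 - x)) ≤
      2 * (m + 1) * (floorArtanhSum a b D T + T + 1) := by
  have hb' : (0 : ℝ) < b := by exact_mod_cast hb
  have hq : (a / b : ℝ) ≤ 1 / 3 := by
    rw [div_le_div_iff₀ hb' (by norm_num)]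
    exact_mod_cast (by omega : a * 3 ≤ 1 * b)
  have hq0 : (0 : ℝ) ≤ a / b := by positivity
  have hx1 : |x| < 1 := by
    rw [abs_of_pos hx]
    nlinarith
  have hsum : HasSum (fun k : ℕ => D * (1 / (2 * k + 1) * (a / b : ℝ) ^ k))
      (D * (log (1 + x) - log (1 - x)) / (2 * x)) := by
    have h1 := (hasSum_log_sub_log_of_abs_lt_one hx1).mul_left (D / (2 * x))
    rw [← mul_div_right_comm] at h1
    refine h1.congr_fun fun k => ?_
    rw [← hxab]
    field_simp
    ring
  set s := D * (log (1 + x) - log (1 - x)) / (2 * x) with hs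
  have hterm (k : ℕ) : 0 ≤ D * (1 / (2 * k + 1) * (a / b : ℝ) ^ k) := by positivity
  have hlow : (floorArtanhSum a b D T : ℝ) ≤ s :=
    (floorArtanhSum_le T).trans (sum_le_hasSum _ (fun k _ => hterm k) hsum)
  have hup : s ≤ floorArtanhSum a b D T + T + 1 := by
    rw [← hsum.tsum_eq, ← hsum.summable.sum_add_tsum_nat_add T]
    refine add_le_add (sum_le_floorArtanhSum hb T) ?_
    have h1 := hasSum_geometric_of_lt_one (by norm_num : (0 : ℝ) ≤ 1 / 3) (by norm_num)
    have h2 := h1.mul_left ((D : ℝ) * (a / b) ^ T)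
    refine (Summable.tsum_le_tsum (fun k => ?_) ((summable_nat_add_iff T).2 hsum.summable)
      h2.summable).trans ?_
    · have h3 : 1 / (2 * ((k + T : ℕ) : ℝ) + 1) ≤ 1 := by
        rw [div_le_one (by positivity)]
        linarith [(Nat.cast_nonneg (k + T) : (0 : ℝ) ≤ _)]
      calc (D : ℝ) * (1 / (2 * ((k + T : ℕ) : ℝ) + 1) * (a / b : ℝ) ^ (k + T)) ≤
            D * (1 * (a / b : ℝ) ^ (k + T)) := by gcongr
        _ = D * (a / b) ^ T * (a / b) ^ k := by ring
        _ ≤ _ := by gcongr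
    · rw [h2.tsum_eq, div_pow, ← mul_div_assoc, div_mul_eq_mul_div, div_le_one (by positivity)]
      have h4 : (3 * (D * a ^ T) : ℝ) ≤ 2 * b ^ T := by exact_mod_cast hT
      norm_num
      linarith
  have hDx : (m : ℝ) ≤ D * x ∧ D * x ≤ m + 1 := by
    have h1 : (D * x) ^ 2 * b = a * D ^ 2 := by
      rw [mul_pow, hxab]
      field_simp
    have h2 : (m : ℝ) ^ 2 * b ≤ (D * x) ^ 2 * b := by
      rw [h1]
      exact_mod_cast hm
    have h3 : (D * x) ^ 2 * b ≤ ((m : ℝ) + 1) ^ 2 * b := by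
      rw [h1]
      exact_mod_cast hm'
    exact ⟨(sq_le_sq₀ (by positivity) (by positivity)).1 (le_of_mul_le_mul_right h2 hb'),
      (sq_le_sq₀ (by positivity) (by positivity)).1 (le_of_mul_le_mul_right h3 hb')⟩
  have heq : (D : ℝ) ^ 2 * (log (1 + x) - log (1 - x)) = 2 * (D * x) * s := by
    rw [hs]
    field_simp
  have hs0 : 0 ≤ s := (Nat.cast_nonneg _).trans hlow
  rw [heq]
  constructor
  · exact mul_le_mul (by linarith [hDx.1]) hlow (Nat.cast_nonneg _) (by positivity)
  · exact mul_le_mul (by linarith [hDx.2]) hup hs0 (by positivity)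

lemma log_three_eq : log (2 + √3) = log (1 + √3 / 3) - log (1 - √3 / 3) := by
  have h3 : √3 ^ 2 = 3 := Real.sq_sqrt (by norm_num)
  have h : √3 < 3 := by nlinarith [Real.sqrt_nonneg 3]
  have h1 : 0 < 1 - √3 / 3 := by linarith
  rw [← Real.log_div (by positivity) h1.ne']
  congr 1
  rw [eq_div_iff h1.ne']
  linear_combination (-1 / 3 : ℝ) * h3

lemma log_seven_eq : log (8 + 3 * √7) = 3 * (log (1 + √7 / 13) - log (1 - √7 / 13)) +
    4 * (log (1 + √7 / 14) - log (1 - √7 / 14)) := by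
  have h7 : √7 ^ 2 = 7 := Real.sq_sqrt (by norm_num)
  have h : √7 < 3 := by nlinarith [Real.sqrt_nonneg 7]
  have h1 : 0 < 1 - √7 / 13 := by linarith
  have h2 : 0 < 1 - √7 / 14 := by linarith
  rw [← Real.log_div (by positivity) h1.ne', ← Real.log_div (by positivity) h2.ne',
    show (3 : ℝ) = (3 : ℕ) by norm_num, show (4 : ℝ) = (4 : ℕ) by norm_num, ← Real.log_pow,
    ← Real.log_pow, ← Real.log_mul (by positivity) (by positivity)]
  congr 1
  have h14 : (1 + √7 / 14) / (1 - √7 / 14) = (29 + 4 * √7) / 27 := by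
    rw [div_eq_iff h2.ne']
    linear_combination (4 / 378 : ℝ) * h7
  have h13 : (1 + √7 / 13) / (1 - √7 / 13) = (88 + 13 * √7) / 81 := by
    rw [div_eq_iff h1.ne']
    linear_combination (1 / 81 : ℝ) * h7
  have h14' : ((29 + 4 * √7) / 27) ^ 2 = (953 + 232 * √7) / 729 := by
    linear_combination (16 / 729 : ℝ) * h7
  have h13' : ((88 + 13 * √7) / 81) ^ 2 = (8927 + 2288 * √7) / 6561 := by
    linear_combination (169 / 6561 : ℝ) * h7
  push_cast
  have h13'' : ((88 + 13 * √7) / 81) ^ 3 = (993784 + 317395 * √7) / 531441 := by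
    rw [pow_succ, h13']
    linear_combination (29744 / 531441 : ℝ) * h7
  have h14'' : ((29 + 4 * √7) / 27) ^ 4 = (1284977 + 442192 * √7) / 531441 := by
    rw [show ((29 + 4 * √7) / 27) ^ 4 = (((29 + 4 * √7) / 27) ^ 2) ^ 2 by ring, h14']
    linear_combination (53824 / 531441 : ℝ) * h7
  rw [h13, h14, h13'', h14'']
  linear_combination (-140349529840 / 531441 ^ 2 : ℝ) * h7

end NonunitSquares

namespace NonunitSquares

open Real

lemma log_sub_log_mem_Icc {a b D T m u P : ℕ} {x : ℝ} (hx : 0 < x) (hxab : x ^ 2 = a / b)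
    (hb : 0 < b) (hab : 3 * a ≤ b) (hD : 0 < D) (hT : 3 * (D * a ^ T) ≤ 2 * b ^ T)
    (hm : m ^ 2 * b ≤ a * D ^ 2) (hm' : a * D ^ 2 ≤ (m + 1) ^ 2 * b)
    (hu : u * D ^ 2 ≤ 2 * m * floorArtanhSum a b D T * P)
    (hu' : 2 * (m + 1) * (floorArtanhSum a b D T + T + 1) * P ≤ (u + 1) * D ^ 2) :
    P * (log (1 + x) - log (1 - x)) ∈ Set.Icc (u : ℝ) (u + 1) := by
  obtain ⟨h1, h2⟩ := log_sub_log_bounds hx hxab hb hab hT hm hm'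
  have hD' : (0 : ℝ) < D ^ 2 := by positivity
  have h3 : (u * D ^ 2 : ℝ) ≤ 2 * m * floorArtanhSum a b D T * P := by exact_mod_cast hu
  have h4 : (2 * (m + 1) * (floorArtanhSum a b D T + T + 1) * P : ℝ) ≤ (u + 1) * D ^ 2 := by
    exact_mod_cast hu'
  have h5 := mul_le_mul_of_nonneg_right h1 (Nat.cast_nonneg (α := ℝ) P)
  have h6 := mul_le_mul_of_nonneg_right h2 (Nat.cast_nonneg (α := ℝ) P)
  exact ⟨le_of_mul_le_mul_right (by linarith) hD', le_of_mul_le_mul_right (by linarith) hD'⟩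

lemma log_three_mem_Icc : (10 ^ 193 : ℕ) * log (2 + √3) ∈ Set.Icc
    ((13169578969248167086250463473079684440269819714675164797684722569204601854164439760742190134501017835564654365656049793198098168621063715327267633457099206769058311287762569581704704373368637119 : ℕ) : ℝ)
    ((13169578969248167086250463473079684440269819714675164797684722569204601854164439760742190134501017835564654365656049793198098168621063715327267633457099206769058311287762569581704704373368637119 : ℕ) + 1) := by
  rw [log_three_eq]
  refine log_sub_log_mem_Icc (a := 1) (b := 3) (D := 10 ^ 200) (T := 430)
    (m := 57735026918962576450914878050195745564760175127012687601860232648397767230293334569371539558574952522520871380513556767665664836499965082627055183736479121617603107730076852735599160670036155830775500)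
    (by positivity) ?_ (by decide) (by decide) (by positivity) ?_ ?_ ?_ ?_ ?_
  · rw [div_pow, Real.sq_sqrt (by norm_num)]
    norm_num
  all_goals decide +kernel

lemma log_thirteen_mem_Icc : (10 ^ 193 : ℕ) * (log (1 + √7 / 13) - log (1 - √7 / 13)) ∈ Set.Icc
    ((4128024615820486893795623232074796840342723614118679049559308596980689321953924960758739468361126704777268985602542478178523674491715461612637305980179511771997713135050055992012441252333727842 : ℕ) : ℝ)
    ((4128024615820486893795623232074796840342723614118679049559308596980689321953924960758739468361126704777268985602542478178523674491715461612637305980179511771997713135050055992012441252333727842 : ℕ) + 1) := by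
  refine log_sub_log_mem_Icc (a := 7) (b := 169) (D := 10 ^ 200) (T := 150)
    (m := 20351933162035312234627813489532772505463532177557309079756418916931298640232950982772252972881104697038958294911518946890334845297132421418672235045231597867055005613294799171536073806654517390007523)
    (by positivity) ?_ (by decide) (by decide) (by positivity) ?_ ?_ ?_ ?_ ?_
  · rw [div_pow, Real.sq_sqrt (by norm_num)]
    norm_num
  all_goals decide +kernel

lemma log_fourteen_mem_Icc : (10 ^ 193 : ℕ) * (log (1 + √7 / 14) - log (1 - √7 / 14)) ∈ Set.Icc
    ((3825629996418569411483286099403266169423102023024992296973712455718893548952373567340336426238178209323094068442737207603444453577360737790642303707978722970319392199085999498279360551574098804 : ℕ) : ℝ)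
    ((3825629996418569411483286099403266169423102023024992296973712455718893548952373567340336426238178209323094068442737207603444453577360737790642303707978722970319392199085999498279360551574098804 : ℕ) + 1) := by
  refine log_sub_log_mem_Icc (a := 1) (b := 28) (D := 10 ^ 200) (T := 150)
    (m := 18898223650461361360725826811709003040787565593446072716916674708579063023073454484002806331961025790107604130989267593541025213490194391317338503970572198019408219498059456373569211391893480433578414)
    (by positivity) ?_ (by decide) (by decide) (by positivity) ?_ ?_ ?_ ?_ ?_
  · rw [div_pow, Real.sq_sqrt (by norm_num)]
    norm_num
  all_goals decide +kernel

lemma le_abs_mul_sub_mul_of_unimodular {p q p' q' b₁ b₂ : ℤ} {x y δ : ℝ} (hδ : 0 ≤ δ)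
    (hdet : p' * q - p * q' = 1) (hA : δ ≤ q * x - p * y) (hA' : δ ≤ p' * y - q' * x)
    (hq : 0 ≤ q) (hq' : 0 ≤ q') (hb₁ : 0 < b₁) (hlt : b₁ < q + q') :
    δ ≤ |b₁ * x - b₂ * y| := by
  set m := p' * b₁ - q' * b₂ with hm
  set m' := q * b₂ - p * b₁ with hm'
  have h1 : b₁ = m * q + m' * q' := by
    rw [hm, hm']
    linear_combination (-b₁) * hdet
  have h2 : b₂ = m * p + m' * p' := by
    rw [hm, hm']
    linear_combination (-b₂) * hdet
  have h3 : (b₁ * x - b₂ * y : ℝ) = m * (q * x - p * y) - m' * (p' * y - q' * x) := by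
    rw [h1, h2]
    push_cast
    ring
  rw [h3]
  rcases lt_trichotomy m 0 with h | h | h
  · have hm0 : 0 ≤ m' := by
      by_contra! h4
      nlinarith
    have h4 : (m : ℝ) ≤ -1 := by exact_mod_cast (by omega : m ≤ -1)
    have h5 : (0 : ℝ) ≤ m' := by exact_mod_cast hm0
    refine le_trans ?_ (neg_le_abs _)
    nlinarith
  · have hm0 : m' ≠ 0 := by
      rintro h4
      rw [h, h4] at h1
      omega
    rw [h, Int.cast_zero, zero_mul, zero_sub, abs_neg, abs_mul]
    have h4 : (1 : ℝ) ≤ |(m' : ℝ)| := by exact_mod_cast Int.one_le_abs hm0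
    have h5 := hA'.trans (le_abs_self _)
    nlinarith
  · have hm0 : m' ≤ 0 := by
      by_contra! h4
      nlinarith
    have h4 : (1 : ℝ) ≤ m := by exact_mod_cast h
    have h5 : (m' : ℝ) ≤ 0 := by exact_mod_cast hm0
    refine le_trans ?_ (le_abs_self _)
    nlinarith

lemma ten_zpow_le_abs_linear_form {b₁ b₂ : ℕ} (hb₁ : 0 < b₁) (hlt : b₁ ≤ 10 ^ 90) :
    (1 / 10 ^ 92 : ℝ) ≤ |b₁ * log (2 + √3) - b₂ * log (8 + 3 * √7)| := by
  obtain ⟨h1, h1'⟩ := log_three_mem_Icc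
  obtain ⟨h2, h2'⟩ := log_thirteen_mem_Icc
  obtain ⟨h3, h3'⟩ := log_fourteen_mem_Icc
  have h7 := log_seven_eq
  push_cast at h1 h1' h2 h2' h3 h3'
  have key := le_abs_mul_sub_mul_of_unimodular (b₁ := b₁) (b₂ := b₂) (x := log (2 + √3))
    (y := log (8 + 3 * √7)) (δ := 1 / 10 ^ 92)
    (p := 124636795704072530982957615608331647783425969250702256164345392637163735095162124370851311)
    (q := 262025714518280683949035621635307805100802303864959253398194200866676124073034721913583336)
    (p' := 546861977038924142461256372615882481799600851556572012705013158715175359933416757903568230)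
    (q' := 1149675739552261400411006731662411452715751043560008342260770179226510843214369281161442689)
    (by positivity) (by norm_num) (by push_cast; linarith) (by push_cast; linarith) (by norm_num)
    (by norm_num) (by exact_mod_cast hb₁) (by
      have : (b₁ : ℤ) ≤ 10 ^ 90 := by exact_mod_cast hlt
      linarith)
  exact_mod_cast key

end NonunitSquares

namespace NonunitSquares

open Real

lemma exists_coprime_small_linear_form {j : ℕ} (hj : 100 ≤ j)
    (hbad : ¬HasNonunitRep (225 * (j : ℤ) ^ 2 + 10)) :
    ∃ b₁ b₂ : ℕ, b₁.Coprime b₂ ∧ 0 < b₁ ∧ 0 < b₂ ∧ (b₁ : ℝ) ≤ 600000 * j ^ 3 ∧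
      |b₁ * log (2 + √3) - b₂ * log (8 + 3 * √7)| ≤ 600000 * j ^ 3 * exp (-(j / 6)) := by
  obtain ⟨b₁, b₂, hb₁, hb₂, h1, h2, hΛ⟩ :=
    (isExceptional_of_not_hasNonunitRep hj hbad).exists_small_linear_form
  set n := 225 * j ^ 2 + 10 with hn
  have hj' : (100 : ℝ) ≤ j := by exact_mod_cast hj
  have hn' : (n : ℝ) = 225 * j ^ 2 + 10 := by rw [hn]; push_cast; ring
  have hs1 : 15 * (j : ℝ) ≤ √n := Real.le_sqrt_of_sq_le (by rw [hn']; linarith)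
  have hs2 : √n ≤ 16 * j := Real.sqrt_le_iff.2 ⟨by positivity, by rw [hn']; nlinarith⟩
  have hnj : n * √n ≤ 3616 * (j : ℝ) ^ 3 := by
    calc n * √n ≤ (226 * (j : ℝ) ^ 2) * (16 * j) := by
          gcongr
          rw [hn']
          nlinarith
      _ = _ := by ring
  have hexp : exp (-√n / 90) ≤ exp (-(j / 6)) := Real.exp_le_exp.2 (by linarith)
  obtain ⟨d, c₁, c₂, hd, hc, rfl, rfl⟩ := Nat.exists_coprime' (Nat.gcd_pos_of_pos_left b₂ hb₁)
  have hc₁ : 0 < c₁ := Nat.pos_of_mul_pos_right hb₁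
  have hc₂ : 0 < c₂ := Nat.pos_of_mul_pos_right hb₂
  have hd' : (1 : ℝ) ≤ d := by exact_mod_cast hd
  push_cast at h1 hΛ
  refine ⟨c₁, c₂, hc, hc₁, hc₂, ?_, ?_⟩
  · have : (c₁ : ℝ) ≤ c₁ * d := le_mul_of_one_le_right (by positivity) hd'
    have : (0 : ℝ) ≤ j ^ 3 := by positivity
    linarith
  · rw [show c₁ * d * log (2 + √3) - c₂ * d * log (8 + 3 * √7) =
      d * (c₁ * log (2 + √3) - c₂ * log (8 + 3 * √7)) by ring, abs_mul, Nat.abs_cast] at hΛ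
    calc _ ≤ d * |c₁ * log (2 + √3) - c₂ * log (8 + 3 * √7)| :=
          le_mul_of_one_le_left (abs_nonneg _) hd'
      _ ≤ _ := hΛ
      _ ≤ 165 * (3616 * j ^ 3) * exp (-(j / 6)) := by gcongr
      _ ≤ _ := by
        refine mul_le_mul_of_nonneg_right ?_ (Real.exp_pos _).le
        have : (0 : ℝ) ≤ j ^ 3 := by positivity
        linarith

lemma exp_bound_lt_of_le {j : ℕ} (hj : 1500 ≤ j) :
    600000 * (j : ℝ) ^ 3 * exp (-(j / 6)) < 1 / 10 ^ 92 := by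
  obtain ⟨t, rfl⟩ := Nat.exists_eq_add_of_le hj
  have h1 : (((1500 + t : ℕ) : ℝ)) ≤ 1500 * exp (t / 1500) := by
    have := Real.add_one_le_exp (t / 1500 : ℝ)
    push_cast
    linarith
  have h2 : exp (t / 1500 : ℝ) ^ 3 ≤ exp (t / 6) := by
    rw [← Real.exp_nat_mul]
    refine Real.exp_le_exp.2 ?_
    have : (0 : ℝ) ≤ t := Nat.cast_nonneg t
    push_cast
    linarith
  have h3 : (2.718 : ℝ) ^ 250 < exp 250 := by
    rw [show (250 : ℝ) = (250 : ℕ) * 1 by norm_num, Real.exp_nat_mul]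
    exact pow_lt_pow_left₀ (by linarith [Real.exp_one_gt_d9]) (by norm_num) (by norm_num)
  have h4 : exp (((1500 + t : ℕ) : ℝ) / 6) = exp 250 * exp (t / 6) := by
    rw [← Real.exp_add]
    push_cast
    ring_nf
  rw [Real.exp_neg, ← div_eq_mul_inv, div_lt_div_iff₀ (Real.exp_pos _) (by positivity), h4]
  calc 600000 * ((1500 + t : ℕ) : ℝ) ^ 3 * 10 ^ 92 ≤
        600000 * (1500 * exp (t / 1500)) ^ 3 * 10 ^ 92 := by gcongr
    _ = (600000 * 1500 ^ 3 * 10 ^ 92) * exp (t / 1500) ^ 3 := by ring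
    _ ≤ (600000 * 1500 ^ 3 * 10 ^ 92) * exp (t / 6) := by gcongr
    _ < exp 250 * exp (t / 6) := by
      refine mul_lt_mul_of_pos_right (lt_trans ?_ h3) (Real.exp_pos _)
      norm_num
    _ = _ := by ring

lemma pow_lt_exp_of_le {h : ℕ} (hh : 208 ≤ h) : (20000 * (h : ℝ)) ^ 4 ≤ exp ((h - 1) / 3) := by
  have hh' : (208 : ℝ) ≤ h := by exact_mod_cast hh
  have h1 : (24000000 : ℝ) ≤ exp 17 := by
    rw [show (17 : ℝ) = (17 : ℕ) * 1 by norm_num, Real.exp_nat_mul]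
    refine le_trans (by norm_num : (24000000 : ℝ) ≤ 2.718 ^ 17) ?_
    exact pow_le_pow_left₀ (by norm_num) (by linarith [Real.exp_one_gt_d9]) _
  have h2 : 20000 * (h : ℝ) ≤ exp ((h - 1) / 12) := by
    rw [show ((h : ℝ) - 1) / 12 = 17 + (h - 205) / 12 by ring, Real.exp_add]
    have := Real.add_one_le_exp (((h : ℝ) - 205) / 12)
    nlinarith
  calc (20000 * (h : ℝ)) ^ 4 ≤ exp ((h - 1) / 12) ^ 4 := by gcongr
    _ = _ := by
      rw [← Real.exp_nat_mul]
      congr 1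
      push_cast
      ring

theorem lt_of_not_hasNonunitRep {j : ℕ} (hj : 100 ≤ j)
    (hbad : ¬HasNonunitRep (225 * (j : ℤ) ^ 2 + 10)) : j < 1500 := by
  by_contra! hj2
  obtain ⟨b₁, b₂, hb, hb₁, hb₂, hle, hΛ⟩ := exists_coprime_small_linear_form hj hbad
  have hsmall := hΛ.trans_lt (exp_bound_lt_of_le hj2)
  rcases le_or_gt b₁ (10 ^ 90) with hlt | hlt
  · exact absurd (ten_zpow_le_abs_linear_form (b₂ := b₂) hb₁ hlt) hsmall.not_ge
  have hb₁' : (10 : ℝ) ^ 90 < b₁ := by exact_mod_cast hlt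
  have hb₁0 : (0 : ℝ) < b₁ := by positivity
  set h := ⌈log b₁⌉₊ with hh
  have hbexp : (b₁ : ℝ) ≤ exp h := by
    rw [← Real.log_le_iff_le_exp hb₁0]
    exact Nat.le_ceil _
  have hexpb : exp (h - 1) ≤ b₁ := by
    rw [← Real.le_log_iff_exp_le hb₁0]
    have := Nat.ceil_lt_add_one (a := log b₁) (Real.log_nonneg (by exact_mod_cast hb₁))
    linarith
  have hh208 : 208 ≤ h := by
    by_contra! h1
    have h2 : (h : ℝ) ≤ 207 := by exact_mod_cast Nat.le_of_lt_succ h1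
    have h3 : exp 207 < 2.7183 ^ 207 := by
      rw [show (207 : ℝ) = (207 : ℕ) * 1 by norm_num, Real.exp_nat_mul]
      exact pow_lt_pow_left₀ (by linarith [Real.exp_one_lt_d9]) (Real.exp_pos 1).le (by norm_num)
    have h4 : (2.7183 : ℝ) ^ 207 < 10 ^ 90 := by norm_num
    linarith [Real.exp_le_exp.2 h2]
  have hh' : (208 : ℝ) ≤ h := by exact_mod_cast hh208
  have hpow := pow_lt_exp_of_le hh208
  set u := exp (((h : ℝ) - 1) / 3) with hu
  have hu3 : u ^ 3 = exp (h - 1) := by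
    rw [hu, ← Real.exp_nat_mul]
    congr 1
    push_cast
    ring
  have hb₂₁ : b₂ ≤ b₁ := by
    by_contra! h1
    have h2 : (b₁ : ℝ) ≤ b₂ := by exact_mod_cast h1.le
    have h3 := two_le_log_seven
    have h4 : log (2 + √3) ≤ 3 / 2 := by
      have h5 : log (2 + √3) ≤ log (2 ^ 2) := log_le_log (by positivity) (by
        linarith [Real.sqrt_le_iff.2 (⟨by norm_num, by norm_num⟩ : (0 : ℝ) ≤ 2 ∧ (3 : ℝ) ≤ 2 ^ 2)])
      rw [log_pow] at h5
      push_cast at h5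
      linarith [log_two_lt_d9]
    have h6 : (1 : ℝ) ≤ b₁ := by exact_mod_cast hb₁
    have h7 := (abs_lt.1 hsmall).1
    have h8 : (1 / 10 ^ 92 : ℝ) < 1 / 2 := by norm_num
    nlinarith
  have hbig : 4128 * h ≤ b₁ := by
    have h1 : (4128 * h : ℝ) ≤ b₁ := by
      have h2 : (1 : ℝ) ≤ u := Real.one_le_exp (by linarith)
      have h3 : u ≤ u ^ 3 := le_self_pow₀ h2 (by norm_num)
      have h4 : 20000 * (h : ℝ) ≤ (20000 * (h : ℝ)) ^ 4 :=
        le_self_pow₀ (by linarith) (by norm_num)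
      linarith
    exact_mod_cast h1
  have hlow := (exp_neg_le_abs_linear_form hb hb₂ hb₂₁ (by omega) hbig hbexp).trans hΛ
  have hju : u ≤ 85 * j := by
    refine (pow_le_pow_iff_left₀ (Real.exp_pos _).le (by positivity) three_ne_zero).1 ?_
    rw [hu3, mul_pow]
    have : (0 : ℝ) ≤ j ^ 3 := by positivity
    linarith
  have hjpos : (100 : ℝ) ≤ j := by exact_mod_cast hj
  have hj3 : 600000 * (j : ℝ) ^ 3 ≤ exp (j / 12) := by
    refine le_trans ?_ (Real.pow_div_factorial_le_exp (j / 12 : ℝ) (by positivity) 12)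
    have h1 : (1500 : ℝ) ^ 9 * j ^ 3 ≤ j ^ 12 := by
      calc (1500 : ℝ) ^ 9 * j ^ 3 ≤ (j : ℝ) ^ 9 * j ^ 3 := by
            gcongr
            exact_mod_cast hj2
        _ = _ := by ring
    rw [div_pow, show (Nat.factorial 12 : ℝ) = 479001600 by norm_num [Nat.factorial],
      le_div_iff₀ (by norm_num), le_div_iff₀ (by norm_num)]
    have : (0 : ℝ) ≤ j ^ 3 := by positivity
    norm_num at h1 ⊢
    linarith
  have h1 : exp (-(2 ^ 47 * h ^ 4)) ≤ exp (-(j / 12)) := by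
    refine hlow.trans ((mul_le_mul_of_nonneg_right hj3 (Real.exp_pos _).le).trans (le_of_eq ?_))
    rw [← Real.exp_add]
    ring_nf
  have h2 := Real.exp_le_exp.1 h1
  have h3 : (0 : ℝ) < h ^ 4 := by positivity
  rw [mul_pow] at hpow
  norm_num at hpow
  linarith

end NonunitSquares

namespace NonunitSquares

set_option maxRecDepth 10000 in
lemma exists_small_prime : ∀ j < 1500, 2 ≤ j → ∃ p ∈ [7, 11, 13, 17, 19, 23, 29, 31],
    p < 5 * j ^ 2 ∧ ∃ t < p, (t ^ 2 + (225 * j ^ 2 + 10)) % p = 0 := by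
  decide +kernel

theorem eq_zero_or_eq_one_of_not_hasNonunitRep {j : ℕ}
    (hbad : ¬HasNonunitRep (225 * (j : ℤ) ^ 2 + 10)) : j = 0 ∨ j = 1 := by
  by_contra! h
  have hj : j < 1500 := by
    rcases lt_or_ge j 100 with h1 | h1
    · omega
    · exact lt_of_not_hasNonunitRep h1 hbad
  obtain ⟨p, hp, hpj, t, -, ht⟩ := exists_small_prime j hj (by omega)
  have hprime : p.Prime ∧ p ≠ 2 ∧ p ≠ 5 := by
    simp only [List.mem_cons, List.not_mem_nil, or_false] at hp
    rcases hp with rfl | rfl | rfl | rfl | rfl | rfl | rfl | rfl <;> norm_num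
  have hdvd : (p : ℤ) ∣ (t : ℤ) ^ 2 + (225 * (j : ℤ) ^ 2 + 10) := by
    exact_mod_cast Nat.dvd_of_mod_eq_zero ht
  exact absurd (le_of_dvd_sq_add hbad hprime.1 hprime.2.1 hprime.2.2 hdvd) hpj.not_ge

end NonunitSquares

/-- Any `n ∈ 𝒮₃` with `5 ∣ n` is a sum of three nonunit squares,
except `5, 10, 30, 35, 235`. -/
theorem stmt_3 (n : ℕ) (hn : 0 < n) (h5 : 5 ∣ n)
    (hS3 : ∃ a b c : ℤ, (n : ℤ) = a ^ 2 + b ^ 2 + c ^ 2)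
    (hexc : n ∉ ({5, 10, 30, 35, 235} : Set ℕ)) :
    ∃ x y z : ℤ, (n : ℤ) = x ^ 2 + y ^ 2 + z ^ 2 ∧
      x ^ 2 ≠ 1 ∧ y ^ 2 ≠ 1 ∧ z ^ 2 ≠ 1 := by
  by_contra hbad
  obtain ⟨a, b, c, h⟩ := hS3
  simp only [Set.mem_insert_iff, Set.mem_singleton_iff, not_or] at hexc
  rcases NonunitSquares.exists_eq_of_not_hasNonunitRep hbad (by exact_mod_cast h5) h with
    h1 | h1 | h1 | ⟨j, h1⟩
  · omega
  · omega
  · omega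
  · rw [h1] at hbad
    rcases NonunitSquares.eq_zero_or_eq_one_of_not_hasNonunitRep hbad with rfl | rfl
    · norm_num at h1
      omega
    · norm_num at h1
      omega
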